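/- Assume the Riemann Hypothesis. Let N be a sufficiently large integer and let y be an integer with N^{1/2} ≤ y ≤ N. Then ∫_{−1/2}^{1/2} |T(y; −α)| · |S̃(α) − 1/z|² dα ≪ N log² N log y, where z = 1/N − 2πiα, with an absolute implied constant. -/

import Mathlib

open Finset

/-- The von Mangoldt function. -/
noncomputable def vM (n : ℕ) : ℝ := ArithmeticFunction.vonMangoldt n

/-- `z = 1/N - 2πiα`. -/
noncomputable def zOf (N : ℕ) (α : ℝ) : ℂ :=
  1 / (N : ℂ) - 2 * (Real.pi : ℂ) * Complex.I * (α : ℂ)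

/-- The weighted exponential sum `S̃(α) = ∑_{n ≥ 1} Λ(n) e^{-n/N} e(nα)`. -/
noncomputable def Stilde (N : ℕ) (α : ℝ) : ℂ :=
  ∑' n : ℕ, (vM n : ℂ) * Real.exp (-(n : ℝ) / N) *
    Complex.exp (2 * (Real.pi : ℂ) * Complex.I * (n : ℂ) * (α : ℂ))


/-- `T(y; α) = ∑_{n=1}^{y} e(nα)`. -/
noncomputable def T (y : ℕ) (α : ℝ) : ℂ :=
  ∑ n ∈ Finset.Icc 1 y, Complex.exp (2 * (Real.pi : ℂ) * Complex.I * (n : ℂ) * (α : ℂ))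

/-- The numerator of a Blaschke factor, normalised by the radius of the disc. -/
noncomputable def blaschkeConj (R : ℝ) (Z : Multiset ℂ) (w : ℂ) : ℂ :=
  (Z.map fun ρ => ((R : ℂ) ^ 2 - (starRingEnd ℂ) ρ * w) / R).prod

theorem differentiable_blaschkeConj (R : ℝ) (Z : Multiset ℂ) :
    Differentiable ℂ (blaschkeConj R Z) := by
  induction Z using Multiset.induction with
  | empty => unfold blaschkeConj; simp
  | cons a Z ih =>
    have : blaschkeConj R (a ::ₘ Z) =
        fun w => ((R : ℂ) ^ 2 - (starRingEnd ℂ) a * w) / R * blaschkeConj R Z w := by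
      ext w; simp [blaschkeConj]
    rw [this]
    fun_prop

theorem norm_blaschkeConj_of_norm_eq {R : ℝ} (hR : 0 < R) (Z : Multiset ℂ) {w : ℂ} (hw : ‖w‖ = R) :
    ‖blaschkeConj R Z w‖ = ‖(Z.map fun ρ => w - ρ).prod‖ := by
  induction Z using Multiset.induction with
  | empty => simp [blaschkeConj]
  | cons a Z ih =>
    have h1 : (R : ℂ) ^ 2 = (starRingEnd ℂ) w * w := by
      rw [mul_comm, Complex.mul_conj, Complex.normSq_eq_norm_sq, hw]; norm_cast
    have h2 : ‖((R : ℂ) ^ 2 - (starRingEnd ℂ) a * w) / R‖ = ‖w - a‖ := by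
      rw [h1, ← sub_mul, ← map_sub, norm_div, norm_mul, RCLike.norm_conj, hw]
      simp [abs_of_pos hR, hR.ne']
    simp only [blaschkeConj, Multiset.map_cons, Multiset.prod_cons, norm_mul] at ih ⊢
    rw [h2, ih]

theorem blaschkeConj_zero_norm {R : ℝ} (hR : 0 < R) (Z : Multiset ℂ) :
    ‖blaschkeConj R Z 0‖ = R ^ Z.card := by
  induction Z using Multiset.induction with
  | empty => simp [blaschkeConj]
  | cons a Z ih =>
    simp only [blaschkeConj, Multiset.map_cons, Multiset.prod_cons, norm_mul] at ih ⊢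
    rw [ih]
    have : ‖((R : ℂ) ^ 2 - (starRingEnd ℂ) a * 0) / R‖ = R := by
      rw [mul_zero, sub_zero, pow_two, mul_div_assoc, div_self (by exact_mod_cast hR.ne')]
      simp [abs_of_pos hR]
    rw [this, Multiset.card_cons, pow_succ]; ring

theorem prod_sub_norm_le {r : ℝ} (Z : Multiset ℂ) (hZ : ∀ ρ ∈ Z, ‖ρ‖ ≤ r) :
    ‖(Z.map fun ρ => (0 : ℂ) - ρ).prod‖ ≤ r ^ Z.card := by
  induction Z using Multiset.induction with
  | empty => simp
  | cons a Z ih =>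
    simp only [Multiset.map_cons, Multiset.prod_cons, norm_mul, Multiset.card_cons, pow_succ]
    rw [mul_comm]
    have ha := hZ a (Multiset.mem_cons_self _ _)
    have := ih fun ρ h => hZ ρ (Multiset.mem_cons_of_mem h)
    have h0 : ‖0 - a‖ ≤ r := by simpa using ha
    have hr0 : 0 ≤ r := (norm_nonneg a).trans ha
    gcongr

theorem logDeriv_multiset_prod_sub (Z : Multiset ℂ) {w : ℂ} (hw : ∀ ρ ∈ Z, w ≠ ρ) :
    (Z.map fun ρ => w - ρ).prod ≠ 0 ∧
    logDeriv (fun w => (Z.map fun ρ => w - ρ).prod) w = (Z.map fun ρ => 1 / (w - ρ)).sum ∧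
    Differentiable ℂ (fun w => (Z.map fun ρ => w - ρ).prod) := by
  induction Z using Multiset.induction with
  | empty => simp
  | cons a Z ih =>
    obtain ⟨h1, h2, h3⟩ := ih fun ρ h => hw ρ (Multiset.mem_cons_of_mem h)
    have ha : w - a ≠ 0 := sub_ne_zero.mpr (hw a (Multiset.mem_cons_self _ _))
    simp only [Multiset.map_cons, Multiset.prod_cons, Multiset.sum_cons]
    refine ⟨mul_ne_zero ha h1, ?_, by fun_prop⟩
    rw [logDeriv_mul (f := fun w => w - a) w ha h1 (by fun_prop) (h3 w), h2]
    simp [logDeriv_apply]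

theorem norm_logDeriv_blaschkeConj_le {R r : ℝ} (hR : 0 < R) (Z : Multiset ℂ)
    (hZ : ∀ ρ ∈ Z, ‖ρ‖ ≤ r) {w : ℂ} (hr : r * ‖w‖ < R ^ 2) :
    blaschkeConj R Z w ≠ 0 ∧
    ‖logDeriv (blaschkeConj R Z) w‖ ≤ Z.card * (r / (R ^ 2 - r * ‖w‖)) := by
  induction Z using Multiset.induction with
  | empty =>
    have : blaschkeConj R 0 = fun _ => 1 := by ext w; simp [blaschkeConj]
    simp [this]
  | cons a Z ih =>
    obtain ⟨h1, h2⟩ := ih fun ρ h => hZ ρ (Multiset.mem_cons_of_mem h)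
    have ha := hZ a (Multiset.mem_cons_self _ _)
    have hRc : (R : ℂ) ≠ 0 := by exact_mod_cast hR.ne'
    have : blaschkeConj R (a ::ₘ Z) =
        fun w => ((R : ℂ) ^ 2 - (starRingEnd ℂ) a * w) / R * blaschkeConj R Z w := by
      ext w; simp [blaschkeConj]
    have hlow : R ^ 2 - r * ‖w‖ ≤ ‖(R : ℂ) ^ 2 - (starRingEnd ℂ) a * w‖ := by
      have := norm_sub_norm_le ((R : ℂ) ^ 2) ((starRingEnd ℂ) a * w)
      rw [norm_mul, RCLike.norm_conj] at this
      have h4 : ‖(R : ℂ) ^ 2‖ = R ^ 2 := by simp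
      have h5 : ‖a‖ * ‖w‖ ≤ r * ‖w‖ := by gcongr
      linarith
    have hne : (R : ℂ) ^ 2 - (starRingEnd ℂ) a * w ≠ 0 := by
      intro h; rw [h] at hlow; simp at hlow; linarith
    rw [this]
    have hne2 : ((R : ℂ) ^ 2 - (starRingEnd ℂ) a * w) / R ≠ 0 := div_ne_zero hne hRc
    refine ⟨mul_ne_zero hne2 h1, ?_⟩
    rw [logDeriv_mul (f := fun w => ((R : ℂ) ^ 2 - (starRingEnd ℂ) a * w) / R) w hne2 h1
      (by fun_prop) (differentiable_blaschkeConj R Z w)]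
    have h6 : logDeriv (fun w => ((R : ℂ) ^ 2 - (starRingEnd ℂ) a * w) / R) w
        = - (starRingEnd ℂ) a / ((R : ℂ) ^ 2 - (starRingEnd ℂ) a * w) := by
      rw [logDeriv_apply]
      have : HasDerivAt (fun w => ((R : ℂ) ^ 2 - (starRingEnd ℂ) a * w) / R)
          ((0 - (starRingEnd ℂ) a * 1) / R) w :=
        (((hasDerivAt_id w).const_mul _).const_sub _ |>.congr_deriv (by simp)).div_const _
      rw [this.deriv]
      field_simp
      simp
    refine (norm_add_le _ _).trans ?_
    have h7 : ‖- (starRingEnd ℂ) a / ((R : ℂ) ^ 2 - (starRingEnd ℂ) a * w)‖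
        ≤ r / (R ^ 2 - r * ‖w‖) := by
      rw [norm_div, norm_neg, RCLike.norm_conj]
      have : 0 ≤ r := (norm_nonneg a).trans ha
      gcongr
    rw [h6, Multiset.card_cons]
    push_cast
    linarith

/-- Jensen-type bound for the number of linear factors of an entire function in a disc. -/
theorem card_factor_bound {f g : ℂ → ℂ} {R r M : ℝ} (hr : 0 < r) (hrR : r < R)
    (hg : Differentiable ℂ g) (Z : Multiset ℂ) (hZ : ∀ ρ ∈ Z, ‖ρ‖ ≤ r)
    (hfg : ∀ w, f w = (Z.map fun ρ => w - ρ).prod * g w)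
    (hM : ∀ w, ‖w‖ ≤ R → ‖f w‖ ≤ M) :
    (∀ w, ‖w‖ ≤ R → ‖g w * blaschkeConj R Z w‖ ≤ M) ∧
      ‖f 0‖ * (R / r) ^ Z.card ≤ ‖g 0 * blaschkeConj R Z 0‖ := by
  have hR : 0 < R := hr.trans hrR
  constructor
  · intro w hw
    refine Complex.norm_le_of_forall_mem_frontier_norm_le (U := Metric.ball 0 R)
      Metric.isBounded_ball (f := fun w => g w * blaschkeConj R Z w)
      ((hg.mul (differentiable_blaschkeConj R Z)).diffContOnCl) ?_ ?_
    · intro x hx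
      rw [frontier_ball _ hR.ne', mem_sphere_zero_iff_norm] at hx
      rw [norm_mul, norm_blaschkeConj_of_norm_eq hR Z hx, ← norm_mul, mul_comm, ← hfg]
      exact hM x hx.le
    · rw [closure_ball _ hR.ne']; simpa using hw
  · rw [norm_mul, blaschkeConj_zero_norm hR, hfg 0, norm_mul, div_pow]
    have h := prod_sub_norm_le Z hZ
    have hp : 0 < r ^ Z.card := by positivity
    calc _ ≤ r ^ Z.card * ‖g 0‖ * (R ^ Z.card / r ^ Z.card) := by gcongr
      _ = _ := by field_simp

/-- An entire function not vanishing at the origin splits off all its zeros in a closed disc. -/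
theorem exists_factor_zeros {f : ℂ → ℂ} {R r M : ℝ} (hr : 0 < r) (hrR : r < R)
    (hf : Differentiable ℂ f) (hf0 : f 0 ≠ 0) (hM : ∀ w, ‖w‖ ≤ R → ‖f w‖ ≤ M) :
    ∃ (Z : Multiset ℂ) (g : ℂ → ℂ), Differentiable ℂ g ∧ (∀ ρ ∈ Z, ‖ρ‖ ≤ r) ∧
      (∀ w, f w = (Z.map fun ρ => w - ρ).prod * g w) ∧ ∀ w, ‖w‖ ≤ r → g w ≠ 0 := by
  classical
  let P : ℕ → Prop := fun n => ∃ (Z : Multiset ℂ) (g : ℂ → ℂ), Z.card = n ∧ Differentiable ℂ g ∧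
    (∀ ρ ∈ Z, ‖ρ‖ ≤ r) ∧ ∀ w, f w = (Z.map fun ρ => w - ρ).prod * g w
  have hP0 : P 0 := ⟨0, f, by simp, hf, by simp, by simp⟩
  obtain ⟨B, hB⟩ : ∃ B : ℕ, M / ‖f 0‖ < (R / r) ^ B :=
    pow_unbounded_of_one_lt _ ((one_lt_div hr).mpr hrR)
  have hbound : ∀ n, P n → n ≤ B := by
    rintro n ⟨Z, g, rfl, hg, hZ, hfg⟩
    by_contra! hlt
    obtain ⟨h1, h2⟩ := card_factor_bound hr hrR hg Z hZ hfg hM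
    have h3 := h2.trans (h1 0 (by simpa using (hr.trans hrR).le))
    have h4 : (R / r) ^ B ≤ (R / r) ^ Z.card :=
      pow_le_pow_right₀ ((one_lt_div hr).mpr hrR).le hlt.le
    have h5 : 0 < ‖f 0‖ := norm_pos_iff.mpr hf0
    rw [div_lt_iff₀ h5] at hB
    nlinarith
  obtain ⟨Z, g, hc, hg, hZ, hfg⟩ := Nat.findGreatest_spec (P := P) (Nat.zero_le B) hP0
  refine ⟨Z, g, hg, hZ, hfg, fun ρ hρ h0 => ?_⟩
  have hP : P (Nat.findGreatest P B + 1) := by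
    refine ⟨ρ ::ₘ Z, dslope g ρ, by simp [hc], ?_, ?_, fun w => ?_⟩
    · rw [← differentiableOn_univ] at hg ⊢
      exact (Complex.differentiableOn_dslope Filter.univ_mem).mpr hg
    · intro x hx
      rcases Multiset.mem_cons.mp hx with rfl | h
      · exact hρ
      · exact hZ x h
    · have := sub_smul_dslope g ρ w
      rw [h0, sub_zero, smul_eq_mul] at this
      rw [hfg w, Multiset.map_cons, Multiset.prod_cons, ← this]; ring
  have := Nat.le_findGreatest (hbound _ hP) hP
  omega

/-- Bound for the logarithmic derivative of a zero-free bounded function. -/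
theorem norm_logDeriv_le_of_zero_free {G : ℂ → ℂ} {r : ℝ} (hG : Differentiable ℂ G)
    (hr : 0 < r) (h0 : ∀ w, ‖w‖ < r → G w ≠ 0) {A : ℝ} (hA : 0 < A)
    (hM : ∀ w, ‖w‖ < r → ‖G w‖ ≤ Real.exp A * ‖G 0‖) {a b : ℝ} (hab : a < b) (ha : 0 ≤ a)
    (hb : b < r)
    {w : ℂ} (hw : ‖w‖ ≤ a) :
    ‖logDeriv G w‖ ≤ (2 * A * b / (r - b)) / (b - a) := by
  have hd : DifferentiableOn ℂ (logDeriv G) (Metric.ball 0 r) := by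
    intro x hx
    have hx' : G x ≠ 0 := h0 x (by simpa using hx)
    exact ((hG.deriv x).div (hG x) hx').differentiableWithinAt
  obtain ⟨H, hH⟩ := hd.isExactOn_ball
  have hH' : ∀ x ∈ Metric.ball (0 : ℂ) r, HasDerivAt (fun x => H x - H 0) (logDeriv G x) x :=
    fun x hx => (hH x hx).sub_const _
  have hGexp : ∀ x ∈ Metric.ball (0 : ℂ) r, G x = G 0 * Complex.exp (H x - H 0) := by
    have hder : ∀ x ∈ Metric.ball (0 : ℂ) r,
        HasDerivAt (fun x => G x * Complex.exp (-(H x - H 0))) 0 x := by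
      intro x hx
      have h1 := (hG x).hasDerivAt.mul ((hH' x hx).neg.cexp)
      refine h1.congr_deriv ?_
      have hx' : G x ≠ 0 := h0 x (by simpa using hx)
      rw [logDeriv_apply]; simp only [Pi.neg_apply]; field_simp; ring
    intro x hx
    have hconv : Convex ℝ (Metric.ball (0 : ℂ) r) := convex_ball _ _
    have := hconv.is_const_of_fderivWithin_eq_zero (𝕜 := ℂ)
      (f := fun x => G x * Complex.exp (-(H x - H 0)))
      (fun y hy => (hder y hy).differentiableAt.differentiableWithinAt) (fun y hy => by
        have := (hder y hy).hasFDerivAt.hasFDerivWithinAt (s := Metric.ball (0 : ℂ) r)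
        rw [this.fderivWithin (Metric.isOpen_ball.uniqueDiffWithinAt hy)]
        ext; simp) hx (Metric.mem_ball_self hr)
    simp only [sub_self, neg_zero, Complex.exp_zero, mul_one, Complex.exp_neg] at this
    rw [← this]; field_simp
  have hre : ∀ x ∈ Metric.ball (0 : ℂ) r, (H x - H 0).re ≤ A := by
    intro x hx
    have h1 := hM x (by simpa using hx)
    rw [hGexp x hx, norm_mul, Complex.norm_exp, mul_comm] at h1
    have h2 : 0 < ‖G 0‖ := norm_pos_iff.mpr (h0 0 (by simpa using hr))
    exact Real.exp_le_exp.mp (le_of_mul_le_mul_right h1 h2)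
  have hHd : DifferentiableOn ℂ (fun x => H x - H 0) (Metric.ball 0 r) :=
    fun x hx => (hH' x hx).differentiableAt.differentiableWithinAt
  have hb0 : 0 < b := ha.trans_lt hab
  have hbd : ∀ x, ‖x‖ ≤ b → ‖H x - H 0‖ ≤ 2 * A * b / (r - b) := by
    intro x hx
    have h1 := Complex.borelCaratheodory_zero (f := fun x => H x - H 0) hA hHd
      (fun y hy => hre y hy) hr (z := x) (by simpa using hx.trans_lt hb) (by simp)
    refine h1.trans ?_
    have : 0 < r - b := by linarith
    gcongr
  have hcau := Complex.norm_deriv_le_of_forall_mem_sphere_norm_le (c := w) (R := b - a)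
    (f := fun x => H x - H 0) (C := 2 * A * b / (r - b)) (by linarith) ?_ ?_
  · rw [(hH' w (by simpa using (hw.trans_lt hab).trans hb)).deriv] at hcau
    exact hcau
  · refine hHd.diffContOnCl_ball (c := w) (R := b - a) fun x hx => ?_
    have : ‖x - w‖ ≤ b - a := by simpa [dist_eq_norm] using hx
    have := norm_add_le (x - w) w
    simp only [sub_add_cancel] at this
    simp; linarith
  · intro x hx
    apply hbd
    have : ‖x - w‖ = b - a := by simpa [dist_eq_norm] using hx
    have := norm_add_le (x - w) w
    simp only [sub_add_cancel] at this
    linarith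

/-- Local partial fraction expansion of `f' / f` for an entire function `f`. -/
theorem exists_local_partial_fractions {f : ℂ → ℂ} {A : ℝ} (hA : 0 < A)
    (hf : Differentiable ℂ f) (hf0 : f 0 ≠ 0)
    (hM : ∀ w, ‖w‖ ≤ 19 / 10 → ‖f w‖ ≤ Real.exp A * ‖f 0‖) :
    ∃ Z : Multiset ℂ, (∀ ρ ∈ Z, f ρ = 0 ∧ ‖ρ‖ ≤ 17 / 10) ∧ (Z.card : ℝ) ≤ 18 * A ∧
      ∀ w, ‖w‖ ≤ 3 / 2 → f w ≠ 0 →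
        ‖logDeriv f w - (Z.map fun ρ => 1 / (w - ρ)).sum‖ ≤ 1000 * A := by
  obtain ⟨Z, g, hg, hZ, hfg, hg0⟩ := exists_factor_zeros (r := 17 / 10) (R := 19 / 10)
    (by norm_num) (by norm_num) hf hf0 hM
  obtain ⟨hG1, hG2⟩ := card_factor_bound (r := 17 / 10) (R := 19 / 10)
    (by norm_num) (by norm_num) hg Z hZ hfg hM
  have hf0' : 0 < ‖f 0‖ := norm_pos_iff.mpr hf0
  have hpow : ((19 / 10 / (17 / 10) : ℝ)) ^ Z.card ≤ Real.exp A := by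
    have := hG2.trans (hG1 0 (by norm_num))
    rw [mul_comm] at this
    exact le_of_mul_le_mul_right this hf0'
  have hcard : (Z.card : ℝ) ≤ 18 * A := by
    have h1 := Real.log_le_log (by positivity) hpow
    rw [Real.log_exp, Real.log_pow] at h1
    have h2 : (1 : ℝ) / 18 ≤ Real.log (19 / 10 / (17 / 10)) := by
      have := Real.one_sub_inv_le_log_of_pos (x := 19 / 10 / (17 / 10)) (by norm_num)
      norm_num at this ⊢; linarith
    have h3 : (0 : ℝ) ≤ Z.card := by positivity
    nlinarith
  refine ⟨Z, fun ρ hρ => ?_, hcard, fun w hw hfw => ?_⟩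
  · refine ⟨?_, hZ ρ hρ⟩
    rw [hfg ρ, Multiset.prod_eq_zero (Multiset.mem_map.mpr ⟨ρ, hρ, sub_self ρ⟩), zero_mul]
  have hBd := differentiable_blaschkeConj (19 / 10) Z
  set G : ℂ → ℂ := fun w => g w * blaschkeConj (19 / 10) Z w with hGdef
  have hBne : ∀ x : ℂ, ‖x‖ ≤ 17 / 10 → blaschkeConj (19 / 10) Z x ≠ 0 := fun x hx =>
    (norm_logDeriv_blaschkeConj_le (R := 19 / 10) (r := 17 / 10) (by norm_num) Z hZ
      (by nlinarith)).1
  have hpow1 : (1 : ℝ) ≤ (19 / 10 / (17 / 10) : ℝ) ^ Z.card := one_le_pow₀ (by norm_num)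
  have hGd := norm_logDeriv_le_of_zero_free (G := G) (r := 17 / 10) (A := A) (a := 3 / 2)
    (b := 16 / 10) (w := w) (hg.mul hBd) (by norm_num)
    (fun x hx => mul_ne_zero (hg0 x hx.le) (hBne x hx.le)) hA (fun x hx => by
      refine (hG1 x (by linarith)).trans ?_
      have : ‖f 0‖ ≤ ‖G 0‖ := le_trans (by nlinarith) hG2
      gcongr) (by norm_num) (by norm_num) (by norm_num) hw
  have hPne : (Z.map fun ρ => w - ρ).prod ≠ 0 := by
    intro h; apply hfw; rw [hfg, h, zero_mul]
  have hwZ : ∀ ρ ∈ Z, w ≠ ρ := by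
    rintro ρ hρ rfl
    exact hPne (Multiset.prod_eq_zero (Multiset.mem_map.mpr ⟨w, hρ, sub_self w⟩))
  obtain ⟨-, hP2, hP3⟩ := logDeriv_multiset_prod_sub Z hwZ
  have hgw : g w ≠ 0 := hg0 w (by linarith)
  have hflog : logDeriv f w = (Z.map fun ρ => 1 / (w - ρ)).sum + logDeriv g w := by
    have : f = fun w => (Z.map fun ρ => w - ρ).prod * g w := funext hfg
    rw [this, logDeriv_mul w hPne hgw (hP3 w) (hg w), hP2]
  have hGlog : logDeriv G w = logDeriv g w + logDeriv (blaschkeConj (19 / 10) Z) w :=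
    logDeriv_mul w hgw (hBne w (by linarith)) (hg w) (hBd w)
  obtain ⟨-, hB⟩ := norm_logDeriv_blaschkeConj_le (R := 19 / 10) (r := 17 / 10) (w := w)
    (by norm_num) Z hZ (by nlinarith)
  have hfrac : (17 / 10 : ℝ) / ((19 / 10) ^ 2 - 17 / 10 * ‖w‖) ≤ 2 := by
    rw [div_le_iff₀ (by nlinarith)]; nlinarith
  have e : logDeriv f w - (Z.map fun ρ => 1 / (w - ρ)).sum
      = logDeriv G w - logDeriv (blaschkeConj (19 / 10) Z) w := by
    rw [hflog, hGlog]; ring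
  rw [e]
  refine (norm_sub_le _ _).trans ?_
  have hnn : (0 : ℝ) ≤ 17 / 10 / ((19 / 10) ^ 2 - 17 / 10 * ‖w‖) :=
    div_nonneg (by norm_num) (by nlinarith)
  have : (Z.card : ℝ) * (17 / 10 / ((19 / 10) ^ 2 - 17 / 10 * ‖w‖)) ≤ 18 * A * 2 :=
    mul_le_mul hcard hfrac hnn (by positivity)
  have : (2 * A * (16 / 10) / (17 / 10 - 16 / 10)) / (16 / 10 - 3 / 2) = 320 * A := by ring
  linarith

/-- The terms of an Euler-Maclaurin series for `(s - 1) * ζ(s)`. -/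
noncomputable def zetaTerm (n : ℕ) (s : ℂ) : ℂ :=
  (s - 1) * ((n + 1 : ℝ) : ℂ) ^ (-s) +
    (((n + 1 + 1 : ℝ) : ℂ) ^ (1 - s) - ((n + 1 : ℝ) : ℂ) ^ (1 - s))

theorem norm_zetaTerm_le (n : ℕ) {s : ℂ} (hs : 0 < s.re) :
    ‖zetaTerm n s‖ ≤ ‖s - 1‖ * ‖s‖ * (n + 1 : ℝ) ^ (-s.re - 1) := by
  set a : ℝ := n + 1 with ha
  have ha0 : 0 < a := by positivity
  rcases eq_or_ne s 1 with rfl | hs1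
  · simp [zetaTerm]
  have hs0 : s ≠ 0 := by rintro rfl; simp at hs
  have hdiff : ∀ x ∈ Set.Icc a (a + 1), ‖(x : ℂ) ^ (-s) - (a : ℂ) ^ (-s)‖
      ≤ ‖s‖ * a ^ (-s.re - 1) := by
    intro x hx
    have hle := Convex.norm_image_sub_le_of_norm_hasDerivWithin_le
      (f := fun x : ℝ => (x : ℂ) ^ (-s)) (f' := fun x : ℝ => -s * (x : ℂ) ^ (-s - 1))
      (s := Set.Icc a (a + 1)) (C := ‖s‖ * a ^ (-s.re - 1)) (x := a) (y := x) ?_ ?_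
      (convex_Icc _ _) ⟨le_rfl, by linarith⟩ hx
    · refine hle.trans ?_
      have : ‖x - a‖ ≤ 1 := by
        rw [Real.norm_eq_abs, abs_of_nonneg (by linarith [hx.1])]; linarith [hx.2]
      nlinarith [mul_nonneg (norm_nonneg s) (Real.rpow_nonneg ha0.le (-s.re - 1))]
    · intro y hy
      exact (hasDerivAt_ofReal_cpow_const (by linarith [hy.1])
        (neg_ne_zero.mpr hs0)).hasDerivWithinAt
    · intro y hy
      have hy0 : 0 < y := ha0.trans_le hy.1
      rw [norm_mul, norm_neg, Complex.norm_cpow_eq_rpow_re_of_pos hy0]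
      simp only [Complex.sub_re, Complex.neg_re, Complex.one_re]
      refine mul_le_mul_of_nonneg_left ?_ (norm_nonneg _)
      exact Real.rpow_le_rpow_of_nonpos ha0 hy.1 (by linarith)
  have hle := Convex.norm_image_sub_le_of_norm_hasDerivWithin_le
      (f := fun x : ℝ => (s - 1) * (a : ℂ) ^ (-s) * x + (x : ℂ) ^ (1 - s))
      (f' := fun x : ℝ => (s - 1) * (a : ℂ) ^ (-s) + (1 - s) * (x : ℂ) ^ (-s))
      (s := Set.Icc a (a + 1)) (C := ‖s - 1‖ * ‖s‖ * a ^ (-s.re - 1)) (x := a) (y := a + 1) ?_ ?_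
      (convex_Icc _ _) ⟨le_rfl, by linarith⟩ ⟨by linarith, le_rfl⟩
  · have e : zetaTerm n s =
        ((s - 1) * (a : ℂ) ^ (-s) * ((a + 1 : ℝ) : ℂ) + ((a + 1 : ℝ) : ℂ) ^ (1 - s))
        - ((s - 1) * (a : ℂ) ^ (-s) * a + (a : ℂ) ^ (1 - s)) := by
      rw [zetaTerm, ← ha]; push_cast; ring
    rw [e]
    simpa using hle
  · intro y hy
    have h1 := hasDerivAt_ofReal_cpow_const (x := y) (by linarith [hy.1])
      (sub_ne_zero.mpr hs1.symm)
    have h2 := ((hasDerivAt_id y).ofReal_comp.const_mul ((s - 1) * (a : ℂ) ^ (-s))).add h1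
    refine (h2.congr_deriv ?_).hasDerivWithinAt
    simp
  · intro y hy
    have : (s - 1) * (a : ℂ) ^ (-s) + (1 - s) * (y : ℂ) ^ (-s)
        = (1 - s) * ((y : ℂ) ^ (-s) - (a : ℂ) ^ (-s)) := by ring
    rw [this, norm_mul, norm_sub_rev 1 s, mul_assoc]
    exact mul_le_mul_of_nonneg_left (hdiff y hy) (norm_nonneg _)

theorem differentiable_zetaTerm (n : ℕ) : Differentiable ℂ (zetaTerm n) := by
  have h1 : ((n + 1 : ℝ) : ℂ) ≠ 0 := by exact_mod_cast (by positivity : (n + 1 : ℝ) ≠ 0)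
  have h2 : ((n + 1 + 1 : ℝ) : ℂ) ≠ 0 := by exact_mod_cast (by positivity : (n + 1 + 1 : ℝ) ≠ 0)
  unfold zetaTerm
  intro s
  refine DifferentiableAt.add (DifferentiableAt.mul (by fun_prop) ?_) (DifferentiableAt.sub ?_ ?_)
  · exact (differentiableAt_id.neg).const_cpow (Or.inl h1)
  · exact (differentiableAt_id.const_sub 1).const_cpow (Or.inl h2)
  · exact (differentiableAt_id.const_sub 1).const_cpow (Or.inl h1)

theorem tsum_zetaTerm {s : ℂ} (hs : 1 < s.re) : 1 + ∑' n, zetaTerm n s = riemannZeta₁ s := by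
  have hs1 : s ≠ 1 := by rintro rfl; simp at hs
  have hz := riemannZeta_eq_inv_sub_mul hs1
  rw [inv_mul_eq_div, eq_div_iff (sub_ne_zero.mpr hs1)] at hz
  rw [← hz, zeta_eq_tsum_one_div_nat_add_one_cpow hs]
  have hsum : Summable fun n : ℕ => 1 / ((n : ℂ) + 1) ^ s := by
    have := (summable_nat_add_iff 1).mpr (Complex.summable_one_div_nat_cpow.mpr hs)
    simpa using this
  have hA : Summable fun n : ℕ => (s - 1) * ((n + 1 : ℝ) : ℂ) ^ (-s) := by
    refine Summable.mul_left _ (hsum.congr fun n => ?_)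
    push_cast; rw [Complex.cpow_neg, one_div]
  have ht : Filter.Tendsto (fun n : ℕ => ((n + 1 : ℝ) : ℂ) ^ (1 - s)) Filter.atTop (nhds 0) := by
    rw [tendsto_zero_iff_norm_tendsto_zero]
    have : ∀ n : ℕ, ‖((n + 1 : ℝ) : ℂ) ^ (1 - s)‖ = (n + 1 : ℝ) ^ (-(s.re - 1)) := fun n => by
      rw [Complex.norm_cpow_eq_rpow_re_of_pos (by positivity)]; simp
    simp_rw [this]
    exact (tendsto_rpow_neg_atTop (by linarith)).comp
      (Filter.tendsto_atTop_add_const_right _ 1 tendsto_natCast_atTop_atTop)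
  have hT : Summable (fun n => zetaTerm n s) := by
    have hre : (1 : ℝ) < s.re + 1 := by linarith
    have h := (summable_nat_add_iff 1).mpr (Real.summable_nat_rpow_inv.mpr hre)
    refine Summable.of_norm_bounded (g := fun n : ℕ => ‖s - 1‖ * ‖s‖ * (n + 1 : ℝ) ^ (-s.re - 1))
      (Summable.mul_left _ (h.congr fun n => ?_)) fun n => norm_zetaTerm_le n (by linarith)
    push_cast
    rw [← Real.rpow_neg (by positivity)]; congr 1; ring
  have hB : Summable fun n : ℕ =>
      (((n + 1 + 1 : ℝ) : ℂ) ^ (1 - s) - ((n + 1 : ℝ) : ℂ) ^ (1 - s)) := by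
    refine (hT.sub hA).congr fun n => ?_
    simp [zetaTerm]
  have htel : ∑' n : ℕ, (((n + 1 + 1 : ℝ) : ℂ) ^ (1 - s) - ((n + 1 : ℝ) : ℂ) ^ (1 - s)) = -1 := by
    have h1 := hB.hasSum.tendsto_sum_nat
    have h2 : ∀ m : ℕ,
        ∑ n ∈ range m, (((n + 1 + 1 : ℝ) : ℂ) ^ (1 - s) - ((n + 1 : ℝ) : ℂ) ^ (1 - s))
        = ((m + 1 : ℝ) : ℂ) ^ (1 - s) - 1 := fun m => by
      have := Finset.sum_range_sub (fun n : ℕ => ((n + 1 : ℝ) : ℂ) ^ (1 - s)) m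
      simpa using this
    simp_rw [h2] at h1
    exact tendsto_nhds_unique h1 (by simpa using ht.sub_const 1)
  unfold zetaTerm
  rw [hA.tsum_add hB, htel, tsum_mul_left, mul_comm (tsum _)]
  rw [add_comm _ (-1 : ℂ), ← add_assoc, add_neg_cancel, zero_add]
  congr 1
  refine tsum_congr fun n => ?_
  push_cast; rw [Complex.cpow_neg, one_div]

/-- Polynomial growth of `(s - 1) * ζ(s)` in a half plane containing the critical line. -/
theorem exists_norm_riemannZeta₁_le :
    ∃ K : ℝ, 0 < K ∧ ∀ s : ℂ, 1 / 10 ≤ s.re → ‖riemannZeta₁ s‖ ≤ 1 + K * (‖s - 1‖ * ‖s‖) := by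
  have hb : (1 : ℝ) < 21 / 20 := by norm_num
  have h0 := (summable_nat_add_iff 1).mpr (Real.summable_nat_rpow_inv.mpr hb)
  have hsum : Summable fun n : ℕ => (n + 1 : ℝ) ^ (-(21 / 20) : ℝ) := h0.congr fun n => by
    push_cast; rw [← Real.rpow_neg (by positivity)]
  have hle : ∀ (s : ℂ), 1 / 20 < s.re → ∀ n : ℕ,
      ‖zetaTerm n s‖ ≤ ‖s - 1‖ * ‖s‖ * (n + 1 : ℝ) ^ (-(21 / 20) : ℝ) := fun s hs n => by
    refine (norm_zetaTerm_le n (by linarith)).trans ?_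
    refine mul_le_mul_of_nonneg_left ?_ (by positivity)
    exact Real.rpow_le_rpow_of_exponent_le (by simp) (by linarith)
  refine ⟨∑' n : ℕ, (n + 1 : ℝ) ^ (-(21 / 20) : ℝ), ?_, fun s hs => ?_⟩
  · exact hsum.tsum_pos (fun n => by positivity) 0 (by simp)
  have heq : 1 + ∑' n, zetaTerm n s = riemannZeta₁ s := by
    set M : ℝ := ‖s‖ + 3
    set U : Set ℂ := {w : ℂ | 1 / 20 < w.re} ∩ Metric.ball 0 M with hU
    have hUo : IsOpen U :=
      (isOpen_lt continuous_const Complex.continuous_re).inter Metric.isOpen_ball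
    have hUc : Convex ℝ U := (convex_halfSpace_re_gt _).inter (convex_ball _ _)
    have hd : DifferentiableOn ℂ (fun w => ∑' n, zetaTerm n w) U := by
      refine Complex.differentiableOn_tsum_of_summable_norm
        (u := fun n : ℕ => (M + 1) * M * (n + 1 : ℝ) ^ (-(21 / 20) : ℝ)) (hsum.mul_left _)
        (fun n => (differentiable_zetaTerm n).differentiableOn) hUo fun n w hw => ?_
      refine (hle w hw.1 n).trans ?_
      have hwM : ‖w‖ ≤ M := by simpa using (mem_ball_zero_iff.mp hw.2).le
      have : ‖w - 1‖ ≤ M + 1 := (norm_sub_le _ _).trans (by simpa using hwM)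
      have : 0 ≤ M + 1 := by positivity
      gcongr
    have h2U : (2 : ℂ) ∈ U := by
      constructor
      · simp; norm_num
      · simp [M]; linarith [norm_nonneg s]
    refine AnalyticOnNhd.eqOn_of_preconnected_of_eventuallyEq (z₀ := 2)
      ((hd.const_add 1).analyticOnNhd hUo)
      (differentiable_riemannZeta₁.differentiableOn.analyticOnNhd hUo)
      hUc.isPreconnected h2U ?_ (x := s) ?_
    · have : {w : ℂ | 1 < w.re} ∈ nhds (2 : ℂ) :=
        (isOpen_lt continuous_const Complex.continuous_re).mem_nhds (by simp)
      filter_upwards [this] with w hw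
      exact tsum_zetaTerm hw
    · exact ⟨by simp only [Set.mem_ofPred_eq]; linarith, by simp [M]⟩
  rw [← heq]
  refine (norm_add_le _ _).trans ?_
  rw [norm_one]
  have := tsum_of_norm_bounded (hsum.mul_left (‖s - 1‖ * ‖s‖)).hasSum (hle s (by linarith))
  rw [tsum_mul_left] at this
  linarith

/-- A lower bound on the line `Re s = 2`. -/
theorem norm_riemannZeta₁_two_ge (t : ℝ) : (1 : ℝ) / 4 ≤ ‖riemannZeta₁ (2 + t * Complex.I)‖ := by
  set s : ℂ := 2 + t * Complex.I with hs
  have hre : s.re = 2 := by simp [hs]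
  have hs1 : s ≠ 1 := by intro h; rw [h] at hre; norm_num at hre
  have hz := riemannZeta_eq_inv_sub_mul hs1
  rw [inv_mul_eq_div, eq_div_iff (sub_ne_zero.mpr hs1)] at hz
  rw [← hz, norm_mul]
  have h1 : 1 ≤ ‖s - 1‖ := by
    have := Complex.abs_re_le_norm (s - 1)
    simp only [Complex.sub_re, hre, Complex.one_re] at this
    norm_num at this; exact this
  have h2 : (1 : ℝ) / 4 ≤ ‖riemannZeta s‖ := by
    have hre1 : 1 < s.re := by rw [hre]; norm_num
    have hsum : Summable fun n : ℕ => 1 / ((n : ℂ) + 1) ^ s := by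
      have := (summable_nat_add_iff 1).mpr (Complex.summable_one_div_nat_cpow.mpr hre1)
      simpa using this
    have hz2 := hasSum_zeta_two
    have hsum2 : HasSum (fun n : ℕ => 1 / ((n : ℝ) + 1 + 1) ^ 2) (Real.pi ^ 2 / 6 - 1) := by
      have := (hasSum_nat_add_iff' 2).mpr hz2
      simp only [Finset.sum_range_succ, Finset.sum_range_zero] at this
      norm_num at this
      have e : (fun n : ℕ => 1 / ((n : ℝ) + 1 + 1) ^ 2) = fun n : ℕ => (((n : ℝ) + 2) ^ 2)⁻¹ := by
        ext n
        rw [one_div, add_assoc, one_add_one_eq_two]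
      rw [e]
      exact this
    rw [zeta_eq_tsum_one_div_nat_add_one_cpow hre1, hsum.tsum_eq_zero_add]
    simp only [Nat.cast_zero, zero_add, Complex.one_cpow, ne_eq, one_ne_zero, not_false_eq_true,
      div_self]
    have h3 : ‖∑' n : ℕ, 1 / (((n + 1 : ℕ) : ℂ) + 1) ^ s‖ ≤ Real.pi ^ 2 / 6 - 1 := by
      refine tsum_of_norm_bounded hsum2 fun n => ?_
      have : (((n + 1 : ℕ) : ℂ) + 1) = ((n + 1 + 1 : ℝ) : ℂ) := by push_cast; ring
      rw [this, norm_div, Complex.norm_cpow_eq_rpow_re_of_pos (by positivity), hre, norm_one]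
      norm_cast
    have h4 := norm_sub_le_norm_add (1 : ℂ) (∑' n : ℕ, 1 / (((n + 1 : ℕ) : ℂ) + 1) ^ s)
    rw [norm_one] at h4
    have := Real.pi_lt_d2
    have := Real.pi_pos
    nlinarith
  nlinarith [norm_nonneg (s - 1)]

/-- Under the Riemann hypothesis the zeros of `(s - 1) * ζ(s)` with `0 < Re s` are on the
critical line. -/
theorem re_eq_half_of_riemannZeta₁_eq_zero (hRH : RiemannHypothesis) {s : ℂ} (hs : 0 < s.re)
    (h0 : riemannZeta₁ s = 0) : s.re = 1 / 2 := by
  have hs1 : s ≠ 1 := by rintro rfl; simp at h0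
  refine hRH s ?_ ?_ hs1
  · rw [riemannZeta_eq_inv_sub_mul hs1, h0, mul_zero]
  · rintro ⟨n, rfl⟩
    have : (-2 * ((n : ℂ) + 1)).re = -2 * ((n : ℝ) + 1) := by simp
    rw [this] at hs
    have : (0 : ℝ) ≤ n := by positivity
    linarith

theorem riemannZeta₁_ne_zero (hRH : RiemannHypothesis) {s : ℂ} (hs : 1 / 2 < s.re) :
    riemannZeta₁ s ≠ 0 := fun h =>
  hs.ne' (re_eq_half_of_riemannZeta₁_eq_zero hRH (by linarith) h)

theorem multiset_sum_inv_bounds {d : ℝ} (hd : 0 < d) {w : ℂ} (Z : Multiset ℂ)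
    (hZ : ∀ ρ ∈ Z, (w - ρ).re = d) :
    0 ≤ (Z.map fun ρ => 1 / (w - ρ)).sum.re ∧
      ‖(Z.map fun ρ => 1 / (w - ρ)).sum‖ ≤ Z.card / d := by
  induction Z using Multiset.induction with
  | empty => simp
  | cons a Z ih =>
    obtain ⟨h1, h2⟩ := ih fun ρ h => hZ ρ (Multiset.mem_cons_of_mem h)
    have ha := hZ a (Multiset.mem_cons_self _ _)
    simp only [Multiset.map_cons, Multiset.sum_cons, Multiset.card_cons]
    constructor
    · rw [Complex.add_re, one_div, Complex.inv_re, ha]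
      exact add_nonneg (div_nonneg hd.le (Complex.normSq_nonneg _)) h1
    · refine (norm_add_le _ _).trans ?_
      have h3 : ‖1 / (w - a)‖ ≤ 1 / d := by
        rw [norm_div, norm_one]
        have := Complex.re_le_norm (w - a)
        rw [ha] at this
        gcongr
      push_cast
      rw [add_div]
      linarith

theorem log_abs_add_two_ge (t : ℝ) : Real.log 2 ≤ Real.log (|t| + 2) :=
  Real.log_le_log (by norm_num) (by linarith [abs_nonneg t])

/-- Bounds for `ζ'/ζ(s) + 1/(s-1)` to the right of the critical line, under the
Riemann hypothesis. -/
theorem exists_logDeriv_riemannZeta₁_bounds (hRH : RiemannHypothesis) :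
    ∃ C : ℝ, 0 < C ∧ ∀ s : ℂ, 1 / 2 < s.re → s.re ≤ 3 / 2 →
      -(C * Real.log (|s.im| + 2)) ≤ (logDeriv riemannZeta₁ s).re ∧
      ‖logDeriv riemannZeta₁ s‖ ≤ C * Real.log (|s.im| + 2) / (s.re - 1 / 2) := by
  obtain ⟨K, hK, hKb⟩ := exists_norm_riemannZeta₁_le
  have hlog2 : 0 < Real.log 2 := Real.log_pos (by norm_num)
  have hK24 : 0 < Real.log (24 * (1 + K)) := Real.log_pos (by nlinarith)
  set C₁ : ℝ := Real.log (24 * (1 + K)) / Real.log 2 + 2 with hC₁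
  have hC₁0 : 0 < C₁ := by positivity
  refine ⟨1018 * C₁, by positivity, fun s hs1 hs2 => ?_⟩
  set t := s.im with ht
  set A : ℝ := C₁ * Real.log (|t| + 2) with hA
  have hl := log_abs_add_two_ge t
  have hA0 : 0 < A := mul_pos hC₁0 (hlog2.trans_le hl)
  have ht2 : 0 < |t| + 2 := by positivity
  have hexpA : 24 * (1 + K) * (|t| + 2) ^ 2 ≤ Real.exp A := by
    rw [← Real.log_le_iff_le_exp (by positivity), Real.log_mul (by positivity) (by positivity),
      Real.log_pow, hA, hC₁, add_mul, div_mul_eq_mul_div]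
    have : Real.log (24 * (1 + K)) ≤ Real.log (24 * (1 + K)) * Real.log (|t| + 2) / Real.log 2 := by
      rw [le_div_iff₀ hlog2]
      gcongr
    push_cast
    linarith
  set f : ℂ → ℂ := fun w => riemannZeta₁ (2 + t * Complex.I + w) with hf
  have hfd : Differentiable ℂ f := by fun_prop
  have hf0 : (1 : ℝ) / 4 ≤ ‖f 0‖ := by
    simp only [hf, add_zero]
    exact norm_riemannZeta₁_two_ge t
  obtain ⟨Z, hZ, hcard, hpf⟩ := exists_local_partial_fractions hA0 hfd
    (norm_pos_iff.mp (by linarith)) fun w hw => by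
      have hre := (Complex.abs_re_le_norm w).trans hw
      rw [abs_le] at hre
      refine (hKb _ (by simp; linarith)).trans ?_
      have h1 : ‖2 + t * Complex.I + w‖ ≤ |t| + 4 := by
        refine (norm_add₃_le).trans ?_
        simp
        linarith
      have h2 : ‖2 + t * Complex.I + w - 1‖ ≤ |t| + 5 := by
        refine (norm_sub_le _ _).trans ?_
        rw [norm_one]; linarith
      have h3 : ‖2 + t * Complex.I + w - 1‖ * ‖2 + t * Complex.I + w‖ ≤ (|t| + 5) * (|t| + 4) := by
        gcongr
      have h4 : Real.exp A * (1 / 4) ≤ Real.exp A * ‖f 0‖ := by gcongr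
      refine le_trans ?_ h4
      have := abs_nonneg t
      nlinarith [mul_nonneg hK.le this, mul_nonneg hK.le (sq_nonneg |t|)]
  set w : ℂ := ((s.re - 2 : ℝ) : ℂ) with hw
  have hsw : 2 + t * Complex.I + w = s := by
    apply Complex.ext <;> simp [hw, ht]
  have hwn : ‖w‖ ≤ 3 / 2 := by
    rw [hw, Complex.norm_real, Real.norm_eq_abs, abs_le]
    constructor <;> linarith
  have hfw : f w ≠ 0 := by
    simp only [hf, hsw]
    exact riemannZeta₁_ne_zero hRH hs1
  have hlog : logDeriv f w = logDeriv riemannZeta₁ s := by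
    rw [logDeriv_apply, logDeriv_apply, hf]
    simp only [hsw]
    rw [deriv_comp_const_add, hsw]
  have hZre : ∀ ρ ∈ Z, (w - ρ).re = s.re - 1 / 2 := fun ρ hρ => by
    obtain ⟨h1, h2⟩ := hZ ρ hρ
    have h3 := (abs_le.mp ((Complex.abs_re_le_norm ρ).trans h2)).1
    have := re_eq_half_of_riemannZeta₁_eq_zero hRH (s := 2 + t * Complex.I + ρ)
      (by simp; linarith) h1
    simp at this
    simp [hw]
    linarith
  have hd : 0 < s.re - 1 / 2 := by linarith
  obtain ⟨hS1, hS2⟩ := multiset_sum_inv_bounds hd Z hZre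
  have hb := hpf w hwn hfw
  rw [hlog] at hb
  set S := (Z.map fun ρ => 1 / (w - ρ)).sum
  have e : (1018 : ℝ) * C₁ * Real.log (|t| + 2) = 1018 * A := by rw [hA]; ring
  rw [e]
  constructor
  · have h1 := (abs_le.mp ((Complex.abs_re_le_norm _).trans hb)).1
    rw [Complex.sub_re] at h1
    linarith
  · have h1 : ‖logDeriv riemannZeta₁ s‖ ≤ 1000 * A + Z.card / (s.re - 1 / 2) := by
      have := norm_add_le (logDeriv riemannZeta₁ s - S) S
      rw [sub_add_cancel] at this
      linarith
    refine h1.trans ?_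
    rw [le_div_iff₀ hd, add_mul, div_mul_cancel₀ _ hd.ne']
    nlinarith

theorem logDeriv_riemannZeta₁_conj (s : ℂ) :
    logDeriv riemannZeta₁ ((starRingEnd ℂ) s) = (starRingEnd ℂ) (logDeriv riemannZeta₁ s) := by
  have h : ∀ s, riemannZeta₁ ((starRingEnd ℂ) s) = (starRingEnd ℂ) (riemannZeta₁ s) := by
    intro s
    rcases eq_or_ne s 1 with rfl | hs
    · simp
    have hs' : (starRingEnd ℂ) s ≠ 1 := fun h => hs (by simpa using congrArg (starRingEnd ℂ) h)
    have h1 := riemannZeta_conj s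
    rw [riemannZeta_eq_inv_sub_mul hs, riemannZeta_eq_inv_sub_mul hs', map_mul, map_inv₀, map_sub,
      map_one] at h1
    exact mul_left_cancel₀ (inv_ne_zero (sub_ne_zero.mpr hs')) h1
  have h2 : (starRingEnd ℂ) ∘ riemannZeta₁ ∘ (starRingEnd ℂ) = riemannZeta₁ := by
    ext s; simp [h]
  have h3 := congrFun (deriv_conj_conj (𝕜 := ℂ) (f := riemannZeta₁)) ((starRingEnd ℂ) s)
  rw [h2] at h3
  simp only [Function.comp_apply, Complex.conj_conj] at h3
  rw [logDeriv_apply, logDeriv_apply, h, h3, map_div₀]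

theorem differentiableAt_logDeriv_riemannZeta₁ (hRH : RiemannHypothesis) {s : ℂ}
    (hs : 1 / 2 < s.re) : DifferentiableAt ℂ (logDeriv riemannZeta₁) s :=
  (differentiable_riemannZeta₁.deriv s).div (differentiable_riemannZeta₁ s)
    (riemannZeta₁_ne_zero hRH hs)

/-- Shifting the line of integration inside a strip of holomorphy. -/
theorem integral_vertical_shift {f : ℂ → ℂ} {a b : ℝ} (hab : a ≤ b)
    (hf : ∀ s : ℂ, a ≤ s.re → s.re ≤ b → DifferentiableAt ℂ f s) {g : ℝ → ℝ}
    (hg : MeasureTheory.Integrable g) (hg0 : Filter.Tendsto g (Filter.cocompact ℝ) (nhds 0))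
    (hfg : ∀ s : ℂ, a ≤ s.re → s.re ≤ b → ‖f s‖ ≤ g s.im) :
    MeasureTheory.Integrable (fun t : ℝ => f (a + t * Complex.I)) ∧
    MeasureTheory.Integrable (fun t : ℝ => f (b + t * Complex.I)) ∧
    ∫ t : ℝ, f (a + t * Complex.I) = ∫ t : ℝ, f (b + t * Complex.I) := by
  have hintg : ∀ x : ℝ, a ≤ x → x ≤ b →
      MeasureTheory.Integrable (fun t : ℝ => f (x + t * Complex.I)) := by
    intro x hx1 hx2
    have hc : Continuous (fun t : ℝ => f (x + t * Complex.I)) := by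
      rw [continuous_iff_continuousAt]
      intro t
      have h1 : ContinuousAt f (x + t * Complex.I) :=
        (hf _ (by simpa using hx1) (by simpa using hx2)).continuousAt
      exact ContinuousAt.comp (f := fun t : ℝ => (x : ℂ) + t * Complex.I) h1
        (by fun_prop)
    refine hg.mono' hc.aestronglyMeasurable (Filter.Eventually.of_forall fun t => ?_)
    simpa using hfg (x + t * Complex.I) (by simpa using hx1) (by simpa using hx2)
  have ha := hintg a le_rfl hab
  have hb := hintg b hab le_rfl
  refine ⟨ha, hb, ?_⟩
  have hlim : ∀ x : ℝ, MeasureTheory.Integrable (fun t : ℝ => f (x + t * Complex.I)) →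
      Filter.Tendsto (fun T : ℝ => ∫ t in (-T)..T, f (x + t * Complex.I)) Filter.atTop
        (nhds (∫ t : ℝ, f (x + t * Complex.I))) := fun x hx =>
    MeasureTheory.intervalIntegral_tendsto_integral hx Filter.tendsto_neg_atTop_atBot
      Filter.tendsto_id
  have hhor : ∀ T : ℝ, ‖∫ x in a..b, f (x + T * Complex.I)‖ ≤ g T * (b - a) := by
    intro T
    have := intervalIntegral.norm_integral_le_of_norm_le_const (a := a) (b := b) (C := g T)
      (f := fun x : ℝ => f (x + T * Complex.I)) (fun x hx => by
        rw [Set.uIoc_of_le hab] at hx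
        simpa using hfg (x + T * Complex.I) (by simpa using hx.1.le) (by simpa using hx.2))
    rwa [abs_of_nonneg (sub_nonneg.mpr hab)] at this
  have hhor0 : ∀ u : ℝ → ℝ, Filter.Tendsto u Filter.atTop (Filter.cocompact ℝ) →
      Filter.Tendsto (fun T : ℝ => ∫ x in a..b, f (x + (u T : ℝ) * Complex.I)) Filter.atTop
        (nhds 0) := fun u hu =>
    squeeze_zero_norm (fun T => hhor (u T)) (by simpa using (hg0.comp hu).mul_const (b - a))
  have hrect : ∀ T : ℝ, (∫ x in a..b, f (x + (-T : ℝ) * Complex.I))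
      - (∫ x in a..b, f (x + (T : ℝ) * Complex.I))
      + Complex.I • (∫ t in (-T)..T, f (b + t * Complex.I))
      - Complex.I • (∫ t in (-T)..T, f (a + t * Complex.I)) = 0 := by
    intro T
    have := Complex.integral_boundary_rect_eq_zero_of_differentiableOn f
      (⟨a, -T⟩ : ℂ) ⟨b, T⟩ (fun s hs => by
        have h1 := hs.1
        simp only [Set.mem_preimage, Set.uIcc_of_le hab] at h1
        exact (hf s h1.1 h1.2).differentiableWithinAt)
    exact this
  have h1 := (hhor0 (fun T => -T) (by
    rw [cocompact_eq_atBot_atTop]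
    exact Filter.tendsto_neg_atTop_atBot.mono_right le_sup_left)).sub (hhor0 (fun T => T) (by
    rw [cocompact_eq_atBot_atTop]
    exact Filter.tendsto_id.mono_right le_sup_right))
  have h2 := (h1.add ((hlim b hb).const_smul Complex.I)).sub ((hlim a ha).const_smul Complex.I)
  simp only [hrect] at h2
  have h3 := tendsto_nhds_unique h2 tendsto_const_nhds
  rw [sub_zero, zero_add, ← smul_sub, smul_eq_zero] at h3
  rcases h3 with h3 | h3
  · exact absurd h3 Complex.I_ne_zero
  · exact (sub_eq_zero.mp h3).symm

/-- The logarithmic weight `log (|t| + 2)`. -/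
noncomputable def logWeight (t : ℝ) : ℝ := Real.log (|t| + 2)

theorem half_le_logWeight (t : ℝ) : 1 / 2 ≤ logWeight t := by
  have := log_abs_add_two_ge t
  have := Real.log_two_gt_d9
  unfold logWeight
  linarith

theorem logWeight_le_rpow (u : ℝ) : logWeight u ≤ 4 * (1 + u ^ 2) ^ (1 / 4 : ℝ) := by
  have h0 : 0 < |u| + 2 := by positivity
  have h1 : Real.log (|u| + 2) ≤ (|u| + 2) ^ (1 / 2 : ℝ) / (1 / 2) :=
    Real.log_le_rpow_div h0.le (by norm_num)
  have h2 : (|u| + 2) ^ (1 / 2 : ℝ) ≤ 2 * (1 + u ^ 2) ^ (1 / 4 : ℝ) := by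
    have e1 : (2 : ℝ) = (16 : ℝ) ^ (1 / 4 : ℝ) := by
      rw [show (16 : ℝ) = 2 ^ (4 : ℝ) by norm_num, ← Real.rpow_mul (by norm_num)]; norm_num
    have e2 : (|u| + 2) ^ (1 / 2 : ℝ) = ((|u| + 2) ^ (2 : ℝ)) ^ (1 / 4 : ℝ) := by
      rw [← Real.rpow_mul h0.le]; norm_num
    have e3 : 2 * (1 + u ^ 2) ^ (1 / 4 : ℝ) = (16 * (1 + u ^ 2)) ^ (1 / 4 : ℝ) := by
      rw [Real.mul_rpow (by norm_num) (by positivity), ← e1]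
    rw [e2, e3]
    refine Real.rpow_le_rpow (by positivity) ?_ (by norm_num)
    rw [Real.rpow_two]
    nlinarith [sq_abs u, sq_nonneg (|u| - 1)]
  unfold logWeight
  linarith

theorem logWeight_le_add (t s : ℝ) : logWeight t ≤ logWeight s + logWeight (t - s) := by
  unfold logWeight
  rw [← Real.log_mul (by positivity) (by positivity)]
  refine Real.log_le_log (by positivity) ?_
  have := abs_add_le s (t - s)
  rw [add_sub_cancel] at this
  nlinarith [abs_nonneg s, abs_nonneg (t - s), mul_nonneg (abs_nonneg s) (abs_nonneg (t - s))]

/-- An integrable majorant for `logWeight u / (1 + u ^ 2)`. -/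
noncomputable def decayWeight (u : ℝ) : ℝ := (1 + u ^ 2) ^ (-(3 / 4) : ℝ)

theorem decayWeight_pos (u : ℝ) : 0 < decayWeight u := by
  unfold decayWeight; positivity

theorem integrable_decayWeight : MeasureTheory.Integrable decayWeight := by
  have := integrable_rpow_neg_one_add_norm_sq (E := ℝ) (μ := MeasureTheory.volume) (r := 3 / 2)
    (by simp; norm_num)
  refine this.congr (Filter.Eventually.of_forall fun u => ?_)
  simp only [decayWeight, Real.norm_eq_abs, sq_abs]
  norm_num

theorem tendsto_decayWeight_sub (s : ℝ) :
    Filter.Tendsto (fun t => decayWeight (t - s)) (Filter.cocompact ℝ) (nhds 0) := by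
  have h1 : Filter.Tendsto (fun t : ℝ => t - s) (Filter.cocompact ℝ) (Filter.cocompact ℝ) :=
    (Homeomorph.subRight s).isClosedEmbedding.tendsto_cocompact
  have h2 := tendsto_norm_cocompact_atTop.comp h1
  have h3 : Filter.Tendsto (fun t : ℝ => 1 + (t - s) ^ 2) (Filter.cocompact ℝ) Filter.atTop := by
    have := Filter.tendsto_atTop_add_const_left _ (1 : ℝ)
      ((Filter.tendsto_pow_atTop (α := ℝ) two_ne_zero).comp h2)
    simpa [Function.comp_def] using this
  exact (tendsto_rpow_neg_atTop (by norm_num : (0 : ℝ) < 3 / 4)).comp h3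

theorem logWeight_div_le (t s : ℝ) :
    logWeight t / (1 + (t - s) ^ 2) ≤ 16 * logWeight s * decayWeight (t - s) := by
  set u := t - s
  have h1 := logWeight_le_add t s
  have h2 := half_le_logWeight s
  have h3 := half_le_logWeight u
  have h4 := logWeight_le_rpow u
  have h5 : logWeight t ≤ 4 * (logWeight s * logWeight u) := by nlinarith
  have h6 : (1 + u ^ 2) ^ (1 / 4 : ℝ) / (1 + u ^ 2) = decayWeight u := by
    unfold decayWeight
    rw [← Real.rpow_sub_one (by positivity)]; norm_num
  rw [← h6, mul_div_assoc', div_le_div_iff_of_pos_right (by positivity)]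
  nlinarith

theorem exists_average_re_logDeriv_bound (hRH : RiemannHypothesis) :
    ∃ C : ℝ, 0 < C ∧ ∀ c : ℝ, 1 / 2 < c → c ≤ 3 / 4 → ∀ s : ℝ,
      ∫⁻ t : ℝ, ENNReal.ofReal
        (|(logDeriv riemannZeta₁ (c + t * Complex.I)).re| / (1 + (t - s) ^ 2)) ≤
      ENNReal.ofReal (C * logWeight s) := by
  obtain ⟨C, hC, hF⟩ := exists_logDeriv_riemannZeta₁_bounds hRH
  set J : ℝ := ∫ u, decayWeight u
  have hJ : 0 ≤ J := MeasureTheory.integral_nonneg fun u => (decayWeight_pos u).le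
  refine ⟨192 * C * J + 1, by positivity, fun c hc1 hc2 s => ?_⟩
  have hd : 0 < c - 1 / 2 := by linarith
  have hls := half_le_logWeight s
  have hDi : MeasureTheory.Integrable fun t => decayWeight (t - s) :=
    integrable_decayWeight.comp_sub_right s
  have hDJ : ∫ t, decayWeight (t - s) = J := MeasureTheory.integral_sub_right_eq_self _ s
  set w₀ : ℂ := c + s * Complex.I with hw₀
  set k : ℂ → ℂ := fun w => 4 / (4 - (w - w₀) ^ 2) with hk
  have hkre : ∀ w : ℂ, c ≤ w.re → w.re ≤ 3 / 2 → 1 + (w.im - s) ^ 2 ≤ (4 - (w - w₀) ^ 2).re := by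
    intro w h1 h2
    have : (4 - (w - w₀) ^ 2).re = 4 - (w.re - c) ^ 2 + (w.im - s) ^ 2 := by
      simp [hw₀, pow_two]; ring
    rw [this]
    nlinarith
  have hkne : ∀ w : ℂ, c ≤ w.re → w.re ≤ 3 / 2 → 4 - (w - w₀) ^ 2 ≠ 0 := by
    intro w h1 h2 h
    have := hkre w h1 h2
    rw [h, Complex.zero_re] at this
    nlinarith [sq_nonneg (w.im - s)]
  have hkb : ∀ w : ℂ, c ≤ w.re → w.re ≤ 3 / 2 → ‖k w‖ ≤ 4 / (1 + (w.im - s) ^ 2) := by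
    intro w h1 h2
    rw [hk, norm_div]
    have := (hkre w h1 h2).trans (Complex.re_le_norm _)
    norm_num
    gcongr
  have hfk : ∀ (B : ℝ) (w : ℂ), 0 ≤ B → c ≤ w.re → w.re ≤ 3 / 2 →
      ‖logDeriv riemannZeta₁ w‖ ≤ B * logWeight w.im →
      ‖logDeriv riemannZeta₁ w * k w‖ ≤ 64 * B * logWeight s * decayWeight (w.im - s) := by
    intro B w hB h1 h2 h3
    rw [norm_mul]
    have hlw := half_le_logWeight w.im
    calc _ ≤ (B * logWeight w.im) * (4 / (1 + (w.im - s) ^ 2)) :=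
          mul_le_mul h3 (hkb w h1 h2) (norm_nonneg _) (by positivity)
      _ = 4 * B * (logWeight w.im / (1 + (w.im - s) ^ 2)) := by ring
      _ ≤ 4 * B * (16 * logWeight s * decayWeight (w.im - s)) := by
          gcongr; exact logWeight_div_le _ _
      _ = _ := by ring
  obtain ⟨hi1, hi2, hshift⟩ := integral_vertical_shift (a := c) (b := 3 / 2)
    (f := fun w => logDeriv riemannZeta₁ w * k w) (by linarith)
    (fun w h1 h2 => (differentiableAt_logDeriv_riemannZeta₁ hRH (by linarith)).mul
      (by
        have := hkne w h1 h2
        rw [hk]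
        fun_prop (disch := assumption)))
    (g := fun t => 64 * (C / (c - 1 / 2)) * logWeight s * decayWeight (t - s))
    (hDi.const_mul _) (by
      have := (tendsto_decayWeight_sub s).const_mul (64 * (C / (c - 1 / 2)) * logWeight s)
      rwa [mul_zero] at this)
    (fun w h1 h2 => hfk _ w (by positivity) h1 h2 (by
      refine (hF w (by linarith) h2).2.trans ?_
      have hlw := half_le_logWeight w.im
      change C * logWeight w.im / (w.re - 1 / 2) ≤ C / (c - 1 / 2) * logWeight w.im
      rw [div_mul_eq_mul_div]
      gcongr))
  have hR : ‖∫ t : ℝ, logDeriv riemannZeta₁ (c + t * Complex.I) * k (c + t * Complex.I)‖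
      ≤ 64 * C * logWeight s * J := by
    rw [hshift, ← hDJ, ← MeasureTheory.integral_const_mul]
    refine MeasureTheory.norm_integral_le_of_norm_le (hDi.const_mul _)
      (Filter.Eventually.of_forall fun t => ?_)
    have := hfk C (((3 / 2 : ℝ) : ℂ) + t * Complex.I) hC.le (by simp; linarith) (by simp) (by
      have := (hF (((3 / 2 : ℝ) : ℂ) + t * Complex.I) (by simp; norm_num) (by simp)).2
      refine this.trans (le_of_eq ?_)
      simp [logWeight]; norm_num)
    simpa using this
  have hkr : ∀ t : ℝ, k (c + t * Complex.I) = ((4 / (4 + (t - s) ^ 2) : ℝ) : ℂ) := by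
    intro t
    have : (c + t * Complex.I - w₀) ^ 2 = -((t - s) ^ 2 : ℝ) := by
      rw [hw₀]; push_cast; ring_nf; simp [Complex.I_sq]; ring
    rw [hk]; simp only [this]; push_cast; rw [sub_neg_eq_add]
  have hre : ∀ t : ℝ, (logDeriv riemannZeta₁ (c + t * Complex.I) * k (c + t * Complex.I)).re =
      (logDeriv riemannZeta₁ (c + t * Complex.I)).re * (4 / (4 + (t - s) ^ 2)) := by
    intro t; rw [hkr, Complex.re_mul_ofReal]
  have hpt : ∀ t : ℝ, |(logDeriv riemannZeta₁ (c + t * Complex.I)).re| / (1 + (t - s) ^ 2) ≤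
      (logDeriv riemannZeta₁ (c + t * Complex.I) * k (c + t * Complex.I)).re
        + 128 * C * logWeight s * decayWeight (t - s) := by
    intro t
    have h1 := (hF (c + t * Complex.I) (by simpa using hc1) (by simp; linarith)).1
    simp only [Complex.add_im, Complex.ofReal_im, Complex.mul_im, Complex.ofReal_re, Complex.I_im,
      mul_one, Complex.I_re, mul_zero, add_zero, zero_add] at h1
    change -(C * logWeight t) ≤ _ at h1
    rw [hre]
    set x := (logDeriv riemannZeta₁ (c + t * Complex.I)).re
    have hlw := half_le_logWeight t
    have h2 : |x| ≤ x + 2 * C * logWeight t := by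
      rw [abs_le]
      constructor <;> nlinarith
    have h3 := logWeight_div_le t s
    calc |x| / (1 + (t - s) ^ 2) ≤ |x| * (4 / (4 + (t - s) ^ 2)) := by
          rw [div_eq_mul_inv, ← one_div]
          refine mul_le_mul_of_nonneg_left ?_ (abs_nonneg x)
          rw [div_le_div_iff₀ (by positivity) (by positivity)]
          nlinarith [sq_nonneg (t - s)]
      _ ≤ (x + 2 * C * logWeight t) * (4 / (4 + (t - s) ^ 2)) := by gcongr
      _ = x * (4 / (4 + (t - s) ^ 2)) + 8 * C * (logWeight t / (4 + (t - s) ^ 2)) := by ring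
      _ ≤ x * (4 / (4 + (t - s) ^ 2)) + 8 * C * (logWeight t / (1 + (t - s) ^ 2)) := by
          gcongr; norm_num
      _ ≤ x * (4 / (4 + (t - s) ^ 2)) + 8 * C * (16 * logWeight s * decayWeight (t - s)) := by
          gcongr
      _ = _ := by ring
  have hi3 : MeasureTheory.Integrable fun t : ℝ =>
      (logDeriv riemannZeta₁ (c + t * Complex.I) * k (c + t * Complex.I)).re := hi1.re
  have hi4 := hi3.add (hDi.const_mul (128 * C * logWeight s))
  calc _ ≤ ∫⁻ t : ℝ, ENNReal.ofReal
        ((logDeriv riemannZeta₁ (c + t * Complex.I) * k (c + t * Complex.I)).re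
        + 128 * C * logWeight s * decayWeight (t - s)) :=
        MeasureTheory.lintegral_mono fun t => ENNReal.ofReal_le_ofReal (hpt t)
    _ = ENNReal.ofReal (∫ t : ℝ,
        ((logDeriv riemannZeta₁ (c + t * Complex.I) * k (c + t * Complex.I)).re
        + 128 * C * logWeight s * decayWeight (t - s))) :=
        (MeasureTheory.ofReal_integral_eq_lintegral_ofReal hi4
          (Filter.Eventually.of_forall fun t => le_trans (by positivity) (hpt t))).symm
    _ ≤ _ := by
        refine ENNReal.ofReal_le_ofReal ?_
        rw [MeasureTheory.integral_add hi3 (hDi.const_mul _), MeasureTheory.integral_const_mul, hDJ]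
        have h1 : (∫ t : ℝ, (logDeriv riemannZeta₁ (c + t * Complex.I) * k (c + t * Complex.I)).re)
            = (∫ t : ℝ, logDeriv riemannZeta₁ (c + t * Complex.I) * k (c + t * Complex.I)).re :=
          integral_re hi1
        rw [h1]
        have := (Complex.re_le_norm _).trans hR
        nlinarith

theorem integrable_exp_neg_mul_abs {a : ℝ} (ha : 0 < a) :
    MeasureTheory.Integrable fun s : ℝ => Real.exp (-a * |s|) := by
  rw [← MeasureTheory.integrableOn_univ, ← Set.Iic_union_Ioi (a := (0 : ℝ))]
  refine MeasureTheory.IntegrableOn.union ?_ ?_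
  · refine (integrableOn_exp_mul_Iic ha 0).congr_fun (fun x hx => ?_) measurableSet_Iic
    simp only [abs_of_nonpos (Set.mem_Iic.mp hx)]; ring_nf
  · refine (integrableOn_exp_mul_Ioi (neg_neg_of_pos ha) 0).congr_fun (fun x hx => ?_)
      measurableSet_Ioi
    simp only [abs_of_pos (Set.mem_Ioi.mp hx)]

theorem integral_exp_neg_mul_abs {a : ℝ} (ha : 0 < a) :
    ∫ s : ℝ, Real.exp (-a * |s|) = 2 / a := by
  rw [integral_comp_abs (f := fun s => Real.exp (-a * s)),
    integral_exp_mul_Ioi (neg_neg_of_pos ha)]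
  simp [div_eq_mul_inv]

theorem lintegral_exp_neg_mul_abs {a : ℝ} (ha : 0 < a) :
    ∫⁻ s : ℝ, ENNReal.ofReal (Real.exp (-a * |s|)) = ENNReal.ofReal (2 / a) := by
  rw [← MeasureTheory.ofReal_integral_eq_lintegral_ofReal (integrable_exp_neg_mul_abs ha)
    (Filter.Eventually.of_forall fun s => (Real.exp_pos _).le), integral_exp_neg_mul_abs ha]

theorem integral_gaussian_mul_cexp (u : ℝ) :
    ‖∫ x : ℝ, Complex.exp (-(1 / 4 : ℂ) * (x : ℂ) ^ 2 + (-Complex.I * u) * x + 0)‖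
      ≤ 4 * (1 / (1 + u ^ 2)) := by
  rw [integral_cexp_quadratic (by norm_num)]
  have e1 : (0 : ℂ) - (-Complex.I * u) ^ 2 / (4 * -(1 / 4)) = ((-u ^ 2 : ℝ) : ℂ) := by
    rw [mul_pow, neg_sq, Complex.I_sq]; push_cast; ring
  have e2 : (Real.pi : ℂ) / - -(1 / 4) = ((4 * Real.pi : ℝ) : ℂ) := by push_cast; ring
  rw [e1, e2, norm_mul, Complex.norm_exp_ofReal,
    Complex.norm_cpow_eq_rpow_re_of_pos (by positivity)]
  have h1 : (4 * Real.pi) ^ (1 / 2 : ℂ).re ≤ 4 := by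
    have : (1 / 2 : ℂ).re = 1 / 2 := by norm_num
    rw [this, ← Real.sqrt_eq_rpow, Real.sqrt_le_left (by norm_num)]
    linarith [Real.pi_le_four]
  have h2 : Real.exp (-u ^ 2) ≤ 1 / (1 + u ^ 2) := by
    rw [Real.exp_neg, ← one_div]
    exact one_div_le_one_div_of_le (by positivity) (by linarith [Real.add_one_le_exp (u ^ 2)])
  exact mul_le_mul h1 h2 (Real.exp_pos _).le (by norm_num)

theorem lintegral_gaussian_mul_sq_le {h : ℝ → ℂ} (hh : MeasureTheory.Integrable h) :
    ∫⁻ τ : ℝ, ENNReal.ofReal (Real.exp (-(1 / 4) * τ ^ 2) *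
        ‖∫ t : ℝ, h t * Complex.exp (-Complex.I * t * τ)‖ ^ 2) ≤
      ∫⁻ p : ℝ × ℝ, ENNReal.ofReal (‖h p.1‖ * ‖h p.2‖ * (4 * (1 / (1 + (p.1 - p.2) ^ 2)))) := by
  set F : ℝ → ℝ × ℝ → ℂ := fun τ p => Complex.exp (-(1 / 4 : ℂ) * (τ : ℂ) ^ 2) *
    (h p.1 * (starRingEnd ℂ) (h p.2)) * Complex.exp (-Complex.I * (p.1 - p.2 : ℝ) * τ) with hF
  have hgauss : MeasureTheory.Integrable fun τ : ℝ => Complex.exp (-(1 / 4 : ℂ) * (τ : ℂ) ^ 2) :=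
    integrable_cexp_neg_mul_sq (b := 1 / 4) (by norm_num)
  have hconj : MeasureTheory.Integrable fun t : ℝ => (starRingEnd ℂ) (h t) :=
    (Complex.conjCLE : ℂ →L[ℝ] ℂ).integrable_comp hh
  have hFi : MeasureTheory.Integrable (Function.uncurry F)
      (MeasureTheory.volume.prod MeasureTheory.volume) := by
    have h1 := hgauss.mul_prod (hh.mul_prod hconj)
    refine h1.mul_bdd (c := 1) (Continuous.aestronglyMeasurable (by fun_prop))
      (Filter.Eventually.of_forall fun x => ?_)
    rw [Complex.norm_exp]; simp
  have hprod : ∀ τ : ℝ, ∫ p, F τ p = ((Real.exp (-(1 / 4) * τ ^ 2) *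
        ‖∫ t : ℝ, h t * Complex.exp (-Complex.I * t * τ)‖ ^ 2 : ℝ) : ℂ) := by
    intro τ
    have e : ∀ p : ℝ × ℝ, F τ p = Complex.exp (-(1 / 4 : ℂ) * (τ : ℂ) ^ 2) *
        ((h p.1 * Complex.exp (-Complex.I * p.1 * τ)) *
        (starRingEnd ℂ) (h p.2 * Complex.exp (-Complex.I * p.2 * τ))) := by
      intro p
      rw [hF]
      simp only [map_mul, ← Complex.exp_conj, map_neg, Complex.conj_I, Complex.conj_ofReal]
      have : Complex.exp (-Complex.I * (p.1 - p.2 : ℝ) * τ) =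
          Complex.exp (-Complex.I * p.1 * τ) * Complex.exp (- -Complex.I * p.2 * τ) := by
        rw [← Complex.exp_add]; congr 1; push_cast; ring
      rw [this]; ring
    simp_rw [e]
    rw [MeasureTheory.integral_const_mul]
    have := MeasureTheory.integral_prod_mul (μ := MeasureTheory.volume) (ν := MeasureTheory.volume)
      (fun t : ℝ => h t * Complex.exp (-Complex.I * t * τ))
      (fun t : ℝ => (starRingEnd ℂ) (h t * Complex.exp (-Complex.I * t * τ)))
    rw [MeasureTheory.Measure.volume_eq_prod, this, integral_conj, Complex.mul_conj,
      Complex.normSq_eq_norm_sq]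
    push_cast
    rfl
  have hXi := hFi.integral_prod_left
  simp only [Function.uncurry] at hXi
  simp_rw [hprod] at hXi
  have hXr := hXi.re
  simp only [RCLike.re_to_complex, Complex.ofReal_re] at hXr
  rw [← MeasureTheory.ofReal_integral_eq_lintegral_ofReal hXr
    (Filter.Eventually.of_forall fun s => by positivity)]
  have hswap := MeasureTheory.integral_integral_swap hFi
  simp_rw [hprod] at hswap
  rw [integral_complex_ofReal] at hswap
  set X : ℝ := ∫ τ : ℝ, Real.exp (-(1 / 4) * τ ^ 2) *
        ‖∫ t : ℝ, h t * Complex.exp (-Complex.I * t * τ)‖ ^ 2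
  have hX0 : 0 ≤ X := MeasureTheory.integral_nonneg fun _ => by positivity
  have : ENNReal.ofReal X = ‖(X : ℂ)‖ₑ := by
    rw [← ofReal_norm, Complex.norm_real, Real.norm_eq_abs, abs_of_nonneg hX0]
  rw [this, hswap]
  refine (MeasureTheory.enorm_integral_le_lintegral_enorm _).trans ?_
  refine MeasureTheory.lintegral_mono fun p => ?_
  rw [← ofReal_norm]
  refine ENNReal.ofReal_le_ofReal ?_
  have e : ∀ τ : ℝ, F τ p = (h p.1 * (starRingEnd ℂ) (h p.2)) *
      Complex.exp (-(1 / 4 : ℂ) * (τ : ℂ) ^ 2 + (-Complex.I * (p.1 - p.2 : ℝ)) * τ + 0) := by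
    intro τ
    rw [hF, add_zero, Complex.exp_add]; ring
  simp_rw [e]
  rw [MeasureTheory.integral_const_mul, norm_mul, norm_mul, RCLike.norm_conj]
  exact mul_le_mul_of_nonneg_left (integral_gaussian_mul_cexp _) (by positivity)

theorem logWeight_le_mul_exp {L ψ : ℝ} (hL : 1 ≤ L) (hψ : Real.exp (-L) ≤ ψ) (hψ' : ψ ≤ 1 / 2)
    (t : ℝ) : logWeight t ≤ L * Real.exp (ψ * |t|) := by
  have h0 : 0 < |t| + 2 := by positivity
  have h1 := Real.log_le_sub_one_of_pos (mul_pos h0 (Real.exp_pos (-L)))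
  rw [Real.log_mul h0.ne' (Real.exp_pos _).ne', Real.log_exp] at h1
  have h2 : (|t| + 2) * Real.exp (-L) ≤ (|t| + 2) * ψ := by gcongr
  have hψ0 : 0 < ψ := (Real.exp_pos _).trans_le hψ
  have h3 := Real.add_one_le_exp (ψ * |t|)
  have h4 : L * (ψ * |t| + 1) ≤ L * Real.exp (ψ * |t|) := by gcongr
  have h5 : 0 ≤ (L - 1) * (ψ * |t|) := by
    have := abs_nonneg t
    have : 0 ≤ L - 1 := by linarith
    positivity
  unfold logWeight
  nlinarith

theorem exp_neg_mul_abs_le_lintegral {ψ : ℝ} (hψ : 0 < ψ) (hψ' : ψ ≤ 1) (t : ℝ) :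
    ENNReal.ofReal (Real.exp (-ψ * |t|)) ≤
      3 * ∫⁻ s, ENNReal.ofReal (Real.exp (-ψ * |s|) * (1 / (1 + (t - s) ^ 2))) := by
  have h1 : ∫⁻ s in Set.Icc (t - 1) (t + 1), ENNReal.ofReal (Real.exp (-ψ * |t|) / 6) ≤
      ∫⁻ s, ENNReal.ofReal (Real.exp (-ψ * |s|) * (1 / (1 + (t - s) ^ 2))) := by
    refine le_trans (MeasureTheory.setLIntegral_mono' measurableSet_Icc fun s hs => ?_)
      (MeasureTheory.setLIntegral_le_lintegral _ _)
    refine ENNReal.ofReal_le_ofReal ?_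
    have hst : |s - t| ≤ 1 := abs_le.mpr ⟨by linarith [hs.1], by linarith [hs.2]⟩
    have h2 : |s| ≤ |t| + 1 := by
      have := abs_add_le (s - t) t
      rw [sub_add_cancel] at this
      linarith
    have h3 : Real.exp (-ψ * |t|) / 3 ≤ Real.exp (-ψ * |s|) := by
      have h4 : Real.exp (-ψ * |t|) ≤ Real.exp 1 * Real.exp (-ψ * |s|) := by
        rw [← Real.exp_add]
        refine Real.exp_le_exp.mpr ?_
        nlinarith
      have h5 := Real.exp_one_lt_d9
      nlinarith [Real.exp_pos (-ψ * |s|)]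
    have h6 : 1 / 2 ≤ 1 / (1 + (t - s) ^ 2) := by
      refine one_div_le_one_div_of_le (by positivity) ?_
      have := sq_le_one_iff_abs_le_one (s - t) |>.mpr hst
      nlinarith
    calc Real.exp (-ψ * |t|) / 6 = Real.exp (-ψ * |t|) / 3 * (1 / 2) := by ring
      _ ≤ _ := by gcongr
  rw [MeasureTheory.setLIntegral_const, Real.volume_Icc,
    ← ENNReal.ofReal_mul (by positivity)] at h1
  calc ENNReal.ofReal (Real.exp (-ψ * |t|))
      = 3 * ENNReal.ofReal (Real.exp (-ψ * |t|) / 6 * (t + 1 - (t - 1))) := by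
        rw [show (3 : ENNReal) = ENNReal.ofReal 3 by simp, ← ENNReal.ofReal_mul (by norm_num)]
        congr 1; ring
    _ ≤ _ := by gcongr

theorem lintegral_mul_exp_neg_le {g : ℝ → ℝ} (hgc : Continuous g) (hg : ∀ t, 0 ≤ g t) {C : ℝ}
    (hC : 0 ≤ C) (havg : ∀ s, ∫⁻ t, ENNReal.ofReal (g t / (1 + (t - s) ^ 2)) ≤
      ENNReal.ofReal (C * logWeight s)) {L ψ : ℝ} (hL : 1 ≤ L) (hψ : Real.exp (-L) ≤ ψ / 2)
    (hψ' : ψ ≤ 1) :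
    ∫⁻ t, ENNReal.ofReal (g t * Real.exp (-ψ * |t|)) ≤ ENNReal.ofReal (12 * C * L / ψ) := by
  have hψ0 : 0 < ψ := by have := Real.exp_pos (-L); linarith
  have hden : ∀ x y : ℝ, (1 + (x - y) ^ 2) ≠ 0 := fun x y => by positivity
  calc ∫⁻ t, ENNReal.ofReal (g t * Real.exp (-ψ * |t|))
      ≤ ∫⁻ t, ∫⁻ s, 3 * ENNReal.ofReal (g t * (Real.exp (-ψ * |s|) * (1 / (1 + (t - s) ^ 2)))) := by
        refine MeasureTheory.lintegral_mono fun t => ?_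
        rw [ENNReal.ofReal_mul (hg t)]
        refine (mul_le_mul_right (exp_neg_mul_abs_le_lintegral hψ0 hψ' t) _).trans_eq ?_
        rw [MeasureTheory.lintegral_const_mul' _ _ (by simp), mul_left_comm,
          ← MeasureTheory.lintegral_const_mul' _ _ (by simp)]
        simp_rw [ENNReal.ofReal_mul (hg t)]
    _ = ∫⁻ s, ∫⁻ t, 3 * ENNReal.ofReal
          (g t * (Real.exp (-ψ * |s|) * (1 / (1 + (t - s) ^ 2)))) := by
        refine MeasureTheory.lintegral_lintegral_swap (Measurable.aemeasurable ?_)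
        refine Measurable.const_mul (Measurable.ennreal_ofReal (Continuous.measurable ?_)) _
        have := hden
        fun_prop (disch := intro x; positivity)
    _ = ∫⁻ s, 3 * ENNReal.ofReal (Real.exp (-ψ * |s|)) *
          ∫⁻ t, ENNReal.ofReal (g t / (1 + (t - s) ^ 2)) := by
        refine MeasureTheory.lintegral_congr fun s => ?_
        rw [← MeasureTheory.lintegral_const_mul' _ _ (by finiteness)]
        refine MeasureTheory.lintegral_congr fun t => ?_
        rw [mul_assoc, ← ENNReal.ofReal_mul (Real.exp_pos _).le]
        congr 2
        ring
    _ ≤ ∫⁻ s, ENNReal.ofReal (3 * C * L) * ENNReal.ofReal (Real.exp (-(ψ / 2) * |s|)) := by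
        refine MeasureTheory.lintegral_mono fun s => ?_
        refine (mul_le_mul_right (havg s) _).trans ?_
        rw [show (3 : ENNReal) = ENNReal.ofReal 3 by simp, ← ENNReal.ofReal_mul (by norm_num),
          ← ENNReal.ofReal_mul (by positivity), ← ENNReal.ofReal_mul (by positivity)]
        refine ENNReal.ofReal_le_ofReal ?_
        have h1 := logWeight_le_mul_exp hL hψ (by linarith) s
        have h2 : Real.exp (-(ψ / 2) * |s|) = Real.exp (-ψ * |s|) * Real.exp (ψ / 2 * |s|) := by
          rw [← Real.exp_add]; congr 1; ring
        rw [h2]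
        calc 3 * Real.exp (-ψ * |s|) * (C * logWeight s)
            ≤ 3 * Real.exp (-ψ * |s|) * (C * (L * Real.exp (ψ / 2 * |s|))) := by gcongr
          _ = _ := by ring
    _ = ENNReal.ofReal (12 * C * L / ψ) := by
        rw [MeasureTheory.lintegral_const_mul' _ _ (by simp),
          lintegral_exp_neg_mul_abs (by positivity), ← ENNReal.ofReal_mul (by positivity)]
        congr 1
        field_simp
        ring

theorem integrable_of_norm_le_mul_exp_neg {g : ℝ → ℝ} (hgc : Continuous g) (hg : ∀ t, 0 ≤ g t)
    {C : ℝ} (hC : 0 ≤ C) (havg : ∀ s, ∫⁻ t, ENNReal.ofReal (g t / (1 + (t - s) ^ 2)) ≤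
      ENNReal.ofReal (C * logWeight s)) {ψ : ℝ} (hψ : 0 < ψ) (hψ' : ψ ≤ 1)
    {h : ℝ → ℂ} (hm : MeasureTheory.AEStronglyMeasurable h) {B : ℝ}
    (hB : ∀ t, ‖h t‖ ≤ B * (g t * Real.exp (-ψ * |t|))) : MeasureTheory.Integrable h := by
  have h1 := lintegral_mul_exp_neg_le hgc hg hC havg (L := max 1 (-Real.log (ψ / 2)))
    (le_max_left _ _) (by
      rw [← Real.exp_log (half_pos hψ)]
      refine Real.exp_le_exp.mpr ?_
      have := le_max_right 1 (-Real.log (ψ / 2))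
      rw [Real.exp_log (half_pos hψ)]
      linarith) hψ'
  have h2 : MeasureTheory.Integrable fun t => g t * Real.exp (-ψ * |t|) := by
    refine ⟨Continuous.aestronglyMeasurable (by fun_prop), ?_⟩
    rw [MeasureTheory.hasFiniteIntegral_iff_ofReal
      (Filter.Eventually.of_forall fun t => mul_nonneg (hg t) (Real.exp_pos _).le)]
    exact h1.trans_lt ENNReal.ofReal_lt_top
  exact (h2.const_mul B).mono' hm (Filter.Eventually.of_forall hB)

theorem lintegral_sq_fourier_le {g : ℝ → ℝ} (hgc : Continuous g) (hg : ∀ t, 0 ≤ g t) {C : ℝ}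
    (hC : 0 ≤ C) (havg : ∀ s, ∫⁻ t, ENNReal.ofReal (g t / (1 + (t - s) ^ 2)) ≤
      ENNReal.ofReal (C * logWeight s)) {L ψ : ℝ} (hL : 1 ≤ L) (hψ : Real.exp (-L) ≤ ψ / 2)
    (hψ' : ψ ≤ 1 / 2) {h : ℝ → ℂ} (hm : MeasureTheory.AEStronglyMeasurable h) {B : ℝ} (hB0 : 0 ≤ B)
    (hB : ∀ t, ‖h t‖ ≤ B * (g t * Real.exp (-(2 * ψ) * |t|))) (τ₀ : ℝ) :
    ∫⁻ τ in Set.Icc (τ₀ - 1) (τ₀ + 1),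
        ENNReal.ofReal (‖∫ t : ℝ, h t * Complex.exp (-Complex.I * t * τ)‖ ^ 2) ≤
      ENNReal.ofReal (96 * B ^ 2 * C ^ 2 * L ^ 2 / ψ) := by
  have hψ0 : 0 < ψ := by have := Real.exp_pos (-L); linarith
  set h₀ : ℝ → ℂ := fun t => h t * Complex.exp (-Complex.I * t * τ₀) with hh₀
  have hn : ∀ t, ‖h₀ t‖ = ‖h t‖ := by
    intro t
    rw [hh₀]
    simp [Complex.norm_exp]
  have hm₀ : MeasureTheory.AEStronglyMeasurable h₀ :=
    hm.mul (Continuous.aestronglyMeasurable (by fun_prop))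
  have hB₀ : ∀ t, ‖h₀ t‖ ≤ B * (g t * Real.exp (-(2 * ψ) * |t|)) := fun t => (hn t).trans_le (hB t)
  have hintg : MeasureTheory.Integrable h₀ :=
    integrable_of_norm_le_mul_exp_neg hgc hg hC havg (by positivity) (by linarith) hm₀ hB₀
  set G : ℝ → ℝ := fun τ => ‖∫ t : ℝ, h₀ t * Complex.exp (-Complex.I * t * τ)‖ ^ 2 with hG
  have e1 : ∀ τ : ℝ, ‖∫ t : ℝ, h t * Complex.exp (-Complex.I * t * τ)‖ ^ 2 = G (τ - τ₀) := by
    intro τ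
    rw [hG]
    congr 2
    refine MeasureTheory.integral_congr_ae (Filter.Eventually.of_forall fun t => ?_)
    simp only [hh₀]
    rw [mul_assoc (h t), ← Complex.exp_add]
    congr 2
    push_cast
    ring
  calc ∫⁻ τ in Set.Icc (τ₀ - 1) (τ₀ + 1),
        ENNReal.ofReal (‖∫ t : ℝ, h t * Complex.exp (-Complex.I * t * τ)‖ ^ 2)
      ≤ ∫⁻ τ, ENNReal.ofReal (2 * (Real.exp (-(1 / 4) * (τ - τ₀) ^ 2) * G (τ - τ₀))) := by
        refine le_trans (MeasureTheory.setLIntegral_mono' measurableSet_Icc fun τ hτ => ?_)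
          (MeasureTheory.setLIntegral_le_lintegral _ _)
        refine ENNReal.ofReal_le_ofReal ?_
        rw [e1]
        have h2 : (τ - τ₀) ^ 2 ≤ 1 := by
          rw [sq_le_one_iff_abs_le_one, abs_le]
          exact ⟨by linarith [hτ.1], by linarith [hτ.2]⟩
        have h3 := Real.add_one_le_exp (-(1 / 4) * (τ - τ₀) ^ 2)
        have h4 : 0 ≤ G (τ - τ₀) := by rw [hG]; positivity
        nlinarith
    _ = ∫⁻ τ, ENNReal.ofReal (2 * (Real.exp (-(1 / 4) * τ ^ 2) * G τ)) :=
        MeasureTheory.lintegral_sub_right_eq_self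
          (fun τ => ENNReal.ofReal (2 * (Real.exp (-(1 / 4) * τ ^ 2) * G τ))) τ₀
    _ = 2 * ∫⁻ τ, ENNReal.ofReal (Real.exp (-(1 / 4) * τ ^ 2) * G τ) := by
        rw [← MeasureTheory.lintegral_const_mul' _ _ (by simp)]
        refine MeasureTheory.lintegral_congr fun τ => ?_
        rw [ENNReal.ofReal_mul (by norm_num)]
        simp
    _ ≤ 2 * ∫⁻ p : ℝ × ℝ, ENNReal.ofReal
          (‖h₀ p.1‖ * ‖h₀ p.2‖ * (4 * (1 / (1 + (p.1 - p.2) ^ 2)))) := by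
        gcongr
        exact lintegral_gaussian_mul_sq_le hintg
    _ ≤ 2 * ∫⁻ p : ℝ × ℝ, ENNReal.ofReal (4 * B ^ 2 * (g p.1 * Real.exp (-(2 * ψ) * |p.1|))) *
          ENNReal.ofReal (g p.2 / (1 + (p.2 - p.1) ^ 2)) := by
        gcongr with p
        rw [← ENNReal.ofReal_mul (by have := hg p.1; positivity)]
        refine ENNReal.ofReal_le_ofReal ?_
        have h5 : ‖h₀ p.2‖ ≤ B * g p.2 := by
          refine (hB₀ p.2).trans ?_
          have h6 : Real.exp (-(2 * ψ) * |p.2|) ≤ 1 := by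
            rw [Real.exp_le_one_iff]
            have := abs_nonneg p.2
            nlinarith
          have := mul_le_mul_of_nonneg_left h6 (hg p.2)
          rw [mul_one] at this
          gcongr
        have h7 := hB₀ p.1
        calc ‖h₀ p.1‖ * ‖h₀ p.2‖ * (4 * (1 / (1 + (p.1 - p.2) ^ 2)))
            ≤ (B * (g p.1 * Real.exp (-(2 * ψ) * |p.1|))) * (B * g p.2) *
              (4 * (1 / (1 + (p.1 - p.2) ^ 2))) := by
              have := hg p.1
              gcongr
          _ = _ := by
            rw [show (p.1 - p.2) ^ 2 = (p.2 - p.1) ^ 2 by ring]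
            ring
    _ = 2 * ∫⁻ t, ENNReal.ofReal (4 * B ^ 2 * (g t * Real.exp (-(2 * ψ) * |t|))) *
          ∫⁻ s, ENNReal.ofReal (g s / (1 + (s - t) ^ 2)) := by
        rw [MeasureTheory.Measure.volume_eq_prod, MeasureTheory.lintegral_prod]
        · congr 1
          refine MeasureTheory.lintegral_congr fun t => ?_
          rw [← MeasureTheory.lintegral_const_mul' _ _ (by finiteness)]
        · have h1 : Continuous fun p : ℝ × ℝ =>
              4 * B ^ 2 * (g p.1 * Real.exp (-(2 * ψ) * |p.1|)) := by fun_prop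
          have h2 : Continuous fun p : ℝ × ℝ => g p.2 / (1 + (p.2 - p.1) ^ 2) := by
            fun_prop (disch := intro x; positivity)
          exact (h1.measurable.ennreal_ofReal.mul h2.measurable.ennreal_ofReal).aemeasurable
    _ ≤ 2 * ∫⁻ t, ENNReal.ofReal (4 * B ^ 2 * C * L) *
          ENNReal.ofReal (g t * Real.exp (-ψ * |t|)) := by
        refine mul_le_mul_right (MeasureTheory.lintegral_mono fun t => ?_) _
        refine (mul_le_mul_right (havg t) _).trans ?_
        have hgt := hg t
        rw [← ENNReal.ofReal_mul (by positivity), ← ENNReal.ofReal_mul (by positivity)]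
        refine ENNReal.ofReal_le_ofReal ?_
        have h1 := logWeight_le_mul_exp hL (hψ.trans (by linarith)) hψ' t
        have h2 : Real.exp (-ψ * |t|) = Real.exp (-(2 * ψ) * |t|) * Real.exp (ψ * |t|) := by
          rw [← Real.exp_add]; congr 1; ring
        rw [h2]
        calc 4 * B ^ 2 * (g t * Real.exp (-(2 * ψ) * |t|)) * (C * logWeight t)
            ≤ 4 * B ^ 2 * (g t * Real.exp (-(2 * ψ) * |t|)) * (C * (L * Real.exp (ψ * |t|))) := by
              gcongr
          _ = _ := by ring
    _ ≤ 2 * (ENNReal.ofReal (4 * B ^ 2 * C * L) * ENNReal.ofReal (12 * C * L / ψ)) := by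
        rw [MeasureTheory.lintegral_const_mul' _ _ (by simp)]
        gcongr
        exact lintegral_mul_exp_neg_le hgc hg hC havg hL hψ (by linarith)
    _ = ENNReal.ofReal (96 * B ^ 2 * C ^ 2 * L ^ 2 / ψ) := by
        rw [show (2 : ENNReal) = ENNReal.ofReal 2 by simp, ← ENNReal.ofReal_mul (by positivity),
          ← ENNReal.ofReal_mul (by norm_num)]
        congr 1
        ring

theorem im_mul_arg_eq (s : ℂ) : s.im * s.arg = |s.im| * |s.arg| := by
  rw [← abs_mul, abs_of_nonneg]
  rcases le_or_gt 0 s.im with h | h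
  · exact mul_nonneg h (Complex.arg_nonneg_iff.mpr h)
  · exact mul_nonneg_of_nonpos_of_nonpos h.le (Complex.arg_neg_iff.mpr h).le

theorem abs_im_mul_le {s : ℂ} (hs : 0 < s.re) :
    |s.im| * (Real.pi / 2 - |s.arg|) ≤ Real.pi / 2 * s.re := by
  have h0 : 0 ≤ Real.pi / 2 - |s.arg| := by
    linarith [Complex.abs_arg_le_pi_div_two_iff.mpr hs.le]
  have h1 := Real.mul_le_sin h0 (by linarith [abs_nonneg s.arg])
  rw [Real.sin_pi_div_two_sub, Real.cos_abs,
    Complex.cos_arg (by rintro rfl; simp at hs)] at h1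
  have h2 : 0 < ‖s‖ := norm_pos_iff.mpr (by rintro rfl; simp at hs)
  rw [le_div_iff₀ h2] at h1
  have h3 := Real.pi_pos
  calc |s.im| * (Real.pi / 2 - |s.arg|) ≤ ‖s‖ * (Real.pi / 2 - |s.arg|) := by
        gcongr
        exact Complex.abs_im_le_norm s
    _ = Real.pi / 2 * (2 / Real.pi * (Real.pi / 2 - |s.arg|) * ‖s‖) := by field_simp
    _ ≤ _ := by gcongr

theorem norm_Gamma_half_add_sq (t : ℝ) :
    ‖Complex.Gamma (1 / 2 + t * Complex.I)‖ ^ 2 = Real.pi / Real.cosh (Real.pi * t) := by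
  have h := Complex.Gamma_mul_Gamma_one_sub (1 / 2 + t * Complex.I)
  have e1 : 1 - (1 / 2 + t * Complex.I) = (starRingEnd ℂ) (1 / 2 + t * Complex.I) := by
    simp [Complex.ext_iff]; norm_num
  have e2 : Complex.sin (Real.pi * (1 / 2 + t * Complex.I)) =
      ((Real.cosh (Real.pi * t) : ℝ) : ℂ) := by
    rw [show (Real.pi : ℂ) * (1 / 2 + t * Complex.I) =
      ((Real.pi * t : ℝ) : ℂ) * Complex.I + Real.pi / 2 by push_cast; ring,
      Complex.sin_add_pi_div_two, Complex.cos_mul_I, Complex.ofReal_cosh]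
  rw [e1, Complex.Gamma_conj, Complex.mul_conj, Complex.normSq_eq_norm_sq, e2] at h
  exact_mod_cast h

theorem norm_Gamma_half_add_le (t : ℝ) :
    ‖Complex.Gamma (1 / 2 + t * Complex.I)‖ ≤ 3 * Real.exp (-(Real.pi / 2) * |t|) := by
  refine le_of_sq_le_sq ?_ (by positivity)
  rw [norm_Gamma_half_add_sq, div_le_iff₀ (Real.cosh_pos _), mul_pow, ← Real.exp_nat_mul,
    ← Real.cosh_abs, Real.cosh_eq, abs_mul, abs_of_pos Real.pi_pos]
  have e : Real.exp (((2 : ℕ) : ℝ) * (-(Real.pi / 2) * |t|)) * Real.exp (Real.pi * |t|) = 1 := by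
    rw [← Real.exp_add, Real.exp_eq_one_iff]; push_cast; ring
  have h1 := mul_pos (Real.exp_pos (((2 : ℕ) : ℝ) * (-(Real.pi / 2) * |t|)))
    (Real.exp_pos (-(Real.pi * |t|)))
  nlinarith [Real.pi_le_four]

theorem norm_cexp_sub_half_mul_log {s : ℂ} (hs : 0 < s.re) :
    ‖Complex.exp (-((s - 1 / 2) * Complex.log s))‖ =
      ‖s‖ ^ (1 / 2 - s.re) * Real.exp (s.im * s.arg) := by
  have h2 : 0 < ‖s‖ := norm_pos_iff.mpr (by rintro rfl; simp at hs)
  rw [Complex.norm_exp, Real.rpow_def_of_pos h2, ← Real.exp_add]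
  congr 1
  simp [Complex.log_re, Complex.log_im]
  ring

theorem norm_Gamma_le_add {s : ℂ} (h1 : 1 / 2 ≤ s.re) (h2 : s.re ≤ 3 / 2) :
    ‖Complex.Gamma s‖ ≤ Real.Gamma (1 / 2) + Real.Gamma (3 / 2) := by
  rw [Complex.Gamma_eq_integral (by linarith), Complex.GammaIntegral,
    Real.Gamma_eq_integral (by norm_num), Real.Gamma_eq_integral (by norm_num),
    ← MeasureTheory.integral_add (Real.GammaIntegral_convergent (by norm_num))
      (Real.GammaIntegral_convergent (by norm_num))]
  refine MeasureTheory.norm_integral_le_of_norm_le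
    ((Real.GammaIntegral_convergent (by norm_num)).add
      (Real.GammaIntegral_convergent (by norm_num))) ?_
  filter_upwards [MeasureTheory.ae_restrict_mem measurableSet_Ioi] with x hx
  have hx0 : 0 < x := hx
  rw [norm_mul, Complex.norm_cpow_eq_rpow_re_of_pos hx0, Complex.norm_real, Real.norm_eq_abs,
    abs_of_pos (Real.exp_pos _), ← mul_add]
  gcongr
  rcases le_or_gt 1 x with h | h
  · have h3 : x ^ (s - 1).re ≤ x ^ ((3 : ℝ) / 2 - 1) :=
      Real.rpow_le_rpow_of_exponent_le h (by simp; linarith)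
    have := Real.rpow_nonneg hx0.le ((1 : ℝ) / 2 - 1)
    linarith
  · have h3 : x ^ (s - 1).re ≤ x ^ ((1 : ℝ) / 2 - 1) :=
      Real.rpow_le_rpow_of_exponent_ge hx0 h.le (by simp; linarith)
    have := Real.rpow_nonneg hx0.le ((3 : ℝ) / 2 - 1)
    linarith

theorem norm_Gamma_mul_cexp_le {s : ℂ} (h1 : 1 / 2 ≤ s.re) (h2 : s.re ≤ 3 / 2) :
    ‖Complex.Gamma s * Complex.exp (-((s - 1 / 2) * Complex.log s))‖ ≤ 3 := by
  have hhalf : ∀ t : ℝ, ∀ a : ℝ, |a| ≤ Real.pi / 2 →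
      ‖Complex.Gamma (1 / 2 + t * Complex.I)‖ * Real.exp (|t| * |a|) ≤ 3 := by
    intro t a ha
    calc _ ≤ 3 * Real.exp (-(Real.pi / 2) * |t|) * Real.exp (|t| * (Real.pi / 2)) := by
          gcongr
          exact norm_Gamma_half_add_le t
      _ = 3 := by
          rw [mul_assoc, ← Real.exp_add]
          ring_nf
          simp
  refine PhragmenLindelof.vertical_strip (a := 1 / 2) (b := 3 / 2)
    (f := fun s => Complex.Gamma s * Complex.exp (-((s - 1 / 2) * Complex.log s)))
    ?_ ⟨1, ?_, Real.pi, ?_⟩ ?_ ?_ h1 h2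
  · refine DifferentiableOn.diffContOnCl ?_
    rw [Complex.closure_preimage_re, closure_Ioo (by norm_num)]
    intro w hw
    have hw0 : 0 < w.re := by linarith [hw.1]
    refine DifferentiableAt.differentiableWithinAt (DifferentiableAt.mul ?_ ?_)
    · refine Complex.differentiableAt_Gamma w fun m hm => ?_
      rw [hm] at hw0
      simp at hw0
      linarith [(Nat.cast_nonneg m : (0 : ℝ) ≤ m)]
    · have := Complex.differentiableAt_log (Or.inl hw0 : w ∈ Complex.slitPlane)
      fun_prop
  · norm_num
    linarith [Real.pi_gt_three]
  · refine Asymptotics.IsBigO.of_bound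
      (2 * (Real.Gamma (1 / 2) + Real.Gamma (3 / 2))) ?_
    refine Filter.eventually_inf_principal.mpr (Filter.Eventually.of_forall fun w hw => ?_)
    have hw1 : 1 / 2 < w.re := hw.1
    have hw2 : w.re < 3 / 2 := hw.2
    have hw0 : 0 < w.re := by linarith
    have hnorm : 1 / 2 ≤ ‖w‖ := hw1.le.trans (Complex.re_le_norm w)
    have hpow : ‖w‖ ^ (1 / 2 - w.re) ≤ 2 := by
      calc ‖w‖ ^ (1 / 2 - w.re) ≤ (1 / 2 : ℝ) ^ (1 / 2 - w.re) :=
            Real.rpow_le_rpow_of_nonpos (by norm_num) hnorm (by linarith)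
        _ ≤ (1 / 2 : ℝ) ^ (-1 : ℝ) :=
            Real.rpow_le_rpow_of_exponent_ge (by norm_num) (by norm_num) (by linarith)
        _ = 2 := by rw [Real.rpow_neg_one]; norm_num
    have harg := Complex.abs_arg_le_pi_div_two_iff.mpr hw0.le
    have hexp : Real.exp (|w.im| * |w.arg|) ≤ Real.exp (Real.pi * Real.exp (1 * |w.im|)) := by
      refine Real.exp_le_exp.mpr ?_
      have := Real.add_one_le_exp (1 * |w.im|)
      have hi := abs_nonneg w.im
      have hpi := Real.pi_pos
      calc |w.im| * |w.arg| ≤ Real.exp (1 * |w.im|) * Real.pi := by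
            gcongr <;> linarith
        _ = _ := mul_comm _ _
    have hG := norm_Gamma_le_add hw1.le hw2.le
    rw [norm_mul, norm_cexp_sub_half_mul_log hw0, im_mul_arg_eq, Real.norm_eq_abs,
      abs_of_pos (Real.exp_pos _)]
    calc _ ≤ (Real.Gamma (1 / 2) + Real.Gamma (3 / 2)) *
          (2 * Real.exp (Real.pi * Real.exp (1 * |w.im|))) := by
          have := (norm_nonneg _).trans hG
          gcongr
      _ = _ := by ring
  · intro w hw
    have hw0 : 0 < w.re := by linarith
    rw [norm_mul, norm_cexp_sub_half_mul_log hw0, hw, sub_self, Real.rpow_zero, one_mul,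
      im_mul_arg_eq]
    have e : w = 1 / 2 + w.im * Complex.I := by
      apply Complex.ext <;> simp [hw]
    have := hhalf w.im w.arg (Complex.abs_arg_le_pi_div_two_iff.mpr hw0.le)
    rwa [← e] at this
  · intro w hw
    have hw0 : 0 < w.re := by linarith
    have e : w = 1 / 2 + w.im * Complex.I + 1 := by
      apply Complex.ext <;> simp [hw]; norm_num
    have hne : (1 / 2 + w.im * Complex.I : ℂ) ≠ 0 := by
      intro h
      have := congrArg Complex.re h
      simp at this
    have hle : ‖(1 / 2 + w.im * Complex.I : ℂ)‖ ≤ ‖w‖ := by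
      rw [Complex.norm_eq_sqrt_sq_add_sq, Complex.norm_eq_sqrt_sq_add_sq]
      refine Real.sqrt_le_sqrt ?_
      simp [hw]
      norm_num
    have hG : Complex.Gamma w = (1 / 2 + w.im * Complex.I) *
        Complex.Gamma (1 / 2 + w.im * Complex.I) := by
      rw [← Complex.Gamma_add_one _ hne, ← e]
    rw [norm_mul, norm_cexp_sub_half_mul_log hw0, hw, im_mul_arg_eq, hG, norm_mul]
    have hwn : 0 < ‖w‖ := norm_pos_iff.mpr (by rintro rfl; simp at hw0)
    have := hhalf w.im w.arg (Complex.abs_arg_le_pi_div_two_iff.mpr hw0.le)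
    rw [show (1 / 2 - 3 / 2 : ℝ) = -1 by norm_num, Real.rpow_neg_one]
    calc _ = (‖(1 / 2 + w.im * Complex.I : ℂ)‖ / ‖w‖) *
          (‖Complex.Gamma (1 / 2 + w.im * Complex.I)‖ * Real.exp (|w.im| * |w.arg|)) := by
          field_simp
      _ ≤ 1 * 3 := by
          gcongr
          exact div_le_one_of_le₀ hle hwn.le
      _ = 3 := by norm_num

theorem exists_norm_Gamma_le : ∃ C : ℝ, 0 < C ∧ ∀ s : ℂ, 1 / 2 ≤ s.re → s.re ≤ 3 / 2 →
    ‖Complex.Gamma s‖ ≤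
      C * (1 + |s.im|) ^ (s.re - 1 / 2) * Real.exp (-(Real.pi / 2) * |s.im|) := by
  refine ⟨6 * Real.exp 3, by positivity, fun s h1 h2 => ?_⟩
  have hs : 0 < s.re := by linarith
  have hsn : 0 < ‖s‖ := norm_pos_iff.mpr (by rintro rfl; simp at hs)
  have h := norm_Gamma_mul_cexp_le h1 h2
  rw [norm_mul, norm_cexp_sub_half_mul_log hs, im_mul_arg_eq] at h
  have h3 := abs_im_mul_le hs
  have h4 : Real.exp (Real.pi / 2 * |s.im|) ≤ Real.exp 3 * Real.exp (|s.im| * |s.arg|) := by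
    rw [← Real.exp_add]
    refine Real.exp_le_exp.mpr ?_
    nlinarith [Real.pi_le_four]
  have h5 : ‖s‖ ^ (s.re - 1 / 2) ≤ 2 * (1 + |s.im|) ^ (s.re - 1 / 2) := by
    have h6 : ‖s‖ ≤ 2 * (1 + |s.im|) := by
      have := Complex.norm_le_abs_re_add_abs_im s
      rw [abs_of_pos hs] at this
      linarith [abs_nonneg s.im]
    calc ‖s‖ ^ (s.re - 1 / 2) ≤ (2 * (1 + |s.im|)) ^ (s.re - 1 / 2) :=
          Real.rpow_le_rpow hsn.le h6 (by linarith)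
      _ = 2 ^ (s.re - 1 / 2) * (1 + |s.im|) ^ (s.re - 1 / 2) :=
          Real.mul_rpow (by norm_num) (by positivity)
      _ ≤ 2 ^ (1 : ℝ) * (1 + |s.im|) ^ (s.re - 1 / 2) := by
          gcongr
          · norm_num
          · linarith
      _ = _ := by rw [Real.rpow_one]
  have e1 : ‖s‖ ^ (1 / 2 - s.re) * ‖s‖ ^ (s.re - 1 / 2) = 1 := by
    rw [← Real.rpow_add hsn]; simp
  have e2 : Real.exp (Real.pi / 2 * |s.im|) * Real.exp (-(Real.pi / 2) * |s.im|) = 1 := by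
    rw [← Real.exp_add]; simp
  calc ‖Complex.Gamma s‖ = ‖Complex.Gamma s‖ * (‖s‖ ^ (1 / 2 - s.re) * ‖s‖ ^ (s.re - 1 / 2)) *
        (Real.exp (Real.pi / 2 * |s.im|) * Real.exp (-(Real.pi / 2) * |s.im|)) := by
        rw [e1, e2]; ring
    _ ≤ ‖Complex.Gamma s‖ * (‖s‖ ^ (1 / 2 - s.re) * (2 * (1 + |s.im|) ^ (s.re - 1 / 2))) *
        (Real.exp 3 * Real.exp (|s.im| * |s.arg|) * Real.exp (-(Real.pi / 2) * |s.im|)) := by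
        gcongr
    _ = (‖Complex.Gamma s‖ * (‖s‖ ^ (1 / 2 - s.re) * Real.exp (|s.im| * |s.arg|))) *
        (2 * (1 + |s.im|) ^ (s.re - 1 / 2)) *
        (Real.exp 3 * Real.exp (-(Real.pi / 2) * |s.im|)) := by ring
    _ ≤ 3 * (2 * (1 + |s.im|) ^ (s.re - 1 / 2)) *
        (Real.exp 3 * Real.exp (-(Real.pi / 2) * |s.im|)) := by gcongr
    _ = _ := by ring

theorem integrableOn_cpow_mul_cexp_neg {a z : ℂ} (ha : 0 < a.re) (hz : 0 < z.re) :
    MeasureTheory.IntegrableOn (fun t : ℝ => (t : ℂ) ^ (a - 1) * Complex.exp (-(z * t)))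
      (Set.Ioi 0) := by
  have h := integrableOn_rpow_mul_exp_neg_mul_rpow (s := a.re - 1) (p := 1) (b := z.re)
    (by linarith) one_pos hz
  refine MeasureTheory.Integrable.mono' h ?_ ?_
  · refine ContinuousOn.aestronglyMeasurable (fun t ht => ?_) measurableSet_Ioi
    have ht0 : (0 : ℝ) < t := ht
    refine ContinuousWithinAt.mul (ContinuousAt.continuousWithinAt ?_) (by fun_prop)
    exact Complex.continuousAt_ofReal_cpow_const _ _ (Or.inr ht0.ne')
  · filter_upwards [MeasureTheory.ae_restrict_mem measurableSet_Ioi] with t ht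
    have ht0 : (0 : ℝ) < t := ht
    rw [norm_mul, Complex.norm_cpow_eq_rpow_re_of_pos ht0, Complex.norm_exp]
    simp

theorem hasDerivAt_integral_cpow_mul_cexp_neg {a z : ℂ} (ha : 0 < a.re) (hz : 0 < z.re) :
    DifferentiableAt ℂ (fun z : ℂ => ∫ t : ℝ in Set.Ioi 0,
      (t : ℂ) ^ (a - 1) * Complex.exp (-(z * t))) z := by
  have hs : {w : ℂ | z.re / 2 < w.re} ∈ nhds z :=
    (isOpen_lt continuous_const Complex.continuous_re).mem_nhds (by simp; linarith)
  have hre : ∀ w ∈ {w : ℂ | z.re / 2 < w.re}, z.re / 2 < w.re := fun w hw => hw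
  have hb := integrableOn_rpow_mul_exp_neg_mul_rpow (s := a.re) (p := 1) (b := z.re / 2)
    (by linarith) one_pos (by linarith)
  have h := hasDerivAt_integral_of_dominated_loc_of_deriv_le
    (μ := MeasureTheory.volume.restrict (Set.Ioi (0 : ℝ)))
    (F := fun (z : ℂ) (t : ℝ) => (t : ℂ) ^ (a - 1) * Complex.exp (-(z * t)))
    (F' := fun (z : ℂ) (t : ℝ) => (t : ℂ) ^ (a - 1) * (Complex.exp (-(z * t)) * (-t)))
    hs ?_ (integrableOn_cpow_mul_cexp_neg ha hz) ?_ ?_ hb ?_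
  · exact h.2.differentiableAt
  · filter_upwards [hs] with w hw
    have := hre w hw
    exact (integrableOn_cpow_mul_cexp_neg ha (by linarith)).1
  · have := (integrableOn_cpow_mul_cexp_neg ha hz).1.mul
      (Continuous.aestronglyMeasurable (f := fun t : ℝ => (-t : ℂ)) (by fun_prop))
    refine this.congr (Filter.Eventually.of_forall fun t => ?_)
    simp only [Pi.mul_apply]; ring
  · filter_upwards [MeasureTheory.ae_restrict_mem measurableSet_Ioi] with t ht w hw
    have ht0 : (0 : ℝ) < t := ht
    have := hre w hw
    rw [norm_mul, norm_mul, Complex.norm_cpow_eq_rpow_re_of_pos ht0, Complex.norm_exp, norm_neg,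
      Complex.norm_real, Real.norm_eq_abs, abs_of_pos ht0, Real.rpow_one]
    have e : t ^ a.re = t ^ (a - 1).re * t := by
      rw [← Real.rpow_add_one ht0.ne']; simp
    rw [e]
    have h2 : Real.exp (-(w * t) : ℂ).re ≤ Real.exp (-(z.re / 2) * t) := by
      refine Real.exp_le_exp.mpr ?_
      simp
      gcongr
    calc _ = t ^ (a - 1).re * t * Real.exp (-(w * t) : ℂ).re := by ring
      _ ≤ _ := by gcongr
  · refine Filter.Eventually.of_forall fun t w hw => ?_
    refine HasDerivAt.const_mul _ ?_
    have h1 : HasDerivAt (fun w : ℂ => -(w * t)) (-t) w := by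
      simpa using ((hasDerivAt_id' w).mul_const (t : ℂ)).fun_neg
    exact h1.cexp

theorem integral_cpow_mul_cexp_neg {a z : ℂ} (ha : 0 < a.re) (hz : 0 < z.re) :
    ∫ t : ℝ in Set.Ioi 0, (t : ℂ) ^ (a - 1) * Complex.exp (-(z * t)) =
      Complex.Gamma a * Complex.exp (-(a * Complex.log z)) := by
  have hopen : IsOpen {w : ℂ | 0 < w.re} := isOpen_lt continuous_const Complex.continuous_re
  have h1 : AnalyticOnNhd ℂ (fun z : ℂ => ∫ t : ℝ in Set.Ioi 0,
      (t : ℂ) ^ (a - 1) * Complex.exp (-(z * t))) {w : ℂ | 0 < w.re} :=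
    DifferentiableOn.analyticOnNhd (fun w hw =>
      (hasDerivAt_integral_cpow_mul_cexp_neg ha hw).differentiableWithinAt) hopen
  have h2 : AnalyticOnNhd ℂ (fun z : ℂ => Complex.Gamma a * Complex.exp (-(a * Complex.log z)))
      {w : ℂ | 0 < w.re} := by
    refine DifferentiableOn.analyticOnNhd (fun w hw => ?_) hopen
    have := Complex.differentiableAt_log (Or.inl hw : w ∈ Complex.slitPlane)
    refine DifferentiableAt.differentiableWithinAt ?_
    fun_prop
  refine h1.eqOn_of_preconnected_of_frequently_eq (z₀ := 1) h2
    (convex_halfSpace_re_gt 0).isPreconnected (by simp) ?_ hz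
  have h3 : ∃ᶠ r : ℝ in nhdsWithin 1 {1}ᶜ, 0 < r :=
    (eventually_nhdsWithin_of_eventually_nhds (lt_mem_nhds one_pos)).frequently
  have h4 : Filter.Tendsto (fun r : ℝ => (r : ℂ)) (nhdsWithin 1 {1}ᶜ) (nhdsWithin 1 {1}ᶜ) := by
    refine tendsto_nhdsWithin_of_tendsto_nhds_of_eventually_within _ ?_ ?_
    · refine (Complex.continuous_ofReal.tendsto' 1 1 (by simp)).mono_left nhdsWithin_le_nhds
    · filter_upwards [self_mem_nhdsWithin] with r hr
      simpa using hr
  refine h4.frequently (h3.mono fun r hr => ?_)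
  have := Complex.integral_cpow_mul_exp_neg_mul_Ioi ha hr
  rw [this, mul_comm, ← Complex.ofReal_log hr.le, one_div, ← Complex.ofReal_inv,
    Complex.cpow_def_of_ne_zero (by simpa using hr.ne'), ← Complex.ofReal_log (by positivity),
    Real.log_inv]
  congr 2
  push_cast
  ring

theorem mellin_cexp_neg {a z : ℂ} (ha : 0 < a.re) (hz : 0 < z.re) :
    mellin (fun t : ℝ => Complex.exp (-(z * t))) a =
      Complex.Gamma a * Complex.exp (-(a * Complex.log z)) := by
  rw [← integral_cpow_mul_cexp_neg ha hz, mellin]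
  simp only [smul_eq_mul]

theorem norm_cexp_neg_mul_log {s z : ℂ} (hz : 0 < z.re) :
    ‖Complex.exp (-(s * Complex.log z))‖ = ‖z‖ ^ (-s.re) * Real.exp (s.im * z.arg) := by
  have h2 : 0 < ‖z‖ := norm_pos_iff.mpr (by rintro rfl; simp at hz)
  rw [Complex.norm_exp, Real.rpow_def_of_pos h2, ← Real.exp_add]
  congr 1
  simp [Complex.log_re, Complex.log_im]
  ring

theorem norm_cexp_neg_mul_log_le {s z : ℂ} (hz : 0 < z.re) :
    ‖Complex.exp (-(s * Complex.log z))‖ ≤ ‖z‖ ^ (-s.re) * Real.exp (|s.im| * |z.arg|) := by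
  rw [norm_cexp_neg_mul_log hz, ← abs_mul]
  gcongr
  exact le_abs_self _

/-- The angular distance `π / 2 - |arg z|` of a point of the right half plane to the
imaginary axis. -/
noncomputable def argGap (z : ℂ) : ℝ := Real.pi / 2 - |z.arg|

theorem argGap_pos {z : ℂ} (hz : 0 < z.re) : 0 < argGap z := by
  have := Complex.abs_arg_lt_pi_div_two_iff.mpr (Or.inl hz)
  unfold argGap
  linarith

theorem argGap_le (z : ℂ) : argGap z ≤ Real.pi / 2 := by
  unfold argGap
  linarith [abs_nonneg z.arg]

theorem exists_norm_Gamma_mul_cexp_le : ∃ C : ℝ, 0 < C ∧ ∀ z : ℂ, 0 < z.re → ∀ s : ℂ,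
    1 / 2 ≤ s.re → s.re ≤ 3 / 2 →
    ‖Complex.Gamma s * Complex.exp (-(s * Complex.log z))‖ ≤
      C * (1 + |s.im|) ^ (s.re - 1 / 2) * ‖z‖ ^ (-s.re) * Real.exp (-argGap z * |s.im|) := by
  obtain ⟨C, hC, h⟩ := exists_norm_Gamma_le
  refine ⟨C, hC, fun z hz s h1 h2 => ?_⟩
  rw [norm_mul]
  have e : Real.exp (-argGap z * |s.im|) = Real.exp (-(Real.pi / 2) * |s.im|) *
      Real.exp (|s.im| * |z.arg|) := by
    rw [← Real.exp_add, argGap]; congr 1; ring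
  calc _ ≤ (C * (1 + |s.im|) ^ (s.re - 1 / 2) * Real.exp (-(Real.pi / 2) * |s.im|)) *
        (‖z‖ ^ (-s.re) * Real.exp (|s.im| * |z.arg|)) := by
        gcongr
        · exact h s h1 h2
        · exact norm_cexp_neg_mul_log_le hz
    _ = _ := by rw [e]; ring

theorem one_add_abs_sq_le {a : ℝ} (ha : 0 < a) (t : ℝ) :
    (1 + |t|) ^ 2 ≤ (1 + 2 / a) ^ 2 * Real.exp (a * |t|) := by
  have h1 := Real.add_one_le_exp (a / 2 * |t|)
  have h2 : 1 + |t| ≤ (1 + 2 / a) * Real.exp (a / 2 * |t|) := by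
    have h3 : |t| = 2 / a * (a / 2 * |t|) := by field_simp
    have h4 := Real.one_le_exp (x := a / 2 * |t|) (by positivity)
    have h5 : 2 / a * (a / 2 * |t|) ≤ 2 / a * Real.exp (a / 2 * |t|) := by
      gcongr
      linarith
    linarith
  calc (1 + |t|) ^ 2 ≤ ((1 + 2 / a) * Real.exp (a / 2 * |t|)) ^ 2 := by gcongr
    _ = _ := by
      rw [mul_pow, ← Real.exp_nat_mul]
      congr 2
      push_cast
      ring

theorem logWeight_le_one_add (t : ℝ) : logWeight t ≤ 1 + |t| := by
  have := Real.log_le_sub_one_of_pos (show 0 < |t| + 2 by positivity)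
  unfold logWeight
  linarith

theorem tendsto_exp_neg_mul_abs {a : ℝ} (ha : 0 < a) :
    Filter.Tendsto (fun t : ℝ => Real.exp (-a * |t|)) (Filter.cocompact ℝ) (nhds 0) := by
  refine Real.tendsto_exp_atBot.comp ?_
  have : Filter.Tendsto (fun t : ℝ => a * ‖t‖) (Filter.cocompact ℝ) Filter.atTop :=
    tendsto_norm_cocompact_atTop.const_mul_atTop ha
  refine (Filter.tendsto_neg_atTop_atBot.comp this).congr fun t => ?_
  simp

/-- The function `Γ(s) z^{-s}`. -/
noncomputable def gammaKernel (z s : ℂ) : ℂ := Complex.Gamma s * Complex.exp (-(s * Complex.log z))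

theorem differentiableAt_gammaKernel {z s : ℂ} (hs : 0 < s.re) :
    DifferentiableAt ℂ (gammaKernel z) s := by
  unfold gammaKernel
  refine DifferentiableAt.mul (Complex.differentiableAt_Gamma s fun m hm => ?_) (by fun_prop)
  rw [hm] at hs
  simp at hs
  linarith [(Nat.cast_nonneg m : (0 : ℝ) ≤ m)]

theorem continuous_gammaKernel_line {z : ℂ} {σ : ℝ} (hσ : 0 < σ) :
    Continuous fun t : ℝ => gammaKernel z (σ + t * Complex.I) := by
  refine continuous_iff_continuousAt.mpr fun t => ?_
  refine ContinuousAt.comp (f := fun t : ℝ => (σ + t * Complex.I : ℂ))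
    (differentiableAt_gammaKernel (by simpa using hσ)).continuousAt (by fun_prop)

theorem exists_gammaKernel_bound {z : ℂ} (hz : 0 < z.re) : ∃ K : ℝ, 0 < K ∧ ∀ s : ℂ,
    1 / 2 ≤ s.re → s.re ≤ 3 / 2 →
    logWeight s.im * ‖gammaKernel z s‖ ≤ K * Real.exp (-(argGap z / 2) * |s.im|) := by
  obtain ⟨C, hC, h⟩ := exists_norm_Gamma_mul_cexp_le
  have hφ := argGap_pos hz
  have h2 : 0 < ‖z‖ := norm_pos_iff.mpr (by rintro rfl; simp at hz)
  refine ⟨C * (‖z‖ ^ (-(1 / 2) : ℝ) + ‖z‖ ^ (-(3 / 2) : ℝ)) * (1 + 2 / (argGap z / 2)) ^ 2,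
    by positivity, fun s h1 h3 => ?_⟩
  have h4 : ‖z‖ ^ (-s.re) ≤ ‖z‖ ^ (-(1 / 2) : ℝ) + ‖z‖ ^ (-(3 / 2) : ℝ) := by
    have p1 := Real.rpow_nonneg h2.le (-(1 / 2) : ℝ)
    have p2 := Real.rpow_nonneg h2.le (-(3 / 2) : ℝ)
    rcases le_or_gt 1 ‖z‖ with h | h
    · have := Real.rpow_le_rpow_of_exponent_le h (show -s.re ≤ -(1 / 2) by linarith)
      linarith
    · have := Real.rpow_le_rpow_of_exponent_ge h2 h.le (show -(3 / 2) ≤ -s.re by linarith)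
      linarith
  have h5 : (1 + |s.im|) ^ (s.re - 1 / 2) ≤ 1 + |s.im| := by
    refine (Real.rpow_le_rpow_of_exponent_le (by linarith [abs_nonneg s.im])
      (show s.re - 1 / 2 ≤ 1 by linarith)).trans_eq (Real.rpow_one _)
  have h6 := one_add_abs_sq_le (half_pos hφ) s.im
  have e : Real.exp (argGap z / 2 * |s.im|) * Real.exp (-argGap z * |s.im|) =
      Real.exp (-(argGap z / 2) * |s.im|) := by
    rw [← Real.exp_add]; congr 1; ring
  calc logWeight s.im * ‖gammaKernel z s‖
      ≤ (1 + |s.im|) * (C * (1 + |s.im|) *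
        (‖z‖ ^ (-(1 / 2) : ℝ) + ‖z‖ ^ (-(3 / 2) : ℝ)) * Real.exp (-argGap z * |s.im|)) := by
        have := logWeight_le_one_add s.im
        have hG := h z hz s h1 h3
        gcongr
        refine hG.trans ?_
        gcongr
    _ = C * (‖z‖ ^ (-(1 / 2) : ℝ) + ‖z‖ ^ (-(3 / 2) : ℝ)) * (1 + |s.im|) ^ 2 *
        Real.exp (-argGap z * |s.im|) := by ring
    _ ≤ C * (‖z‖ ^ (-(1 / 2) : ℝ) + ‖z‖ ^ (-(3 / 2) : ℝ)) *
        ((1 + 2 / (argGap z / 2)) ^ 2 * Real.exp (argGap z / 2 * |s.im|)) *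
        Real.exp (-argGap z * |s.im|) := by gcongr
    _ = C * (‖z‖ ^ (-(1 / 2) : ℝ) + ‖z‖ ^ (-(3 / 2) : ℝ)) * (1 + 2 / (argGap z / 2)) ^ 2 *
        (Real.exp (argGap z / 2 * |s.im|) * Real.exp (-argGap z * |s.im|)) := by ring
    _ = _ := by rw [e]

theorem integrable_gammaKernel_line {z : ℂ} (hz : 0 < z.re) {σ : ℝ} (h1 : 1 / 2 ≤ σ)
    (h2 : σ ≤ 3 / 2) :
    MeasureTheory.Integrable fun t : ℝ => gammaKernel z (σ + t * Complex.I) := by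
  obtain ⟨K, hK, h⟩ := exists_gammaKernel_bound hz
  refine ((integrable_exp_neg_mul_abs (half_pos (argGap_pos hz))).const_mul (2 * K)).mono'
    (continuous_gammaKernel_line (by linarith)).aestronglyMeasurable
    (Filter.Eventually.of_forall fun t => ?_)
  have := h (σ + t * Complex.I) (by simpa using h1) (by simpa using h2)
  simp only [Complex.add_im, Complex.ofReal_im, Complex.mul_im, Complex.ofReal_re, Complex.I_im,
    mul_one, Complex.I_re, mul_zero, add_zero, zero_add] at this
  have h3 := half_le_logWeight t
  have h4 := norm_nonneg (gammaKernel z (σ + t * Complex.I))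
  nlinarith

theorem cexp_neg_eq_integral {z : ℂ} (hz : 0 < z.re) {σ : ℝ} (h1 : 1 / 2 ≤ σ)
    (h2 : σ ≤ 3 / 2) {x : ℝ} (hx : 0 < x) :
    ∫ t : ℝ, (x : ℂ) ^ (-(σ + t * Complex.I)) * gammaKernel z (σ + t * Complex.I) =
      2 * Real.pi * Complex.exp (-(z * x)) := by
  have hσ : 0 < σ := by linarith
  have hm : ∀ t : ℝ, mellin (fun t : ℝ => Complex.exp (-(z * t))) (σ + t * Complex.I) =
      gammaKernel z (σ + t * Complex.I) := fun t => mellin_cexp_neg (by simpa using hσ) hz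
  have h := mellinInv_mellin_eq σ (fun t : ℝ => Complex.exp (-(z * t))) hx
    (integrableOn_cpow_mul_cexp_neg (by simpa using hσ) hz)
    ((integrable_gammaKernel_line hz h1 h2).congr
      (Filter.Eventually.of_forall fun t => (hm t).symm)) (by fun_prop)
  rw [mellinInv] at h
  simp_rw [hm] at h
  rw [← h]
  simp only [smul_eq_mul, Complex.real_smul]
  have : (Real.pi : ℂ) ≠ 0 := by exact_mod_cast Real.pi_ne_zero
  generalize (∫ t : ℝ, (x : ℂ) ^ (-(σ + t * Complex.I)) * gammaKernel z (σ + t * Complex.I)) = J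
  push_cast
  field_simp

theorem LSeries_vonMangoldt_eq_sub_logDeriv {s : ℂ} (hs : 1 < s.re) :
    LSeries (fun n => (ArithmeticFunction.vonMangoldt n : ℂ)) s =
      1 / (s - 1) - logDeriv riemannZeta₁ s := by
  have hs1 : s ≠ 1 := by rintro rfl; simp at hs
  have hs2 : s - 1 ≠ 0 := sub_ne_zero_of_ne hs1
  rw [ArithmeticFunction.LSeries_vonMangoldt_eq_deriv_riemannZeta_div hs]
  have h0 := riemannZeta_ne_zero_of_one_le_re hs.le
  rw [riemannZeta_eq_inv_sub_mul hs1] at h0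
  have h1 : riemannZeta₁ s ≠ 0 := right_ne_zero_of_mul h0
  rw [deriv_riemannZeta_eq_neg_inv_sub_sq_mul_add hs1, riemannZeta_eq_inv_sub_mul hs1,
    logDeriv_apply]
  field_simp
  ring

/-- The integrand `(ζ'/ζ(s) + 1/(s-1)) Γ(s) z^{-s}`. -/
noncomputable def zetaKernel (z s : ℂ) : ℂ := logDeriv riemannZeta₁ s * gammaKernel z s

theorem zetaKernel_shift (hRH : RiemannHypothesis) {z : ℂ} (hz : 0 < z.re) {c : ℝ}
    (hc : 1 / 2 < c) (hc' : c ≤ 3 / 2) :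
    MeasureTheory.Integrable (fun t : ℝ => zetaKernel z (c + t * Complex.I)) ∧
    MeasureTheory.Integrable (fun t : ℝ => zetaKernel z ((3 / 2 : ℝ) + t * Complex.I)) ∧
    ∫ t : ℝ, zetaKernel z (c + t * Complex.I) =
      ∫ t : ℝ, zetaKernel z ((3 / 2 : ℝ) + t * Complex.I) := by
  obtain ⟨C, hC, hF⟩ := exists_logDeriv_riemannZeta₁_bounds hRH
  obtain ⟨K, hK, h⟩ := exists_gammaKernel_bound hz
  have ha := half_pos (argGap_pos hz)
  have hc0 : 0 < c - 1 / 2 := by linarith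
  refine integral_vertical_shift (f := zetaKernel z) (a := c) (b := (3 / 2 : ℝ))
    (g := fun t => C / (c - 1 / 2) * K * Real.exp (-(argGap z / 2) * |t|)) hc' ?_ ?_ ?_ ?_
  · intro s h1 _
    exact (differentiableAt_logDeriv_riemannZeta₁ hRH (by linarith)).mul
      (differentiableAt_gammaKernel (by linarith))
  · exact (integrable_exp_neg_mul_abs ha).const_mul _
  · simpa using (tendsto_exp_neg_mul_abs ha).const_mul (C / (c - 1 / 2) * K)
  · intro s h1 h2
    have h3 := (hF s (by linarith) h2).2
    have h4 := h s (by linarith) h2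
    change _ ≤ C * logWeight s.im / (s.re - 1 / 2) at h3
    have h5 : C * logWeight s.im / (s.re - 1 / 2) ≤ C * logWeight s.im / (c - 1 / 2) := by
      have := half_le_logWeight s.im
      gcongr
    rw [zetaKernel, norm_mul]
    calc _ ≤ C * logWeight s.im / (c - 1 / 2) * ‖gammaKernel z s‖ := by
          gcongr
          exact h3.trans h5
      _ = C / (c - 1 / 2) * (logWeight s.im * ‖gammaKernel z s‖) := by ring
      _ ≤ C / (c - 1 / 2) * (K * Real.exp (-(argGap z / 2) * |s.im|)) := by gcongr
      _ = _ := by ring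

theorem gammaKernel_div_sub_one {z s : ℂ} (hz : 0 < z.re) (hs : s ≠ 1) :
    1 / (s - 1) * gammaKernel z s = 1 / z * gammaKernel z (s - 1) := by
  have hz0 : z ≠ 0 := by rintro rfl; simp at hz
  have hs1 : s - 1 ≠ 0 := sub_ne_zero_of_ne hs
  have h1 := Complex.Gamma_add_one (s - 1) hs1
  rw [sub_add_cancel] at h1
  have h2 : Complex.exp (-(s * Complex.log z)) =
      Complex.exp (-((s - 1) * Complex.log z)) * z⁻¹ := by
    conv_rhs => rw [← Complex.exp_log hz0, ← Complex.exp_neg, ← Complex.exp_add]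
    rw [Complex.exp_log hz0]
    congr 1
    ring
  rw [gammaKernel, gammaKernel, h1, h2]
  field_simp

theorem tsum_vonMangoldt_mul_cexp (hRH : RiemannHypothesis) {z : ℂ} (hz : 0 < z.re) {c : ℝ}
    (hc : 1 / 2 < c) (hc' : c ≤ 3 / 2) :
    ∑' n : ℕ, (ArithmeticFunction.vonMangoldt n : ℂ) * Complex.exp (-(z * n)) - 1 / z =
      (Complex.exp (-z) - 1) / z -
        1 / (2 * Real.pi) * ∫ t : ℝ, zetaKernel z (c + t * Complex.I) := by
  obtain ⟨-, hi, hshift⟩ := zetaKernel_shift hRH hz hc hc'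
  have hG := integrable_gammaKernel_line hz (σ := 3 / 2) (by norm_num) le_rfl
  have hG1 := integrable_gammaKernel_line hz (σ := 1 / 2) le_rfl (by norm_num)
  set Λ : ℕ → ℂ := fun n => (ArithmeticFunction.vonMangoldt n : ℂ) with hΛ
  set S : ℝ → ℂ := fun t => ((3 / 2 : ℝ) : ℂ) + t * Complex.I with hS
  have hSre : ∀ t, (S t).re = 3 / 2 := by intro t; simp [hS]
  have hSne : ∀ t, S t ≠ 1 := by
    intro t h
    have := hSre t
    rw [h] at this
    norm_num at this
  set F : ℕ → ℝ → ℂ := fun n t => LSeries.term Λ (S t) n * gammaKernel z (S t) with hF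
  have hterm : ∀ n ≠ 0, ∀ t, F n t = Λ n * (((n : ℝ) : ℂ) ^ (-S t) * gammaKernel z (S t)) := by
    intro n hn t
    rw [hF]
    simp only
    rw [LSeries.term_of_ne_zero hn, Complex.cpow_neg, Complex.ofReal_natCast]
    ring
  have hnorm : ∀ n t, ‖F n t‖ = ‖LSeries.term Λ ((3 / 2 : ℝ) : ℂ) n‖ * ‖gammaKernel z (S t)‖ := by
    intro n t
    rw [hF, norm_mul]
    congr 1
    rcases eq_or_ne n 0 with rfl | hn
    · simp
    · rw [LSeries.term_of_ne_zero hn, LSeries.term_of_ne_zero hn, norm_div, norm_div,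
        Complex.norm_natCast_cpow_of_pos (Nat.pos_of_ne_zero hn),
        Complex.norm_natCast_cpow_of_pos (Nat.pos_of_ne_zero hn), hSre, Complex.ofReal_re]
  have hFi : ∀ n, MeasureTheory.Integrable (F n) := by
    intro n
    rcases eq_or_ne n 0 with rfl | hn
    · simp [hF]
    · refine MeasureTheory.Integrable.mono'
        (hG.norm.const_mul ‖LSeries.term Λ ((3 / 2 : ℝ) : ℂ) n‖) ?_
        (Filter.Eventually.of_forall fun t => (hnorm n t).le)
      refine Continuous.aestronglyMeasurable ?_
      have e : F n = fun t => Λ n * (((n : ℝ) : ℂ) ^ (-S t) * gammaKernel z (S t)) :=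
        funext (hterm n hn)
      rw [e]
      have hn0 : ((n : ℝ) : ℂ) ≠ 0 := by exact_mod_cast hn
      have hSc : Continuous S := by fun_prop
      have h1 : Continuous fun t => ((n : ℝ) : ℂ) ^ (-S t) :=
        hSc.neg.const_cpow (Or.inl hn0)
      exact continuous_const.mul (h1.mul (continuous_gammaKernel_line (by norm_num)))
  have hsum : Summable fun n => ∫ t, ‖F n t‖ := by
    simp_rw [hnorm, MeasureTheory.integral_const_mul]
    refine Summable.mul_right _ ?_
    exact (ArithmeticFunction.LSeriesSummable_vonMangoldt
      (s := ((3 / 2 : ℝ) : ℂ)) (by norm_num)).norm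
  have hintg : ∀ n, ∫ t, F n t = 2 * Real.pi * (Λ n * Complex.exp (-(z * n))) := by
    intro n
    rcases eq_or_ne n 0 with rfl | hn
    · simp [hF, hΛ]
    · simp_rw [hterm n hn]
      rw [MeasureTheory.integral_const_mul, cexp_neg_eq_integral hz (by norm_num) le_rfl
        (by exact_mod_cast Nat.pos_of_ne_zero hn : (0 : ℝ) < n)]
      push_cast
      ring
  have h := (MeasureTheory.hasSum_integral_of_summable_integral_norm hFi hsum).tsum_eq
  simp_rw [hintg] at h
  rw [tsum_mul_left] at h
  have hts : ∀ t, ∑' n, F n t = 1 / z * gammaKernel z ((1 / 2 : ℝ) + t * Complex.I) -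
      zetaKernel z (S t) := by
    intro t
    rw [hF]
    simp only
    rw [tsum_mul_right]
    change LSeries Λ (S t) * _ = _
    rw [LSeries_vonMangoldt_eq_sub_logDeriv (by rw [hSre]; norm_num), sub_mul,
      gammaKernel_div_sub_one hz (hSne t), zetaKernel]
    congr 3
    simp only [hS]
    push_cast
    ring
  simp_rw [hts] at h
  rw [MeasureTheory.integral_sub (hG1.const_mul _) hi, MeasureTheory.integral_const_mul] at h
  have h2 := cexp_neg_eq_integral hz (σ := 1 / 2) le_rfl (by norm_num) one_pos
  simp only [Complex.ofReal_one, Complex.one_cpow, one_mul, mul_one] at h2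
  rw [h2] at h
  have hpi : (Real.pi : ℂ) ≠ 0 := by exact_mod_cast Real.pi_ne_zero
  rw [hshift]
  have h3 : ∑' n, Λ n * Complex.exp (-(z * n)) = 1 / (2 * Real.pi) *
      (2 * Real.pi * ∑' n, Λ n * Complex.exp (-(z * n))) := by field_simp
  rw [h3, h]
  generalize (∫ t : ℝ, zetaKernel z (S t)) = J
  field_simp
  ring

theorem integral_abs_rpow_mul_exp_neg {a : ℝ} (ha : 0 < a) :
    ∫ t : ℝ, |t| ^ (-(1 / 2) : ℝ) * Real.exp (-a * |t|) = 2 * √(Real.pi / a) := by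
  rw [integral_comp_abs (f := fun t => t ^ (-(1 / 2) : ℝ) * Real.exp (-a * t))]
  have h := Real.integral_rpow_mul_exp_neg_mul_Ioi (a := 1 / 2) (by norm_num) ha
  rw [Real.Gamma_one_half_eq, ← Real.sqrt_eq_rpow, ← Real.sqrt_mul (by positivity)] at h
  rw [show Real.pi / a = 1 / a * Real.pi by ring, ← h]
  norm_num

theorem integrable_abs_rpow_mul_exp_neg {a : ℝ} (ha : 0 < a) :
    MeasureTheory.Integrable fun t : ℝ => |t| ^ (-(1 / 2) : ℝ) * Real.exp (-a * |t|) := by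
  refine MeasureTheory.Integrable.of_integral_ne_zero ?_
  rw [integral_abs_rpow_mul_exp_neg ha]
  have := Real.pi_pos
  positivity

theorem one_add_abs_rpow_le {L a : ℝ} (hL : 1 ≤ L) (h : Real.exp (-L) ≤ a) (t : ℝ) :
    (1 + |t|) ^ (1 / L) ≤ Real.exp 1 * Real.exp (a * |t|) := by
  have hL0 : 0 < L := by linarith
  have ha0 : 0 < a := (Real.exp_pos _).trans_le h
  have ht := abs_nonneg t
  have h1 : 1 + |t| ≤ Real.exp L * Real.exp (a * |t|) := by
    have h2 := Real.add_one_le_exp (a * |t|)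
    have h3 : 1 ≤ Real.exp L * a := by
      have := mul_le_mul_of_nonneg_left h (Real.exp_pos L).le
      rwa [← Real.exp_add, add_neg_cancel, Real.exp_zero] at this
    have h4 : 1 ≤ Real.exp L := Real.one_le_exp hL0.le
    nlinarith
  calc (1 + |t|) ^ (1 / L) ≤ (Real.exp L * Real.exp (a * |t|)) ^ (1 / L) := by gcongr
    _ = Real.exp 1 * Real.exp (a * |t| * (1 / L)) := by
      rw [← Real.exp_add, ← Real.exp_mul, ← Real.exp_add]
      congr 1
      field_simp
    _ ≤ _ := by
      have : 1 / L ≤ 1 := by rw [div_le_one hL0]; exact hL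
      have h5 : a * |t| * (1 / L) ≤ a * |t| := mul_le_of_le_one_right (by positivity) this
      gcongr

theorem rpow_neg_one_div_le {L x : ℝ} (hL : 0 < L) (hx : Real.exp (-L) ≤ x) :
    x ^ (-(1 / L)) ≤ Real.exp 1 := by
  have h := Real.rpow_le_rpow_of_nonpos (Real.exp_pos _) hx
    (show -(1 / L) ≤ 0 by simp [hL.le])
  refine h.trans_eq ?_
  rw [← Real.exp_mul]
  congr 1
  field_simp

theorem norm_gammaKernel_eq {z s : ℂ} (hz : 0 < z.re) (hs : s ≠ 0) :
    ‖gammaKernel z s‖ = ‖z‖ / ‖s‖ * ‖gammaKernel z (s + 1)‖ := by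
  have hz0 : z ≠ 0 := by rintro rfl; simp at hz
  have h := gammaKernel_div_sub_one hz (s := s + 1) (by simpa using hs)
  rw [add_sub_cancel_right] at h
  have : gammaKernel z s = z / s * gammaKernel z (s + 1) := by
    have : gammaKernel z s = z * (1 / z * gammaKernel z s) := by field_simp
    rw [this, ← h]
    ring
  rw [this, norm_mul, norm_div]

theorem exists_gammaKernel_bound_of_pos {z : ℂ} (hz : 0 < z.re) {δ : ℝ} (hδ : 0 < δ) :
    ∃ K : ℝ, 0 < K ∧ ∀ s : ℂ, δ ≤ s.re → s.re ≤ 3 / 2 →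
      logWeight s.im * ‖gammaKernel z s‖ ≤ K * Real.exp (-(argGap z / 2) * |s.im|) := by
  obtain ⟨K, hK, h⟩ := exists_gammaKernel_bound hz
  refine ⟨K * (1 + ‖z‖ / δ), by positivity, fun s h1 h2 => ?_⟩
  have hE := Real.exp_pos (-(argGap z / 2) * |s.im|)
  have hzd : 0 ≤ ‖z‖ / δ := by positivity
  rcases le_or_gt (1 / 2) s.re with h3 | h3
  · refine (h s h3 h2).trans ?_
    gcongr
    nlinarith
  · have hs0 : s ≠ 0 := by rintro rfl; simp at h1; linarith
    have h4 := h (s + 1) (by simp; linarith) (by simp; linarith)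
    simp only [Complex.add_im, Complex.one_im, add_zero] at h4
    rw [norm_gammaKernel_eq hz hs0]
    have h5 : δ ≤ ‖s‖ := h1.trans ((le_abs_self _).trans (Complex.abs_re_le_norm s))
    calc logWeight s.im * (‖z‖ / ‖s‖ * ‖gammaKernel z (s + 1)‖)
        = ‖z‖ / ‖s‖ * (logWeight s.im * ‖gammaKernel z (s + 1)‖) := by ring
      _ ≤ ‖z‖ / δ * (K * Real.exp (-(argGap z / 2) * |s.im|)) := by
        have := half_le_logWeight s.im
        gcongr
      _ ≤ _ := by nlinarith [mul_pos hK hE]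

theorem integral_conj_logDeriv_eq (hRH : RiemannHypothesis) {z : ℂ} (hz : 0 < z.re) {δ : ℝ}
    (hδ : 0 < δ) (hδ' : δ ≤ 1 / 2) :
    MeasureTheory.Integrable (fun t : ℝ =>
      (starRingEnd ℂ) (logDeriv riemannZeta₁ ((1 / 2 + δ : ℝ) + t * Complex.I)) *
        gammaKernel z ((1 / 2 + δ : ℝ) + t * Complex.I)) ∧
    ∫ t : ℝ, (starRingEnd ℂ) (logDeriv riemannZeta₁ ((1 / 2 + δ : ℝ) + t * Complex.I)) *
        gammaKernel z ((1 / 2 + δ : ℝ) + t * Complex.I) =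
      ∫ t : ℝ, logDeriv riemannZeta₁ ((1 + δ : ℝ) - t * Complex.I) *
        gammaKernel z (δ + t * Complex.I) := by
  obtain ⟨C, hC, hF⟩ := exists_logDeriv_riemannZeta₁_bounds hRH
  obtain ⟨K, hK, h⟩ := exists_gammaKernel_bound_of_pos hz hδ
  have ha := half_pos (argGap_pos hz)
  have key := integral_vertical_shift
    (f := fun s => logDeriv riemannZeta₁ ((1 + 2 * δ : ℝ) - s) * gammaKernel z s)
    (a := δ) (b := 1 / 2 + δ)
    (g := fun t => C / δ * K * Real.exp (-(argGap z / 2) * |t|)) (by linarith) ?_ ?_ ?_ ?_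
  · obtain ⟨-, hi, he⟩ := key
    have e1 : ∀ t : ℝ, logDeriv riemannZeta₁
        ((1 + 2 * δ : ℝ) - ((1 / 2 + δ : ℝ) + t * Complex.I)) =
        (starRingEnd ℂ) (logDeriv riemannZeta₁ ((1 / 2 + δ : ℝ) + t * Complex.I)) := by
      intro t
      rw [← logDeriv_riemannZeta₁_conj]
      congr 1
      simp only [map_add, map_mul, Complex.conj_ofReal, Complex.conj_I]
      push_cast
      ring
    have e2 : ∀ t : ℝ, ((1 + 2 * δ : ℝ) : ℂ) - (δ + t * Complex.I) =
        (1 + δ : ℝ) - t * Complex.I := by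
      intro t
      push_cast
      ring
    simp only [e1, e2] at hi he
    exact ⟨hi, he.symm⟩
  · intro s h1 h2
    refine DifferentiableAt.mul ?_ (differentiableAt_gammaKernel (by linarith))
    refine DifferentiableAt.comp (g := logDeriv riemannZeta₁)
      (f := fun s : ℂ => ((1 + 2 * δ : ℝ) : ℂ) - s) s
      (differentiableAt_logDeriv_riemannZeta₁ hRH ?_) (by fun_prop)
    simp only [Complex.sub_re, Complex.ofReal_re]
    linarith
  · exact (integrable_exp_neg_mul_abs ha).const_mul _
  · simpa using (tendsto_exp_neg_mul_abs ha).const_mul (C / δ * K)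
  · intro s h1 h2
    have h3 := (hF ((1 + 2 * δ : ℝ) - s) (by simp; linarith) (by simp; linarith)).2
    simp only [Complex.sub_re, Complex.ofReal_re, Complex.sub_im, Complex.ofReal_im, zero_sub,
      abs_neg] at h3
    have h4 := h s h1 (by linarith)
    change _ ≤ C * logWeight s.im / _ at h3
    have h5 : C * logWeight s.im / (1 + 2 * δ - s.re - 1 / 2) ≤ C * logWeight s.im / δ := by
      have := half_le_logWeight s.im
      gcongr
      linarith
    rw [norm_mul]
    calc _ ≤ C * logWeight s.im / δ * ‖gammaKernel z s‖ := by
          gcongr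
          exact h3.trans h5
      _ = C / δ * (logWeight s.im * ‖gammaKernel z s‖) := by ring
      _ ≤ C / δ * (K * Real.exp (-(argGap z / 2) * |s.im|)) := by gcongr
      _ = _ := by ring

theorem sqrt_one_add_abs_div_le {L t x : ℝ} (hL : 0 < L) (h1 : 1 / L ≤ x) (h2 : |t| ≤ x)
    (ht : t ≠ 0) :
    (1 + |t|) ^ (1 / 2 : ℝ) / x ≤ 6 * L * Real.exp (-1 * |t|) + 2 * |t| ^ (-(1 / 2) : ℝ) := by
  have h0 : 0 < |t| := abs_pos.mpr ht
  have hx : 0 < x := h0.trans_le h2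
  rw [← Real.sqrt_eq_rpow, Real.rpow_neg h0.le, ← Real.sqrt_eq_rpow]
  have hp : 0 < √|t| := Real.sqrt_pos.mpr h0
  rcases le_or_gt |t| 1 with h | h
  · have h3 : √(1 + |t|) ≤ 2 := by
      rw [Real.sqrt_le_left (by norm_num)]
      linarith
    have h4 : 1 / x ≤ L := by
      rw [div_le_iff₀ hx]
      rw [div_le_iff₀ hL] at h1
      linarith
    have h5 : Real.exp (-1) ≤ Real.exp (-1 * |t|) := by
      apply Real.exp_le_exp.mpr
      linarith
    have h6 : 1 / 3 ≤ Real.exp (-1) := by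
      rw [Real.exp_neg, one_div]
      exact inv_anti₀ (Real.exp_pos 1) (by linarith [Real.exp_one_lt_d9])
    have h7 : 0 ≤ 2 * (√|t|)⁻¹ := by positivity
    calc √(1 + |t|) / x = √(1 + |t|) * (1 / x) := by ring
      _ ≤ 2 * L := by gcongr
      _ ≤ 6 * L * Real.exp (-1 * |t|) := by nlinarith
      _ ≤ _ := by linarith
  · have h3 : √(1 + |t|) ≤ 2 * √|t| := by
      rw [Real.sqrt_le_left (by positivity), mul_pow, Real.sq_sqrt h0.le]
      linarith
    have h4 : 0 ≤ 6 * L * Real.exp (-1 * |t|) := by positivity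
    calc √(1 + |t|) / x ≤ 2 * √|t| / |t| := by gcongr
      _ = 2 * (√|t|)⁻¹ := by
        have := Real.sq_sqrt h0.le
        field_simp
        linarith
      _ ≤ _ := by linarith

theorem exists_norm_integral_conj_logDeriv_le (hRH : RiemannHypothesis) : ∃ C : ℝ, 0 < C ∧
    ∀ L : ℝ, 2 ≤ L → ∀ z : ℂ, 0 < z.re → Real.exp (-L) ≤ argGap z / 4 → Real.exp (-L) ≤ ‖z‖ →
      ‖∫ t : ℝ, (starRingEnd ℂ) (logDeriv riemannZeta₁ ((1 / 2 + 1 / L : ℝ) + t * Complex.I)) *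
        gammaKernel z ((1 / 2 + 1 / L : ℝ) + t * Complex.I)‖ ≤ C * L * (L + 1 / √(argGap z)) := by
  obtain ⟨C₁, hC₁, hF⟩ := exists_logDeriv_riemannZeta₁_bounds hRH
  obtain ⟨C₂, hC₂, hG⟩ := exists_norm_Gamma_mul_cexp_le
  refine ⟨2 * C₁ * C₂ * Real.exp 1 * Real.exp 1 * 16, by positivity,
    fun L hL z hz hφ hz1 => ?_⟩
  have hL0 : 0 < L := by linarith
  have hδ : 0 < 1 / L := by positivity
  have hδ' : 1 / L ≤ 1 / 2 := by gcongr
  have hφ0 := argGap_pos hz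
  have hφ1 := argGap_le z
  have hpi := Real.pi_lt_four
  rw [(integral_conj_logDeriv_eq hRH hz hδ hδ').2]
  set A := 2 * C₁ * C₂ * Real.exp 1 * Real.exp 1 * L with hA
  have ha : 0 < argGap z / 2 := half_pos hφ0
  have hb : ∀ᵐ t : ℝ, ‖logDeriv riemannZeta₁ ((1 + 1 / L : ℝ) - t * Complex.I) *
      gammaKernel z (((1 / L : ℝ) : ℂ) + t * Complex.I)‖ ≤
      A * (6 * L * Real.exp (-1 * |t|) +
        2 * (|t| ^ (-(1 / 2) : ℝ) * Real.exp (-(argGap z / 2) * |t|))) := by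
    filter_upwards [MeasureTheory.compl_mem_ae_iff.mpr
      (MeasureTheory.measure_singleton (0 : ℝ))] with t ht
    have ht0 : t ≠ 0 := ht
    set s : ℂ := ((1 / L : ℝ) : ℂ) + t * Complex.I with hs
    have hsre : s.re = 1 / L := by simp [hs]
    have hsim : s.im = t := by simp [hs]
    have hs0 : s ≠ 0 := by
      intro h
      rw [h] at hsre
      simp at hsre
      linarith
    have n1 : 1 / L ≤ ‖s‖ := by
      rw [← hsre]
      exact (le_abs_self _).trans (Complex.abs_re_le_norm s)
    have n2 : |t| ≤ ‖s‖ := by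
      have := Complex.abs_im_le_norm s
      rwa [hsim] at this
    have b1 : ‖logDeriv riemannZeta₁ ((1 + 1 / L : ℝ) - t * Complex.I)‖ ≤
        2 * C₁ * logWeight t := by
      have e1 : (((1 + 1 / L : ℝ) : ℂ) - t * Complex.I).re = 1 + 1 / L := by simp
      have h3 := (hF ((1 + 1 / L : ℝ) - t * Complex.I) (by linarith) (by linarith)).2
      have e2 : |(((1 + 1 / L : ℝ) : ℂ) - t * Complex.I).im| = |t| := by simp
      rw [e1, e2] at h3
      change _ ≤ C₁ * logWeight t / _ at h3
      refine h3.trans ?_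
      have := half_le_logWeight t
      rw [div_le_iff₀ (by linarith)]
      have : 0 < C₁ * logWeight t := by positivity
      nlinarith
    have b2 : ‖gammaKernel z s‖ ≤ ‖z‖ / ‖s‖ * (C₂ * (1 + |t|) ^ (1 / L + 1 / 2) *
        ‖z‖ ^ (-(1 / L + 1)) * Real.exp (-argGap z * |t|)) := by
      rw [norm_gammaKernel_eq hz hs0]
      have e1 : (s + 1).re = 1 / L + 1 := by rw [Complex.add_re, hsre, Complex.one_re]
      have h3 := hG z hz (s + 1) (by linarith) (by linarith)
      simp only [Complex.add_im, Complex.one_im, add_zero, Complex.add_re, Complex.one_re, hsre,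
        hsim] at h3
      rw [show 1 / L + 1 - 1 / 2 = 1 / L + 1 / 2 by ring] at h3
      gcongr
      exact h3
    have hzp : 0 < ‖z‖ := (Real.exp_pos _).trans_le hz1
    have ht1 : 0 < 1 + |t| := by positivity
    have b3 : ‖z‖ * ‖z‖ ^ (-(1 / L + 1)) ≤ Real.exp 1 := by
      have : ‖z‖ * ‖z‖ ^ (-(1 / L + 1)) = ‖z‖ ^ (-(1 / L)) := by
        conv_lhs => rw [← Real.rpow_one_add' hzp.le (by linarith)]
        congr 1
        ring
      rw [this]
      exact rpow_neg_one_div_le hL0 hz1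
    have b4 := one_add_abs_rpow_le (by linarith) hφ t
    have b5 := logWeight_le_mul_exp (by linarith) hφ (by linarith) t
    have b6 := sqrt_one_add_abs_div_le hL0 n1 n2 ht0
    have b7 : Real.exp (argGap z / 4 * |t|) * Real.exp (argGap z / 4 * |t|) *
        Real.exp (-argGap z * |t|) = Real.exp (-(argGap z / 2) * |t|) := by
      rw [← Real.exp_add, ← Real.exp_add]
      congr 1
      ring
    have b8 : Real.exp (-(argGap z / 2) * |t|) ≤ 1 := by
      apply Real.exp_le_one_iff.mpr
      have := abs_nonneg t
      nlinarith
    rw [norm_mul]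
    calc _ ≤ 2 * C₁ * logWeight t * (‖z‖ / ‖s‖ * (C₂ * (1 + |t|) ^ (1 / L + 1 / 2) *
          ‖z‖ ^ (-(1 / L + 1)) * Real.exp (-argGap z * |t|))) := by
          have := half_le_logWeight t
          gcongr
      _ = 2 * C₁ * C₂ * logWeight t * (‖z‖ * ‖z‖ ^ (-(1 / L + 1))) * (1 + |t|) ^ (1 / L) *
          ((1 + |t|) ^ (1 / 2 : ℝ) / ‖s‖) * Real.exp (-argGap z * |t|) := by
          rw [Real.rpow_add ht1]
          ring
      _ ≤ 2 * C₁ * C₂ * (L * Real.exp (argGap z / 4 * |t|)) * Real.exp 1 *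
          (Real.exp 1 * Real.exp (argGap z / 4 * |t|)) *
          ((1 + |t|) ^ (1 / 2 : ℝ) / ‖s‖) * Real.exp (-argGap z * |t|) := by gcongr
      _ = A * (((1 + |t|) ^ (1 / 2 : ℝ) / ‖s‖) * Real.exp (-(argGap z / 2) * |t|)) := by
          rw [← b7, hA]
          ring
      _ ≤ A * ((6 * L * Real.exp (-1 * |t|) + 2 * |t| ^ (-(1 / 2) : ℝ)) *
          Real.exp (-(argGap z / 2) * |t|)) := by gcongr
      _ ≤ _ := by
          have : 0 ≤ 6 * L * Real.exp (-1 * |t|) := by positivity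
          gcongr
          nlinarith
  have hi1 := (integrable_exp_neg_mul_abs one_pos).const_mul (6 * L)
  have hi2 := (integrable_abs_rpow_mul_exp_neg ha).const_mul 2
  refine (MeasureTheory.norm_integral_le_of_norm_le ((hi1.add hi2).const_mul A) hb).trans ?_
  simp only [Pi.add_apply]
  rw [MeasureTheory.integral_const_mul, MeasureTheory.integral_add hi1 hi2,
    MeasureTheory.integral_const_mul, MeasureTheory.integral_const_mul,
    integral_exp_neg_mul_abs one_pos, integral_abs_rpow_mul_exp_neg ha]
  have h3 : √(Real.pi / (argGap z / 2)) ≤ 3 * (1 / √(argGap z)) := by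
    rw [Real.sqrt_le_left (by positivity), mul_pow, div_pow, Real.sq_sqrt hφ0.le,
      div_le_iff₀ ha]
    field_simp
    linarith
  have hA0 : 0 < A := by positivity
  calc _ ≤ A * (6 * L * (2 / 1) + 2 * (2 * (3 * (1 / √(argGap z))))) := by gcongr
    _ ≤ A * (16 * (L + 1 / √(argGap z))) := by
      have : 0 ≤ 1 / √(argGap z) := by positivity
      gcongr
      linarith
    _ = _ := by rw [hA]; ring

theorem sq_norm_add_le_two_mul {E : Type*} [SeminormedAddCommGroup E] (x y : E) :
    ‖x + y‖ ^ 2 ≤ 2 * ‖x‖ ^ 2 + 2 * ‖y‖ ^ 2 := by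
  have h := norm_add_le x y
  have := norm_nonneg (x + y)
  nlinarith [sq_nonneg (‖x‖ - ‖y‖)]

theorem sq_norm_integral_le_lintegral {f : ℝ → ℂ} {a b x y : ℝ} (hax : a ≤ x) (hxy : x ≤ y)
    (hyb : y ≤ b) (hf : MeasureTheory.AEStronglyMeasurable f) :
    ENNReal.ofReal (‖∫ v in x..y, f v‖ ^ 2) ≤
      ENNReal.ofReal (b - a) * ∫⁻ v in Set.Icc a b, ENNReal.ofReal (‖f v‖ ^ 2) := by
  rw [intervalIntegral.integral_of_le hxy, ENNReal.ofReal_pow (norm_nonneg _), ofReal_norm]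
  have hab : Set.Ioc x y ⊆ Set.Icc a b := fun v hv => ⟨by linarith [hv.1], by linarith [hv.2]⟩
  have hfm : AEMeasurable (fun v => ‖f v‖ₑ)
      (MeasureTheory.volume.restrict (Set.Icc a b)) := hf.enorm.restrict
  have h1 : ‖∫ v in Set.Ioc x y, f v‖ₑ ≤ ∫⁻ v in Set.Icc a b, ‖f v‖ₑ :=
    (MeasureTheory.enorm_integral_le_lintegral_enorm _).trans
      (MeasureTheory.lintegral_mono_set hab)
  have h2 := ENNReal.lintegral_mul_le_Lp_mul_Lq (MeasureTheory.volume.restrict (Set.Icc a b))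
    Real.HolderConjugate.two_two hfm (aemeasurable_const (b := (1 : ENNReal)))
  simp only [Pi.mul_apply, mul_one, ENNReal.rpow_two, one_pow, MeasureTheory.lintegral_const,
    MeasureTheory.Measure.restrict_apply_univ, Real.volume_Icc, one_mul] at h2
  have h3 : ∀ w : ENNReal, (w ^ (1 / 2 : ℝ)) ^ 2 = w := by
    intro w
    rw [← ENNReal.rpow_natCast, ← ENNReal.rpow_mul]
    norm_num
  calc ‖∫ v in Set.Ioc x y, f v‖ₑ ^ 2
      ≤ ((∫⁻ v in Set.Icc a b, ‖f v‖ₑ ^ 2) ^ (1 / 2 : ℝ) *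
          ENNReal.ofReal (b - a) ^ (1 / 2 : ℝ)) ^ 2 := by
        gcongr
        exact h1.trans h2
    _ = ENNReal.ofReal (b - a) * ∫⁻ v in Set.Icc a b, ‖f v‖ₑ ^ 2 := by
        rw [mul_pow, h3, h3, mul_comm]
    _ = _ := by
        simp only [ENNReal.ofReal_pow (norm_nonneg _), ofReal_norm]

theorem integral_mul_exp_sub_eq {H : ℝ → ℂ} (hH : Continuous H) {a b : ℝ} {G G' : ℝ → ℝ}
    (hG : MeasureTheory.Integrable G) (hG' : MeasureTheory.Integrable G')
    (h1 : ∀ v ∈ Set.Icc a b, ∀ t : ℝ, ‖H t * Real.exp (v * t)‖ ≤ G t)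
    (h2 : ∀ v ∈ Set.Icc a b, ∀ t : ℝ, ‖t * H t * Real.exp (v * t)‖ ≤ G' t)
    {x y : ℝ} (hx : x ∈ Set.Icc a b) (hy : y ∈ Set.Icc a b) (hxy : x ≤ y) :
    (∫ t, H t * Real.exp (y * t)) - ∫ t, H t * Real.exp (x * t) =
      ∫ v in x..y, ∫ t, t * H t * Real.exp (v * t) := by
  have hi : ∀ v ∈ Set.Icc a b, MeasureTheory.Integrable fun t => H t * Real.exp (v * t) :=
    fun v hv => hG.mono' (Continuous.aestronglyMeasurable (by fun_prop))
      (Filter.Eventually.of_forall (h1 v hv))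
  rw [← MeasureTheory.integral_sub (hi y hy) (hi x hx),
    MeasureTheory.intervalIntegral_integral_swap]
  · congr 1
    ext t
    have hd : ∀ v ∈ Set.uIcc x y, HasDerivAt (fun v : ℝ => H t * Real.exp (v * t))
        (t * H t * Real.exp (v * t)) v := by
      intro v _
      have h3 : HasDerivAt (fun v : ℝ => Real.exp (v * t)) (Real.exp (v * t) * (1 * t)) v :=
        ((hasDerivAt_id v).mul_const t).exp
      have h4 := h3.ofReal_comp.const_mul (H t)
      rw [one_mul, Complex.ofReal_mul, mul_comm, mul_assoc, mul_comm] at h4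
      exact h4
    rw [intervalIntegral.integral_eq_sub_of_hasDerivAt hd]
    exact Continuous.intervalIntegrable (by fun_prop) _ _
  · rw [Set.uIoc_of_le hxy]
    refine MeasureTheory.Integrable.mono' (g := fun p : ℝ × ℝ => G' p.2) ?_ ?_ ?_
    · exact hG'.comp_snd _
    · exact Continuous.aestronglyMeasurable (by unfold Function.uncurry; fun_prop)
    · have : ∀ᵐ v ∂(MeasureTheory.volume.restrict (Set.Ioc x y)), v ∈ Set.Ioc x y :=
        MeasureTheory.ae_restrict_mem measurableSet_Ioc
      have h3 := MeasureTheory.Measure.quasiMeasurePreserving_fst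
        (μ := MeasureTheory.volume.restrict (Set.Ioc x y))
        (ν := (MeasureTheory.volume : MeasureTheory.Measure ℝ)) |>.ae this
      filter_upwards [h3] with p hp
      exact h2 p.1 ⟨by linarith [hp.1, hx.1], by linarith [hp.2, hy.2]⟩ p.2

theorem lintegral_sq_fourier_exp_le {g : ℝ → ℝ} (hgc : Continuous g) (hg : ∀ t, 0 ≤ g t) {C : ℝ}
    (hC : 0 ≤ C) (havg : ∀ s : ℝ, ∫⁻ t : ℝ, ENNReal.ofReal (g t / (1 + (t - s) ^ 2)) ≤
      ENNReal.ofReal (C * logWeight s)) {L ψ : ℝ} (hL : 1 ≤ L) (hψ : Real.exp (-L) ≤ ψ / 2)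
    (hψ' : ψ ≤ 1 / 2) {H : ℝ → ℂ} (hH : Continuous H) {a b B B' : ℝ} (hB : 0 ≤ B)
    (hB' : 0 ≤ B')
    (h1 : ∀ v ∈ Set.Icc a b, ∀ t : ℝ,
      ‖H t * Real.exp (v * t)‖ ≤ B * (g t * Real.exp (-(2 * ψ) * |t|)))
    (h2 : ∀ v ∈ Set.Icc a b, ∀ t : ℝ,
      ‖t * H t * Real.exp (v * t)‖ ≤ B' * (g t * Real.exp (-(2 * ψ) * |t|)))
    {S : Set ℝ} (hS : MeasurableSet S) {τ₀ : ℝ} (hSτ : S ⊆ Set.Icc (τ₀ - 1) (τ₀ + 1)) {φ : ℝ → ℝ}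
    (hφ : ∀ τ ∈ S, φ τ ∈ Set.Icc a b) :
    ∫⁻ τ in S, ENNReal.ofReal
        (‖∫ t : ℝ, H t * Real.exp (φ τ * t) * Complex.exp (-Complex.I * t * τ)‖ ^ 2) ≤
      ENNReal.ofReal (192 * (B ^ 2 + (b - a) ^ 2 * B' ^ 2) * C ^ 2 * L ^ 2 / ψ) := by
  rcases S.eq_empty_or_nonempty with rfl | ⟨τ', hτ'⟩
  · simp
  have hab : a ≤ b := (hφ τ' hτ').1.trans (hφ τ' hτ').2
  have hb : b ∈ Set.Icc a b := ⟨hab, le_rfl⟩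
  have hψ0 : 0 < ψ := by linarith [Real.exp_pos (-L)]
  set P : ℝ → ℝ → ℂ := fun τ v => ∫ t : ℝ, H t * Real.exp (v * t) *
    Complex.exp (-Complex.I * t * τ) with hP
  set Q : ℝ → ℝ → ℂ := fun τ v => ∫ t : ℝ, t * H t * Real.exp (v * t) *
    Complex.exp (-Complex.I * t * τ) with hQ
  have hE : ∀ t τ : ℝ, ‖Complex.exp (-Complex.I * t * τ)‖ = 1 := by
    intro t τ
    rw [show -Complex.I * t * τ = ((-(t * τ) : ℝ) : ℂ) * Complex.I by push_cast; ring]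
    exact Complex.norm_exp_ofReal_mul_I _
  have hGi : ∀ B₀ : ℝ, MeasureTheory.Integrable fun t =>
      B₀ * (g t * Real.exp (-(2 * ψ) * |t|)) := by
    intro B₀
    have h3 := integrable_of_norm_le_mul_exp_neg hgc hg hC havg (ψ := 2 * ψ) (by linarith)
      (by linarith) (h := fun t => ((g t * Real.exp (-(2 * ψ) * |t|) : ℝ) : ℂ))
      (Continuous.aestronglyMeasurable (by fun_prop)) (B := 1) (fun t => by
        rw [Complex.norm_real, one_mul,
          Real.norm_of_nonneg (mul_nonneg (hg t) (Real.exp_pos _).le)])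
    refine MeasureTheory.Integrable.const_mul ?_ B₀
    exact h3.re.congr (Filter.Eventually.of_forall fun t => Complex.ofReal_re _)
  have hQm : MeasureTheory.StronglyMeasurable fun p : ℝ × ℝ => Q p.1 p.2 := by
    refine MeasureTheory.StronglyMeasurable.integral_prod_right
      (f := fun (p : ℝ × ℝ) (t : ℝ) => t * H t * Real.exp (p.2 * t) *
        Complex.exp (-Complex.I * t * p.1)) ?_
    exact Continuous.stronglyMeasurable (by unfold Function.uncurry; fun_prop)
  have hPm : MeasureTheory.StronglyMeasurable fun τ : ℝ => P τ b := by
    refine MeasureTheory.StronglyMeasurable.integral_prod_right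
      (f := fun (τ : ℝ) (t : ℝ) => H t * Real.exp (b * t) *
        Complex.exp (-Complex.I * t * τ)) ?_
    exact Continuous.stronglyMeasurable (by unfold Function.uncurry; fun_prop)
  have hpt : ∀ τ ∈ S, ENNReal.ofReal (‖P τ (φ τ)‖ ^ 2) ≤
      ENNReal.ofReal 2 * ENNReal.ofReal (‖P τ b‖ ^ 2) + ENNReal.ofReal (2 * (b - a)) *
        ∫⁻ v in Set.Icc a b, ENNReal.ofReal (‖Q τ v‖ ^ 2) := by
    intro τ hτ
    have hx := hφ τ hτ
    have h3 := integral_mul_exp_sub_eq (H := fun t => H t * Complex.exp (-Complex.I * t * τ))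
      (by fun_prop) (hGi B) (hGi B') (a := a) (b := b)
      (fun v hv t => by rw [mul_right_comm, norm_mul, hE, mul_one]; exact h1 v hv t)
      (fun v hv t => by
        rw [← mul_assoc, mul_right_comm, norm_mul, hE, mul_one]
        exact h2 v hv t) hx hb hx.2
    have e1 : ∀ v, ∫ t : ℝ, H t * Complex.exp (-Complex.I * t * τ) * Real.exp (v * t) = P τ v := by
      intro v
      simp only [hP]
      congr 1
      ext t
      ring
    have e2 : ∀ v, ∫ t : ℝ, t * (H t * Complex.exp (-Complex.I * t * τ)) * Real.exp (v * t) =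
        Q τ v := by
      intro v
      simp only [hQ]
      congr 1
      ext t
      ring
    simp only [e1, e2] at h3
    have h4 : P τ (φ τ) = P τ b + -∫ v in φ τ..b, Q τ v := by rw [← h3]; ring
    have h5 := sq_norm_add_le_two_mul (P τ b) (-∫ v in φ τ..b, Q τ v)
    rw [← h4, norm_neg] at h5
    have h6 := sq_norm_integral_le_lintegral (f := Q τ) hx.1 hx.2 le_rfl
      (hQm.comp_measurable measurable_prodMk_left).aestronglyMeasurable
    refine (ENNReal.ofReal_le_ofReal h5).trans ?_
    rw [ENNReal.ofReal_add (by positivity) (by positivity), ENNReal.ofReal_mul zero_le_two,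
      ENNReal.ofReal_mul zero_le_two, ENNReal.ofReal_mul zero_le_two, mul_assoc]
    gcongr
  have hPb := lintegral_sq_fourier_le hgc hg hC havg hL hψ hψ'
    (h := fun t => H t * Real.exp (b * t)) (Continuous.aestronglyMeasurable (by fun_prop)) hB
    (h1 b hb) τ₀
  have hQb : ∀ v ∈ Set.Icc a b, ∫⁻ τ in Set.Icc (τ₀ - 1) (τ₀ + 1),
      ENNReal.ofReal (‖Q τ v‖ ^ 2) ≤ ENNReal.ofReal (96 * B' ^ 2 * C ^ 2 * L ^ 2 / ψ) :=
    fun v hv => lintegral_sq_fourier_le hgc hg hC havg hL hψ hψ'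
      (h := fun t => t * H t * Real.exp (v * t)) (Continuous.aestronglyMeasurable (by fun_prop))
      hB' (h2 v hv) τ₀
  calc ∫⁻ τ in S, ENNReal.ofReal (‖P τ (φ τ)‖ ^ 2)
      ≤ ∫⁻ τ in S, (ENNReal.ofReal 2 * ENNReal.ofReal (‖P τ b‖ ^ 2) +
        ENNReal.ofReal (2 * (b - a)) *
          ∫⁻ v in Set.Icc a b, ENNReal.ofReal (‖Q τ v‖ ^ 2)) :=
        MeasureTheory.setLIntegral_mono' hS hpt
    _ ≤ ∫⁻ τ in Set.Icc (τ₀ - 1) (τ₀ + 1), (ENNReal.ofReal 2 * ENNReal.ofReal (‖P τ b‖ ^ 2) +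
        ENNReal.ofReal (2 * (b - a)) *
          ∫⁻ v in Set.Icc a b, ENNReal.ofReal (‖Q τ v‖ ^ 2)) :=
        MeasureTheory.lintegral_mono_set hSτ
    _ = ENNReal.ofReal 2 * (∫⁻ τ in Set.Icc (τ₀ - 1) (τ₀ + 1), ENNReal.ofReal (‖P τ b‖ ^ 2)) +
        ENNReal.ofReal (2 * (b - a)) * ∫⁻ τ in Set.Icc (τ₀ - 1) (τ₀ + 1),
          ∫⁻ v in Set.Icc a b, ENNReal.ofReal (‖Q τ v‖ ^ 2) := by
        rw [MeasureTheory.lintegral_add_left, MeasureTheory.lintegral_const_mul',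
          MeasureTheory.lintegral_const_mul']
        · exact ENNReal.ofReal_ne_top
        · exact ENNReal.ofReal_ne_top
        · exact (hPm.norm.measurable.pow_const 2).ennreal_ofReal.const_mul _
    _ = ENNReal.ofReal 2 * (∫⁻ τ in Set.Icc (τ₀ - 1) (τ₀ + 1), ENNReal.ofReal (‖P τ b‖ ^ 2)) +
        ENNReal.ofReal (2 * (b - a)) * ∫⁻ v in Set.Icc a b,
          ∫⁻ τ in Set.Icc (τ₀ - 1) (τ₀ + 1), ENNReal.ofReal (‖Q τ v‖ ^ 2) := by
        rw [MeasureTheory.lintegral_lintegral_swap]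
        exact (hQm.norm.measurable.pow_const 2).ennreal_ofReal.aemeasurable
    _ ≤ ENNReal.ofReal 2 * ENNReal.ofReal (96 * B ^ 2 * C ^ 2 * L ^ 2 / ψ) +
        ENNReal.ofReal (2 * (b - a)) * ∫⁻ v in Set.Icc a b,
          ENNReal.ofReal (96 * B' ^ 2 * C ^ 2 * L ^ 2 / ψ) := by
        gcongr ?_ + ?_
        · gcongr
        · refine mul_le_mul_right ?_ _
          exact MeasureTheory.setLIntegral_mono' measurableSet_Icc hQb
    _ = _ := by
        have hba : 0 ≤ b - a := by linarith
        rw [MeasureTheory.lintegral_const, MeasureTheory.Measure.restrict_apply_univ,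
          Real.volume_Icc, ← ENNReal.ofReal_mul (by positivity),
          ← ENNReal.ofReal_mul (by positivity), ← ENNReal.ofReal_mul (by positivity),
          ← ENNReal.ofReal_add (by positivity) (by positivity)]
        congr 1
        ring

theorem re_div_norm_le_argGap {z : ℂ} (hz : 0 < z.re) : z.re / ‖z‖ ≤ argGap z := by
  have hz0 : z ≠ 0 := by rintro rfl; simp at hz
  rw [← Complex.cos_arg hz0, ← Real.cos_abs, ← Real.sin_pi_div_two_sub]
  exact Real.sin_le (argGap_pos hz).le

theorem norm_le_add_of_sub_mul_I {η u : ℝ} (hη : 0 ≤ η) (hu : 0 ≤ u) :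
    ‖(η - u * Complex.I : ℂ)‖ ≤ η + u := by
  refine (norm_sub_le _ _).trans_eq ?_
  rw [norm_mul, Complex.norm_I, mul_one, Complex.norm_of_nonneg hη, Complex.norm_of_nonneg hu]

theorem le_norm_sub_mul_I (η u : ℝ) : u ≤ ‖(η - u * Complex.I : ℂ)‖ := by
  have h := Complex.abs_im_le_norm (η - u * Complex.I : ℂ)
  simp only [Complex.sub_im, Complex.ofReal_im, Complex.mul_im, Complex.ofReal_re, Complex.I_im,
    mul_one, Complex.I_re, mul_zero, add_zero, zero_sub, abs_neg] at h
  exact (le_abs_self u).trans h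

theorem argGap_sub_mul_I_mem {η ξ u : ℝ} (hη : 0 < η) (hξ : η ≤ ξ) (hu : u ∈ Set.Icc ξ (2 * ξ)) :
    argGap (η - u * Complex.I) ∈ Set.Icc (η / ξ / 4) (2 * (η / ξ)) := by
  have hξ0 : 0 < ξ := hη.trans_le hξ
  have hu0 : 0 < u := hξ0.trans_le hu.1
  have hre : (η - u * Complex.I : ℂ).re = η := by simp
  have hz : 0 < (η - u * Complex.I : ℂ).re := by rw [hre]; exact hη
  constructor
  · refine le_trans ?_ (re_div_norm_le_argGap hz)
    have h1 := norm_le_add_of_sub_mul_I hη.le hu0.le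
    have h2 := le_norm_sub_mul_I η u
    rw [hre, div_div]
    gcongr
    · linarith
    · linarith [hu.2]
  · have h := abs_im_mul_le hz
    rw [hre] at h
    have him : |(η - u * Complex.I : ℂ).im| = u := by simp [abs_of_pos hu0]
    rw [him] at h
    change u * argGap _ ≤ _ at h
    have h3 : 0 < argGap (η - u * Complex.I) := argGap_pos hz
    rw [mul_div_assoc', le_div_iff₀ hξ0]
    nlinarith [hu.1, Real.pi_lt_four]

theorem integral_gammaKernel_sub_mul_I (F : ℝ → ℂ) {η u c : ℝ} (hu : 0 < u) :
    ∫ t : ℝ, F t * gammaKernel (η - u * Complex.I) (c + t * Complex.I) =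
      Complex.exp (-(c * Complex.log (η - u * Complex.I))) *
        ∫ t : ℝ, F t * Complex.Gamma (c + t * Complex.I) * Real.exp (-(Real.pi / 2 * t)) *
          Real.exp (argGap (η - u * Complex.I) * t) *
          Complex.exp (-Complex.I * t * Real.log ‖(η - u * Complex.I : ℂ)‖) := by
  rw [← MeasureTheory.integral_const_mul]
  congr 1
  ext t
  have him : (η - u * Complex.I : ℂ).im = -u := by simp
  have harg : (η - u * Complex.I : ℂ).arg < 0 := by
    rw [Complex.arg_neg_iff, him]
    linarith
  have hgap : (argGap (η - u * Complex.I) : ℂ) =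
      (Real.pi / 2 : ℝ) + (Complex.arg (η - u * Complex.I) : ℝ) := by
    rw [argGap, abs_of_neg harg]
    push_cast
    ring
  have e : Complex.exp (-((c + t * Complex.I) * Complex.log (η - u * Complex.I))) =
      Complex.exp (-(c * Complex.log (η - u * Complex.I))) *
        (Real.exp (-(Real.pi / 2 * t)) * Real.exp (argGap (η - u * Complex.I) * t) *
          Complex.exp (-Complex.I * t * Real.log ‖(η - u * Complex.I : ℂ)‖)) := by
    rw [Complex.ofReal_exp, Complex.ofReal_exp, ← Complex.exp_add, ← Complex.exp_add,
      ← Complex.exp_add]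
    congr 1
    push_cast
    rw [hgap]
    have hl : Complex.log (η - u * Complex.I) = Real.log ‖(η - u * Complex.I : ℂ)‖ +
        Complex.arg (η - u * Complex.I) * Complex.I := rfl
    rw [hl]
    push_cast
    linear_combination (-(t : ℂ) * Complex.arg (η - u * Complex.I)) * Complex.I_sq
  rw [gammaKernel, e]
  ring

theorem lintegral_comp_log_norm_le {η ξ : ℝ} (hη : 0 < η) (hξ : η ≤ ξ) (f : ℝ → ENNReal) :
    ∃ S : Set ℝ, MeasurableSet S ∧ S ⊆ Set.Icc (Real.log ξ - 1) (Real.log ξ + 1) ∧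
      (∀ τ ∈ S, ∃ u ∈ Set.Icc ξ (2 * ξ), τ = Real.log ‖(η - u * Complex.I : ℂ)‖) ∧
      ∫⁻ u in Set.Icc ξ (2 * ξ), f (Real.log ‖(η - u * Complex.I : ℂ)‖) ≤
        ENNReal.ofReal (4 * ξ) * ∫⁻ τ in S, f τ := by
  have hξ0 : 0 < ξ := hη.trans_le hξ
  set w : ℝ → ℝ := fun u => Real.log ‖(η - u * Complex.I : ℂ)‖ with hw
  have hw' : ∀ u, w u = Real.log (η ^ 2 + u ^ 2) / 2 := by
    intro u
    rw [hw]
    simp only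
    rw [Complex.norm_def, Real.log_sqrt (Complex.normSq_nonneg _), Complex.normSq_apply]
    simp only [Complex.sub_re, Complex.ofReal_re, Complex.mul_re, Complex.I_re, mul_zero,
      Complex.ofReal_im, Complex.I_im, mul_one, sub_self, sub_zero, Complex.sub_im, Complex.mul_im,
      add_zero, zero_sub]
    ring_nf
  have hd : ∀ u ∈ Set.Icc ξ (2 * ξ), HasDerivAt w (u / (η ^ 2 + u ^ 2)) u := by
    intro u hu
    have h1 : HasDerivAt (fun u : ℝ => η ^ 2 + u ^ 2) (2 * u) u := by
      simpa using (hasDerivAt_pow 2 u).const_add (η ^ 2)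
    have h2 := (h1.log (by positivity)).div_const 2
    rw [show w = fun u => Real.log (η ^ 2 + u ^ 2) / 2 from funext hw']
    exact h2.congr_deriv (by ring)
  have hmono : StrictMonoOn w (Set.Icc ξ (2 * ξ)) := by
    intro u hu v hv huv
    rw [hw', hw']
    have hu0 : 0 < u := hξ0.trans_le hu.1
    gcongr
  have hcont : ContinuousOn w (Set.Icc ξ (2 * ξ)) := fun u hu =>
    (hd u hu).continuousAt.continuousWithinAt
  refine ⟨w '' Set.Icc ξ (2 * ξ), (isCompact_Icc.image_of_continuousOn hcont).measurableSet, ?_,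
    ?_, ?_⟩
  · rintro _ ⟨u, hu, rfl⟩
    have hu0 : 0 < u := hξ0.trans_le hu.1
    have h1 := le_norm_sub_mul_I η u
    have h2 := norm_le_add_of_sub_mul_I hη.le hu0.le
    constructor
    · have : Real.log ξ ≤ w u := Real.log_le_log hξ0 (hu.1.trans h1)
      linarith
    · rw [hw']
      have h3 : Real.log (η ^ 2 + u ^ 2) ≤ Real.log (ξ ^ 2 * Real.exp 2) := by
        apply Real.log_le_log (by positivity)
        have h4 : 5 ≤ Real.exp 2 := by
          have : Real.exp 2 = Real.exp 1 ^ 2 := by rw [← Real.exp_nat_mul]; norm_num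
          rw [this]
          nlinarith [Real.exp_one_gt_d9]
        have : 0 < ξ ^ 2 := by positivity
        nlinarith [hu.1, hu.2]
      rw [Real.log_mul (by positivity) (Real.exp_ne_zero _), Real.log_exp, Real.log_pow] at h3
      push_cast at h3
      linarith
  · rintro _ ⟨u, hu, rfl⟩
    exact ⟨u, hu, rfl⟩
  · rw [MeasureTheory.lintegral_image_eq_lintegral_abs_deriv_mul measurableSet_Icc
      (fun u hu => (hd u hu).hasDerivWithinAt) hmono.injOn,
      ← MeasureTheory.lintegral_const_mul' _ _ ENNReal.ofReal_ne_top]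
    refine MeasureTheory.setLIntegral_mono' measurableSet_Icc fun u hu => ?_
    have hu0 : 0 < u := hξ0.trans_le hu.1
    rw [← mul_assoc, ← ENNReal.ofReal_mul (by positivity)]
    refine le_mul_of_one_le_left zero_le (ENNReal.one_le_ofReal.mpr ?_)
    rw [abs_of_pos (by positivity), mul_div_assoc', one_le_div (by positivity)]
    nlinarith [hu.1, hu.2]

theorem mul_exp_neg_mul_le {a x : ℝ} (ha : 0 < a) : x * Real.exp (-a * x) ≤ 1 / a := by
  have h := Real.add_one_le_exp (a * x)
  rw [neg_mul, Real.exp_neg, ← div_eq_mul_inv, div_le_div_iff₀ (Real.exp_pos _) ha]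
  linarith

theorem exp_mul_le_exp_neg_abs {κ v t : ℝ} (hκ : κ ≤ 1) (hv : κ / 4 ≤ v)
    (hv' : v ≤ 2 * κ) : Real.exp (-(Real.pi / 2) * |t|) * Real.exp (-(Real.pi / 2 * t)) *
      Real.exp (v * t) ≤ Real.exp (-(κ / 4) * |t|) := by
  rw [← Real.exp_add, ← Real.exp_add]
  apply Real.exp_le_exp.mpr
  have := Real.pi_gt_three
  rcases abs_cases t with ⟨h, h'⟩ | ⟨h, h'⟩ <;> rw [h] <;> nlinarith

theorem exists_gamma_line_exp_bound : ∃ C : ℝ, 0 < C ∧ ∀ L κ v t : ℝ, 2 ≤ L → κ ≤ 1 →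
    Real.exp (-L) ≤ κ / 8 → v ∈ Set.Icc (κ / 4) (2 * κ) →
      ‖Complex.Gamma ((1 / 2 + 1 / L : ℝ) + t * Complex.I)‖ * Real.exp (-(Real.pi / 2 * t)) *
        Real.exp (v * t) ≤ C * Real.exp (-(κ / 8) * |t|) := by
  obtain ⟨C, hC, h⟩ := exists_norm_Gamma_le
  refine ⟨C * Real.exp 1, by positivity, fun L κ v t hL hκ hLκ hv => ?_⟩
  have hL0 : 0 < 1 / L := by positivity
  have hL1 : 1 / L ≤ 1 / 2 := by gcongr
  set s : ℂ := (1 / 2 + 1 / L : ℝ) + t * Complex.I with hs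
  have hre : s.re = 1 / 2 + 1 / L := by simp [hs]
  have him : s.im = t := by simp [hs]
  have h1 := h s (by linarith) (by linarith)
  rw [hre, him, show 1 / 2 + 1 / L - 1 / 2 = 1 / L by ring] at h1
  have h2 := one_add_abs_rpow_le (by linarith) hLκ t
  have h3 := exp_mul_le_exp_neg_abs (t := t) hκ hv.1 hv.2
  have h4 : Real.exp (κ / 8 * |t|) * Real.exp (-(κ / 4) * |t|) = Real.exp (-(κ / 8) * |t|) := by
    rw [← Real.exp_add]
    congr 1
    ring
  calc _ ≤ C * (1 + |t|) ^ (1 / L) * Real.exp (-(Real.pi / 2) * |t|) *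
        Real.exp (-(Real.pi / 2 * t)) * Real.exp (v * t) := by gcongr
    _ = C * (1 + |t|) ^ (1 / L) * (Real.exp (-(Real.pi / 2) * |t|) *
        Real.exp (-(Real.pi / 2 * t)) * Real.exp (v * t)) := by ring
    _ ≤ C * (Real.exp 1 * Real.exp (κ / 8 * |t|)) * Real.exp (-(κ / 4) * |t|) := by gcongr
    _ = C * Real.exp 1 * (Real.exp (κ / 8 * |t|) * Real.exp (-(κ / 4) * |t|)) := by ring
    _ = _ := by rw [h4]

theorem continuous_logDeriv_riemannZeta₁_line (hRH : RiemannHypothesis) {c : ℝ} (hc : 1 / 2 < c) :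
    Continuous fun t : ℝ => logDeriv riemannZeta₁ (c + t * Complex.I) := by
  refine continuous_iff_continuousAt.mpr fun t => ?_
  refine ContinuousAt.comp (f := fun t : ℝ => (c + t * Complex.I : ℂ))
    (differentiableAt_logDeriv_riemannZeta₁ hRH (by simpa using hc)).continuousAt (by fun_prop)

theorem exists_lintegral_sq_integral_re_logDeriv_le (hRH : RiemannHypothesis) : ∃ C : ℝ, 0 < C ∧
    ∀ L η ξ : ℝ, 4 ≤ L → 0 < η → η ≤ ξ → Real.exp (-L) ≤ η / ξ / 64 → Real.exp (-L) ≤ ξ →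
      ∫⁻ u in Set.Icc ξ (2 * ξ), ENNReal.ofReal
        (‖∫ t : ℝ, ((logDeriv riemannZeta₁ ((1 / 2 + 1 / L : ℝ) + t * Complex.I)).re : ℂ) *
          gammaKernel (η - u * Complex.I) ((1 / 2 + 1 / L : ℝ) + t * Complex.I)‖ ^ 2) ≤
        ENNReal.ofReal (C * L ^ 2 * ξ / η) := by
  obtain ⟨C, hC, havg⟩ := exists_average_re_logDeriv_bound hRH
  obtain ⟨B, hB, hΓ⟩ := exists_gamma_line_exp_bound
  refine ⟨4 * Real.exp 1 ^ 2 * (192 * (1025 * B ^ 2) * C ^ 2 * 32), by positivity,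
    fun L η ξ hL hη hξ hLκ hLξ => ?_⟩
  have hξ0 : 0 < ξ := hη.trans_le hξ
  have hL0 : 0 < 1 / L := by positivity
  have hL1 : 1 / L ≤ 1 / 4 := by gcongr
  set c : ℝ := 1 / 2 + 1 / L with hc
  set κ := η / ξ with hκ
  have hκ0 : 0 < κ := by positivity
  have hκ1 : κ ≤ 1 := (div_le_one hξ0).mpr hξ
  set F : ℝ → ℂ := fun t => ((logDeriv riemannZeta₁ (c + t * Complex.I)).re : ℂ) with hF
  have hFc : Continuous F := by
    have := continuous_logDeriv_riemannZeta₁_line hRH (c := c) (by linarith)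
    exact Complex.continuous_ofReal.comp (Complex.continuous_re.comp this)
  have hΓc : Continuous fun t : ℝ => Complex.Gamma (c + t * Complex.I) := by
    refine continuous_iff_continuousAt.mpr fun t => ?_
    refine ContinuousAt.comp (f := fun t : ℝ => (c + t * Complex.I : ℂ))
      (Complex.differentiableAt_Gamma _ fun m hm => ?_).continuousAt (by fun_prop)
    have := congrArg Complex.re hm
    simp at this
    linarith [(Nat.cast_nonneg m : (0 : ℝ) ≤ m)]
  set H : ℝ → ℂ := fun t => F t * Complex.Gamma (c + t * Complex.I) *
    Real.exp (-(Real.pi / 2 * t)) with hH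
  have hHc : Continuous H := by fun_prop
  have hHb : ∀ v ∈ Set.Icc (κ / 4) (2 * κ), ∀ t : ℝ, ‖H t * Real.exp (v * t)‖ ≤
      B * (‖F t‖ * Real.exp (-(κ / 8) * |t|)) := by
    intro v hv t
    have h1 := hΓ L κ v t (by linarith) hκ1 (by linarith) hv
    rw [hH, norm_mul, norm_mul, norm_mul, Complex.norm_of_nonneg (Real.exp_pos _).le,
      Complex.norm_of_nonneg (Real.exp_pos _).le]
    have := mul_le_mul_of_nonneg_left h1 (norm_nonneg (F t))
    linarith
  obtain ⟨S, hS, hSτ, hSu, hle⟩ := lintegral_comp_log_norm_le hη hξ fun τ =>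
    ENNReal.ofReal (‖∫ t : ℝ, H t * Real.exp (argGap (η - √(Real.exp (2 * τ) - η ^ 2) *
      Complex.I) * t) * Complex.exp (-Complex.I * t * τ)‖ ^ 2)
  have hu_eq : ∀ u ∈ Set.Icc ξ (2 * ξ),
      √(Real.exp (2 * Real.log ‖(η - u * Complex.I : ℂ)‖) - η ^ 2) = u := by
    intro u hu
    have hu0 : 0 < u := hξ0.trans_le hu.1
    have h1 := hu0.trans_le (le_norm_sub_mul_I η u)
    rw [mul_comm, Real.exp_mul, Real.exp_log h1, Real.rpow_two, Complex.sq_norm,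
      Complex.normSq_apply]
    simp only [Complex.sub_re, Complex.ofReal_re, Complex.mul_re, Complex.I_re, mul_zero,
      Complex.ofReal_im, Complex.I_im, mul_one, sub_self, sub_zero, Complex.sub_im, Complex.mul_im,
      add_zero, zero_sub]
    rw [show η * η + -u * -u - η ^ 2 = u ^ 2 by ring, Real.sqrt_sq hu0.le]
  have hφ : ∀ τ ∈ S, argGap (η - √(Real.exp (2 * τ) - η ^ 2) * Complex.I) ∈
      Set.Icc (κ / 4) (2 * κ) := by
    intro τ hτ
    obtain ⟨u, hu, rfl⟩ := hSu τ hτ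
    rw [hu_eq u hu]
    exact argGap_sub_mul_I_mem hη hξ hu
  have hbound := lintegral_sq_fourier_exp_le (g := fun t => ‖F t‖) hFc.norm
    (fun t => norm_nonneg _) hC.le (fun s => by
      refine le_of_eq_of_le ?_ (havg c (by linarith) (by linarith) s)
      simp only [hF, Complex.norm_real, Real.norm_eq_abs]) (L := L) (ψ := κ / 32) (by linarith)
    (by linarith) (by linarith) hHc hB.le (B' := B * (16 / κ)) (by positivity)
    (fun v hv t => (hHb v hv t).trans (by gcongr; linarith))
    (fun v hv t => by
      have h1 := hHb v hv t
      have h2 := mul_exp_neg_mul_le (a := κ / 16) (x := |t|) (by positivity)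
      have h3 : Real.exp (-(κ / 8) * |t|) =
          Real.exp (-(κ / 16) * |t|) * Real.exp (-(2 * (κ / 32)) * |t|) := by
        rw [← Real.exp_add]
        congr 1
        ring
      rw [mul_assoc, norm_mul, Complex.norm_real, Real.norm_eq_abs]
      calc _ ≤ |t| * (B * (‖F t‖ * Real.exp (-(κ / 8) * |t|))) := by gcongr
        _ = B * (|t| * Real.exp (-(κ / 16) * |t|)) *
            (‖F t‖ * Real.exp (-(2 * (κ / 32)) * |t|)) := by rw [h3]; ring
        _ ≤ B * (1 / (κ / 16)) * (‖F t‖ * Real.exp (-(2 * (κ / 32)) * |t|)) := by gcongr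
        _ = _ := by rw [one_div_div]) hS hSτ hφ
  have hpt : ∀ u ∈ Set.Icc ξ (2 * ξ), ENNReal.ofReal
      (‖∫ t : ℝ, F t * gammaKernel (η - u * Complex.I) (c + t * Complex.I)‖ ^ 2) ≤
      ENNReal.ofReal (Real.exp 1 ^ 2 / ξ) * ENNReal.ofReal (‖∫ t : ℝ, H t * Real.exp (argGap (η -
        √(Real.exp (2 * Real.log ‖(η - u * Complex.I : ℂ)‖) - η ^ 2) * Complex.I) * t) *
        Complex.exp (-Complex.I * t * Real.log ‖(η - u * Complex.I : ℂ)‖)‖ ^ 2) := by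
    intro u hu
    have hu0 : 0 < u := hξ0.trans_le hu.1
    rw [hu_eq u hu, integral_gammaKernel_sub_mul_I F hu0, norm_mul, mul_pow,
      ENNReal.ofReal_mul (by positivity)]
    refine mul_le_mul_left (ENNReal.ofReal_le_ofReal ?_) _
    have h1 : ξ ≤ ‖(η - u * Complex.I : ℂ)‖ := hu.1.trans (le_norm_sub_mul_I η u)
    rw [norm_cexp_neg_mul_log (by simpa using hη), Complex.ofReal_im, zero_mul, Real.exp_zero,
      mul_one, Complex.ofReal_re]
    have h2 : ‖(η - u * Complex.I : ℂ)‖ ^ (-c) ≤ ξ ^ (-c) :=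
      Real.rpow_le_rpow_of_nonpos hξ0 h1 (by linarith)
    have h3 : (ξ ^ (-c)) ^ 2 = ξ⁻¹ * (ξ ^ (-(1 / L))) ^ 2 := by
      rw [← Real.rpow_natCast, ← Real.rpow_natCast, ← Real.rpow_mul hξ0.le,
        ← Real.rpow_mul hξ0.le, ← Real.rpow_neg_one, ← Real.rpow_add hξ0]
      congr 1
      rw [hc]
      push_cast
      ring
    calc _ ≤ (ξ ^ (-c)) ^ 2 := by gcongr
      _ = ξ⁻¹ * (ξ ^ (-(1 / L))) ^ 2 := h3
      _ ≤ ξ⁻¹ * Real.exp 1 ^ 2 := by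
        have := rpow_neg_one_div_le (by linarith : 0 < L) hLξ
        gcongr
      _ = _ := by ring
  refine (MeasureTheory.setLIntegral_mono' measurableSet_Icc hpt).trans ?_
  rw [MeasureTheory.lintegral_const_mul' _ _ ENNReal.ofReal_ne_top]
  refine (mul_le_mul_right (hle.trans (mul_le_mul_right hbound _)) _).trans ?_
  rw [← ENNReal.ofReal_mul (by positivity), ← ENNReal.ofReal_mul (by positivity)]
  apply ENNReal.ofReal_le_ofReal
  rw [hκ]
  have hη' := hη.ne'
  have hξ' := hξ0.ne'
  field_simp
  ring_nf
  nlinarith [Real.exp_pos 1]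

/-- The error in the approximation `∑ Λ(n) e^{-nz} ≈ 1/z`. -/
noncomputable def vonMangoldtError (z : ℂ) : ℂ :=
  ∑' n : ℕ, (ArithmeticFunction.vonMangoldt n : ℂ) * Complex.exp (-(z * n)) - 1 / z

theorem norm_cexp_neg_sub_one_div_le {z : ℂ} (hz : 0 < z.re) :
    ‖(Complex.exp (-z) - 1) / z‖ ≤ 2 := by
  have h0 : 0 < ‖z‖ := norm_pos_iff.mpr (by rintro rfl; simp at hz)
  rw [norm_div, div_le_iff₀ h0]
  rcases le_total ‖z‖ 1 with h | h
  · simpa using Complex.norm_exp_sub_one_le (x := -z) (by simpa using h)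
  · refine (norm_sub_le _ _).trans ?_
    have : ‖Complex.exp (-z)‖ ≤ 1 := by
      rw [Complex.norm_exp, Real.exp_le_one_iff, Complex.neg_re]
      linarith
    rw [norm_one]
    linarith

theorem norm_vonMangoldtError_le (hRH : RiemannHypothesis) {z : ℂ} (hz : 0 < z.re) {c : ℝ}
    (hc : 1 / 2 < c) (hc' : c ≤ 3 / 2) :
    ‖vonMangoldtError z‖ ≤ 2 + ‖∫ t : ℝ, zetaKernel z (c + t * Complex.I)‖ / 6 := by
  rw [vonMangoldtError, tsum_vonMangoldt_mul_cexp hRH hz hc hc']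
  refine (norm_sub_le _ _).trans ?_
  refine add_le_add (norm_cexp_neg_sub_one_div_le hz) ?_
  rw [norm_mul, norm_div, norm_one, norm_mul, Complex.norm_ofNat, Complex.norm_real,
    Real.norm_of_nonneg Real.pi_pos.le, div_mul_eq_mul_div, one_mul]
  have := Real.pi_gt_three
  gcongr
  linarith

theorem integral_zetaKernel_eq (hRH : RiemannHypothesis) {z : ℂ} (hz : 0 < z.re) {L : ℝ}
    (hL : 2 ≤ L) :
    ∫ t : ℝ, zetaKernel z ((1 / 2 + 1 / L : ℝ) + t * Complex.I) =
      2 * (∫ t : ℝ, ((logDeriv riemannZeta₁ ((1 / 2 + 1 / L : ℝ) + t * Complex.I)).re : ℂ) *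
        gammaKernel z ((1 / 2 + 1 / L : ℝ) + t * Complex.I)) -
      ∫ t : ℝ, (starRingEnd ℂ) (logDeriv riemannZeta₁ ((1 / 2 + 1 / L : ℝ) + t * Complex.I)) *
        gammaKernel z ((1 / 2 + 1 / L : ℝ) + t * Complex.I) := by
  have hL0 : 0 < 1 / L := by positivity
  have hL1 : 1 / L ≤ 1 / 2 := by gcongr
  obtain ⟨h1, -⟩ := zetaKernel_shift hRH hz (c := 1 / 2 + 1 / L) (by linarith) (by linarith)
  obtain ⟨h2, -⟩ := integral_conj_logDeriv_eq hRH hz hL0 hL1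
  have h3 : ∀ t : ℝ, ((logDeriv riemannZeta₁ ((1 / 2 + 1 / L : ℝ) + t * Complex.I)).re : ℂ) *
      gammaKernel z ((1 / 2 + 1 / L : ℝ) + t * Complex.I) =
      (1 / 2) * (zetaKernel z ((1 / 2 + 1 / L : ℝ) + t * Complex.I) +
        (starRingEnd ℂ) (logDeriv riemannZeta₁ ((1 / 2 + 1 / L : ℝ) + t * Complex.I)) *
          gammaKernel z ((1 / 2 + 1 / L : ℝ) + t * Complex.I)) := by
    intro t
    rw [zetaKernel, ← add_mul, Complex.add_conj]
    push_cast
    ring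
  simp_rw [h3]
  rw [MeasureTheory.integral_const_mul, MeasureTheory.integral_add h1 h2]
  ring

theorem exists_norm_sq_vonMangoldtError_le (hRH : RiemannHypothesis) : ∃ C : ℝ, 0 < C ∧
    ∀ L : ℝ, 4 ≤ L → ∀ z : ℂ, 0 < z.re → ‖z‖ ≤ 2 * z.re → Real.exp (-L) ≤ ‖z‖ → ‖z‖ ≤ 2 →
      ‖vonMangoldtError z‖ ^ 2 ≤ C * L ^ 2 / ‖z‖ := by
  obtain ⟨C₁, hC₁, hF⟩ := exists_logDeriv_riemannZeta₁_bounds hRH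
  obtain ⟨C₂, hC₂, hG⟩ := exists_norm_Gamma_mul_cexp_le
  set K : ℝ := C₁ * C₂ * 3 * Real.exp 1 * Real.exp 1 with hK
  refine ⟨(2 + 2 * K) ^ 2, by positivity, fun L hL z hz hz1 hz2 hz3 => ?_⟩
  have hL0 : 0 < 1 / L := by positivity
  have hL1 : 1 / L ≤ 1 / 4 := by gcongr
  have h0 : 0 < ‖z‖ := (Real.exp_pos _).trans_le hz2
  have hφ : 1 / 2 ≤ argGap z := by
    refine le_trans ?_ (re_div_norm_le_argGap hz)
    rw [le_div_iff₀ h0]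
    linarith
  have hexp3 : Real.exp (-3) ≤ 1 / 8 := by
    rw [Real.exp_neg, ← one_div]
    have : (8 : ℝ) ≤ Real.exp 3 := by
      have : Real.exp 3 = Real.exp 1 ^ 3 := by rw [← Real.exp_nat_mul]; norm_num
      rw [this]
      have := Real.exp_one_gt_d9
      calc (8 : ℝ) = 2 ^ 3 := by norm_num
        _ ≤ _ := by gcongr; linarith
    gcongr
  set c : ℝ := 1 / 2 + 1 / L with hc
  have hpt : ∀ t : ℝ, ‖zetaKernel z (c + t * Complex.I)‖ ≤
      K * L * ‖z‖ ^ (-(1 / 2) : ℝ) * Real.exp (-(1 / 4) * |t|) := by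
    intro t
    set s : ℂ := c + t * Complex.I with hs
    have hre : s.re = c := by simp [hs]
    have him : s.im = t := by simp [hs]
    have b1 := (hF s (by linarith) (by linarith)).2
    have b2 := hG z hz s (by linarith) (by linarith)
    rw [hre, him, show c - 1 / 2 = 1 / L by rw [hc]; ring] at b1 b2
    have b3 := logWeight_le_mul_exp (L := 3) (by norm_num) hexp3 (by norm_num) t
    have b4 := one_add_abs_rpow_le (L := L) (a := 1 / 8) (by linarith)
      ((Real.exp_le_exp.mpr (by linarith)).trans hexp3) t
    have b5 : ‖z‖ ^ (-c) ≤ ‖z‖ ^ (-(1 / 2) : ℝ) * Real.exp 1 := by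
      rw [hc, neg_add, Real.rpow_add h0]
      have := rpow_neg_one_div_le (by linarith : 0 < L) hz2
      gcongr
    have b6 : Real.exp (1 / 8 * |t|) * Real.exp (1 / 8 * |t|) * Real.exp (-argGap z * |t|) ≤
        Real.exp (-(1 / 4) * |t|) := by
      rw [← Real.exp_add, ← Real.exp_add]
      apply Real.exp_le_exp.mpr
      nlinarith [abs_nonneg t]
    change _ ≤ C₁ * logWeight t / (1 / L) at b1
    rw [zetaKernel, norm_mul]
    have := half_le_logWeight t
    calc _ ≤ C₁ * logWeight t / (1 / L) *
          (C₂ * (1 + |t|) ^ (1 / L) * ‖z‖ ^ (-c) * Real.exp (-argGap z * |t|)) := by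
          gcongr
          exact b2
      _ = C₁ * logWeight t * L *
          (C₂ * (1 + |t|) ^ (1 / L) * ‖z‖ ^ (-c) * Real.exp (-argGap z * |t|)) := by
          rw [div_div_eq_mul_div, div_one]
      _ ≤ C₁ * (3 * Real.exp (1 / 8 * |t|)) * L *
          (C₂ * (Real.exp 1 * Real.exp (1 / 8 * |t|)) * (‖z‖ ^ (-(1 / 2) : ℝ) * Real.exp 1) *
            Real.exp (-argGap z * |t|)) := by gcongr
      _ = K * L * ‖z‖ ^ (-(1 / 2) : ℝ) * (Real.exp (1 / 8 * |t|) * Real.exp (1 / 8 * |t|) *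
          Real.exp (-argGap z * |t|)) := by rw [hK]; ring
      _ ≤ _ := by gcongr
  have hintg := MeasureTheory.norm_integral_le_of_norm_le
    ((integrable_exp_neg_mul_abs (a := 1 / 4) (by norm_num)).const_mul
      (K * L * ‖z‖ ^ (-(1 / 2) : ℝ))) (Filter.Eventually.of_forall hpt)
  rw [MeasureTheory.integral_const_mul, integral_exp_neg_mul_abs (by norm_num)] at hintg
  have hb := norm_vonMangoldtError_le hRH hz (c := c) (by linarith) (by linarith)
  set r := ‖z‖ ^ (-(1 / 2) : ℝ) with hr
  have hr0 : 0 < r := by positivity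
  have hr2 : r ^ 2 = 1 / ‖z‖ := by
    rw [hr, ← Real.rpow_natCast, ← Real.rpow_mul h0.le,
      show (-(1 / 2) : ℝ) * (2 : ℕ) = -1 by norm_num, Real.rpow_neg_one, one_div]
  have hr1 : 1 ≤ L * r := by
    refine le_of_sq_le_sq ?_ (by positivity)
    rw [one_pow, mul_pow, hr2, mul_one_div, le_div_iff₀ h0]
    nlinarith
  calc _ ≤ ((2 + 2 * K) * (L * r)) ^ 2 := by
        gcongr
        have : 0 < K := by positivity
        nlinarith [mul_pos this (mul_pos (by linarith : 0 < L) hr0)]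
    _ = (2 + 2 * K) ^ 2 * L ^ 2 * r ^ 2 := by ring
    _ = _ := by rw [hr2, mul_one_div]

theorem exists_lintegral_sq_vonMangoldtError_le (hRH : RiemannHypothesis) : ∃ C : ℝ, 0 < C ∧
    ∀ L η ξ : ℝ, 4 ≤ L → 0 < η → η ≤ ξ → ξ ≤ 4 → Real.exp (-L) ≤ η / ξ / 64 →
      Real.exp (-L) ≤ ξ → L ^ 2 * η ≤ 16 →
      ∫⁻ u in Set.Icc ξ (2 * ξ), ENNReal.ofReal (‖vonMangoldtError (η - u * Complex.I)‖ ^ 2) ≤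
        ENNReal.ofReal (C * L ^ 2 * ξ / η) := by
  obtain ⟨C₁, hC₁, h1⟩ := exists_lintegral_sq_integral_re_logDeriv_le hRH
  obtain ⟨C₂, hC₂, h2⟩ := exists_norm_integral_conj_logDeriv_le hRH
  refine ⟨48 + 192 * C₂ ^ 2 + 3 * C₁, by positivity, fun L η ξ hL hη hξ hξ4 hLκ hLξ hLη => ?_⟩
  have hξ0 : 0 < ξ := hη.trans_le hξ
  have hκ0 : 0 < η / ξ := by positivity
  have hpt : ∀ u ∈ Set.Icc ξ (2 * ξ),
      ENNReal.ofReal (‖vonMangoldtError (η - u * Complex.I)‖ ^ 2) ≤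
      ENNReal.ofReal (12 + 6 * C₂ ^ 2 * L ^ 2 * (L ^ 2 + 4 * (ξ / η))) + ENNReal.ofReal 3 *
      ENNReal.ofReal (‖∫ t : ℝ,
        ((logDeriv riemannZeta₁ ((1 / 2 + 1 / L : ℝ) + t * Complex.I)).re : ℂ) *
          gammaKernel (η - u * Complex.I) ((1 / 2 + 1 / L : ℝ) + t * Complex.I)‖ ^ 2) := by
    intro u hu
    have hu0 : 0 < u := hξ0.trans_le hu.1
    have hz : 0 < (η - u * Complex.I : ℂ).re := by simpa using hη
    have hφ := (argGap_sub_mul_I_mem hη hξ hu).1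
    have hn := le_norm_sub_mul_I η u
    have hL0 : 0 < 1 / L := by positivity
    have hL1 : 1 / L ≤ 1 / 4 := by gcongr
    have b1 := norm_vonMangoldtError_le hRH hz (c := 1 / 2 + 1 / L) (by linarith) (by linarith)
    have b2 := h2 L (by linarith) _ hz (by linarith) (by linarith [hu.1])
    rw [integral_zetaKernel_eq hRH hz (by linarith)] at b1
    rw [← ENNReal.ofReal_mul (by norm_num), ← ENNReal.ofReal_add (by positivity) (by positivity)]
    apply ENNReal.ofReal_le_ofReal
    set φ := argGap (η - u * Complex.I)
    have hφ0 : 0 < φ := by linarith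
    have b3 : (1 / √φ) ^ 2 ≤ 4 * (ξ / η) := by
      rw [div_pow, one_pow, Real.sq_sqrt hφ0.le, div_le_iff₀ hφ0]
      calc (1 : ℝ) = 4 * (ξ / η) * (η / ξ / 4) := by field_simp
        _ ≤ _ := by gcongr
    generalize (∫ t : ℝ, ((logDeriv riemannZeta₁ ((1 / 2 + 1 / L : ℝ) + t * Complex.I)).re : ℂ) *
      gammaKernel (η - u * Complex.I) ((1 / 2 + 1 / L : ℝ) + t * Complex.I)) = I₁ at b1 ⊢
    generalize (∫ t : ℝ, (starRingEnd ℂ)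
      (logDeriv riemannZeta₁ ((1 / 2 + 1 / L : ℝ) + t * Complex.I)) *
      gammaKernel (η - u * Complex.I) ((1 / 2 + 1 / L : ℝ) + t * Complex.I)) = I₂ at b1 b2
    have b4 : ‖2 * I₁ - I₂‖ ≤ 2 * ‖I₁‖ + ‖I₂‖ := by
      refine (norm_sub_le _ _).trans_eq ?_
      rw [norm_mul, Complex.norm_ofNat]
    have b5 : ‖I₂‖ ^ 2 ≤ 2 * C₂ ^ 2 * L ^ 2 * (L ^ 2 + 4 * (ξ / η)) := by
      calc _ ≤ (C₂ * L * (L + 1 / √φ)) ^ 2 := by gcongr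
        _ = C₂ ^ 2 * L ^ 2 * (L + 1 / √φ) ^ 2 := by ring
        _ ≤ C₂ ^ 2 * L ^ 2 * (2 * (L ^ 2 + 4 * (ξ / η))) := by
          gcongr
          nlinarith [sq_nonneg (L - 1 / √φ)]
        _ = _ := by ring
    calc _ ≤ (2 + ‖I₁‖ + ‖I₂‖) ^ 2 := by
          gcongr
          linarith [norm_nonneg I₁, norm_nonneg I₂]
      _ ≤ 12 + 3 * ‖I₁‖ ^ 2 + 3 * ‖I₂‖ ^ 2 := by
          nlinarith [sq_nonneg (2 - ‖I₁‖), sq_nonneg (2 - ‖I₂‖), sq_nonneg (‖I₁‖ - ‖I₂‖)]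
      _ ≤ _ := by linarith
  refine (MeasureTheory.setLIntegral_mono' measurableSet_Icc hpt).trans ?_
  rw [MeasureTheory.lintegral_add_left measurable_const, MeasureTheory.setLIntegral_const,
    MeasureTheory.lintegral_const_mul' _ _ ENNReal.ofReal_ne_top, Real.volume_Icc]
  refine (add_le_add_right (mul_le_mul_right (h1 L η ξ hL hη hξ hLκ hLξ) _) _).trans ?_
  rw [← ENNReal.ofReal_mul (by positivity), ← ENNReal.ofReal_mul (by norm_num),
    ← ENNReal.ofReal_add (mul_nonneg (by positivity) (by linarith)) (by positivity)]
  apply ENNReal.ofReal_le_ofReal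
  have hη4 : η ≤ 4 := hξ.trans hξ4
  have e1 : 12 * ξ ≤ 48 * L ^ 2 * ξ / η := by
    rw [le_div_iff₀ hη]
    have : 12 * η ≤ 48 * L ^ 2 := by nlinarith
    nlinarith
  have e2 : L ^ 2 * L ^ 2 * ξ ≤ 16 * L ^ 2 * ξ / η := by
    rw [le_div_iff₀ hη]
    have : 0 < L ^ 2 * ξ := by positivity
    nlinarith
  have e3 : L ^ 2 * (4 * (ξ / η)) * ξ ≤ 16 * L ^ 2 * ξ / η := by
    calc _ ≤ L ^ 2 * (4 * (ξ / η)) * 4 := by gcongr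
      _ = _ := by ring
  have e4 := mul_le_mul_of_nonneg_left (add_le_add e2 e3) (by positivity : 0 ≤ 6 * C₂ ^ 2)
  calc _ = 12 * ξ + 6 * C₂ ^ 2 * (L ^ 2 * L ^ 2 * ξ + L ^ 2 * (4 * (ξ / η)) * ξ) +
        3 * (C₁ * L ^ 2 * ξ / η) := by ring
    _ ≤ 48 * L ^ 2 * ξ / η + 6 * C₂ ^ 2 * (16 * L ^ 2 * ξ / η + 16 * L ^ 2 * ξ / η) +
        3 * (C₁ * L ^ 2 * ξ / η) := by linarith
    _ = _ := by ring

theorem setLIntegral_Icc_le_sum_dyadic (f : ℝ → ENNReal) {η : ℝ} (hη : 0 ≤ η) (K : ℕ) :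
    ∫⁻ u in Set.Icc 0 (2 ^ K * η), f u ≤ (∫⁻ u in Set.Icc 0 η, f u) +
      ∑ k ∈ range K, ∫⁻ u in Set.Icc (2 ^ k * η) (2 * (2 ^ k * η)), f u := by
  induction K with
  | zero => simp
  | succ K ih =>
    rw [sum_range_succ, ← add_assoc]
    have h : Set.Icc 0 (2 ^ (K + 1) * η) ⊆
        Set.Icc 0 (2 ^ K * η) ∪ Set.Icc (2 ^ K * η) (2 * (2 ^ K * η)) := by
      rw [Set.Icc_union_Icc_eq_Icc (by positivity) (by linarith [show 0 ≤ 2 ^ K * η by positivity]),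
        pow_succ]
      exact Set.Icc_subset_Icc_right (by linarith)
    exact (MeasureTheory.lintegral_mono_set h).trans
      ((MeasureTheory.lintegral_union_le _ _ _).trans (add_le_add_left ih _))

theorem log_sq_le_four_mul {x : ℝ} (hx : 1 ≤ x) : Real.log x ^ 2 ≤ 4 * x := by
  have h0 : 0 ≤ x := by linarith
  have h1 : Real.log x ≤ 2 * √x := by
    have h2 := Real.log_le_sub_one_of_pos (Real.sqrt_pos.mpr (by linarith : 0 < x))
    rw [Real.log_sqrt h0] at h2
    linarith
  calc _ ≤ (2 * √x) ^ 2 := by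
        have := Real.log_nonneg hx
        gcongr
    _ = _ := by rw [mul_pow, Real.sq_sqrt h0]; norm_num

theorem exists_lintegral_weighted_sq_vonMangoldtError_le (hRH : RiemannHypothesis) :
    ∃ C : ℝ, 0 < C ∧ ∃ N₀ : ℕ, ∀ N : ℕ, N₀ ≤ N → ∀ w : ℝ → ℝ, (∀ u, 0 ≤ w u) → (∀ u, w u ≤ N) →
      (∀ u, 0 < u → w u ≤ Real.pi / u) →
      ∫⁻ u in Set.Icc 0 Real.pi, ENNReal.ofReal
        (w u * ‖vonMangoldtError ((1 / N : ℝ) - u * Complex.I)‖ ^ 2) ≤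
        ENNReal.ofReal (C * N * Real.log N ^ 3) := by
  obtain ⟨C₁, hC₁, h1⟩ := exists_norm_sq_vonMangoldtError_le hRH
  obtain ⟨C₂, hC₂, h2⟩ := exists_lintegral_sq_vonMangoldtError_le hRH
  refine ⟨16 * (C₁ + Real.pi * C₂), by positivity, 256, fun N hN w hw0 hwN hwπ => ?_⟩
  have hN' : (256 : ℝ) ≤ N := by exact_mod_cast hN
  have hN0 : (0 : ℝ) < N := by linarith
  have hlog : 2 ≤ Real.log N := by
    rw [Real.le_log_iff_exp_le hN0]
    have : Real.exp 2 = Real.exp 1 ^ 2 := by rw [← Real.exp_nat_mul]; norm_num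
    rw [this]
    nlinarith [Real.exp_one_lt_d9, Real.exp_one_gt_d9]
  set L : ℝ := 2 * Real.log N with hL
  have hL4 : 4 ≤ L := by linarith
  set η : ℝ := 1 / N with hη
  have hη0 : 0 < η := by positivity
  have hη1 : η ≤ 1 / 256 := by rw [hη]; gcongr
  have hLη : L ^ 2 * η ≤ 16 := by
    have := log_sq_le_four_mul (x := N) (by linarith)
    rw [hη, mul_one_div, div_le_iff₀ hN0, hL]
    linarith
  have hexp : Real.exp (-L) = η * η := by
    rw [hL, Real.exp_neg, mul_comm, Real.exp_mul, Real.exp_log hN0, hη]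
    norm_num
    ring
  have hzre : ∀ u : ℝ, (η - u * Complex.I : ℂ).re = η := fun u => by simp
  set B : ℝ := (C₁ + Real.pi * C₂) * L ^ 2 * N with hB
  set f : ℝ → ENNReal := fun u => ENNReal.ofReal
    (w u * ‖vonMangoldtError (η - u * Complex.I)‖ ^ 2) with hf
  have hsmall : ∫⁻ u in Set.Icc 0 η, f u ≤ ENNReal.ofReal B := by
    have hpt : ∀ u ∈ Set.Icc 0 η, f u ≤ ENNReal.ofReal (N * (C₁ * L ^ 2 * N)) := by
      intro u hu
      apply ENNReal.ofReal_le_ofReal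
      have hn := norm_le_add_of_sub_mul_I hη0.le hu.1
      have hn' : η ≤ ‖(η - u * Complex.I : ℂ)‖ := by
        have := (le_abs_self _).trans (Complex.abs_re_le_norm (η - u * Complex.I : ℂ))
        rwa [hzre] at this
      have := h1 L hL4 (η - u * Complex.I) (by rw [hzre]; exact hη0)
        (by rw [hzre]; linarith [hu.2]) (by rw [hexp]; nlinarith) (by linarith [hu.2])
      calc _ ≤ N * (C₁ * L ^ 2 / ‖(η - u * Complex.I : ℂ)‖) := by
            gcongr
            exact hwN u
        _ ≤ N * (C₁ * L ^ 2 / η) := by gcongr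
        _ = _ := by rw [hη, div_div_eq_mul_div, div_one]
    refine (MeasureTheory.setLIntegral_mono' measurableSet_Icc hpt).trans ?_
    rw [MeasureTheory.setLIntegral_const, Real.volume_Icc, ← ENNReal.ofReal_mul (by positivity)]
    apply ENNReal.ofReal_le_ofReal
    calc _ = C₁ * L ^ 2 * N * (N * η) := by ring
      _ = C₁ * L ^ 2 * N := by rw [hη, mul_one_div_cancel hN0.ne', mul_one]
      _ ≤ _ := by
        rw [hB]
        gcongr
        have := Real.pi_pos
        linarith [mul_pos this hC₂]
  set K := Nat.log 2 N + 3 with hK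
  have hdy : ∀ k ∈ range K, ∫⁻ u in Set.Icc (2 ^ k * η) (2 * (2 ^ k * η)), f u ≤
      ENNReal.ofReal B := by
    intro k hk
    set ξ : ℝ := 2 ^ k * η with hξ
    have hηξ : η ≤ ξ := le_mul_of_one_le_left hη0.le (one_le_pow₀ (by norm_num))
    have hξ0 : 0 < ξ := hη0.trans_le hηξ
    have hξ4 : ξ ≤ 4 := by
      have hk' : k ≤ Nat.log 2 N + 2 := by
        rw [mem_range] at hk
        omega
      have : 2 ^ k ≤ N * 4 := (Nat.pow_le_pow_right (by norm_num) hk').trans (by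
        rw [pow_add]
        exact Nat.mul_le_mul_right _ (Nat.pow_log_le_self 2 (by omega)))
      have h3 : (2 : ℝ) ^ k ≤ N * 4 := by exact_mod_cast this
      rw [hξ, hη, mul_one_div, div_le_iff₀ hN0]
      linarith
    have hpt : ∀ u ∈ Set.Icc ξ (2 * ξ), f u ≤ ENNReal.ofReal (Real.pi / ξ) *
        ENNReal.ofReal (‖vonMangoldtError (η - u * Complex.I)‖ ^ 2) := by
      intro u hu
      rw [← ENNReal.ofReal_mul (by positivity)]
      apply ENNReal.ofReal_le_ofReal
      gcongr
      refine (hwπ u (hξ0.trans_le hu.1)).trans ?_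
      have := hu.1
      have := Real.pi_pos
      gcongr
    refine (MeasureTheory.setLIntegral_mono' measurableSet_Icc hpt).trans ?_
    rw [MeasureTheory.lintegral_const_mul' _ _ ENNReal.ofReal_ne_top]
    refine (mul_le_mul_right (h2 L η ξ hL4 hη0 hηξ hξ4 ?_ ?_ hLη) _).trans ?_
    · rw [hexp, div_div, le_div_iff₀ (by positivity)]
      nlinarith [mul_pos hη0 hη0]
    · rw [hexp]
      nlinarith
    · rw [← ENNReal.ofReal_mul (by positivity)]
      apply ENNReal.ofReal_le_ofReal
      calc _ = Real.pi * C₂ * L ^ 2 * (1 / η) * (ξ / ξ) := by ring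
        _ = Real.pi * C₂ * L ^ 2 * N := by
          rw [hη, one_div_one_div, div_self hξ0.ne', mul_one]
        _ ≤ _ := by
          rw [hB]
          gcongr
          linarith
  have hπK : Real.pi ≤ 2 ^ K * η := by
    have h3 : N * 4 ≤ 2 ^ K := by
      have := (Nat.lt_pow_succ_log_self (b := 2) (by norm_num) N).le
      calc N * 4 ≤ 2 ^ (Nat.log 2 N).succ * 4 := Nat.mul_le_mul_right _ this
        _ = 2 ^ K := by rw [hK, Nat.succ_eq_add_one]; ring
    have h4 : (N : ℝ) * 4 ≤ 2 ^ K := by exact_mod_cast h3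
    rw [hη, mul_one_div, le_div_iff₀ hN0]
    nlinarith [Real.pi_lt_four]
  have hKlog : (1 + K : ℝ) ≤ 4 * Real.log N := by
    have h3 : (2 : ℝ) ^ (Nat.log 2 N) ≤ N := by
      exact_mod_cast Nat.pow_log_le_self 2 (by omega : N ≠ 0)
    have h4 := Real.log_le_log (by positivity) h3
    rw [Real.log_pow] at h4
    have h5 := Real.log_two_gt_d9
    have h6 : (0 : ℝ) ≤ (Nat.log 2 N : ℕ) := Nat.cast_nonneg _
    rw [hK]
    push_cast
    nlinarith
  calc ∫⁻ u in Set.Icc 0 Real.pi, f u ≤ ∫⁻ u in Set.Icc 0 (2 ^ K * η), f u :=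
        MeasureTheory.lintegral_mono_set (Set.Icc_subset_Icc_right hπK)
    _ ≤ (∫⁻ u in Set.Icc 0 η, f u) +
        ∑ k ∈ range K, ∫⁻ u in Set.Icc (2 ^ k * η) (2 * (2 ^ k * η)), f u :=
        setLIntegral_Icc_le_sum_dyadic f hη0.le K
    _ ≤ ENNReal.ofReal B + ∑ _k ∈ range K, ENNReal.ofReal B :=
        add_le_add hsmall (sum_le_sum hdy)
    _ = ENNReal.ofReal ((1 + K) * B) := by
        rw [sum_const, card_range, nsmul_eq_mul, ENNReal.ofReal_mul (p := 1 + K) (by positivity),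
          ENNReal.ofReal_add (by norm_num) (by positivity), ENNReal.ofReal_one,
          ENNReal.ofReal_natCast, add_mul, one_mul]
    _ ≤ _ := by
        apply ENNReal.ofReal_le_ofReal
        calc _ ≤ 4 * Real.log N * B := by gcongr
          _ = _ := by rw [hB, hL]; ring

theorem norm_T_le_card (y : ℕ) (α : ℝ) : ‖T y α‖ ≤ y := by
  refine (norm_sum_le_of_le _ (fun n _ => le_of_eq ?_ : ∀ n ∈ Icc 1 y, _ ≤ (1 : ℝ))).trans_eq
    (by simp)
  rw [show 2 * (Real.pi : ℂ) * Complex.I * n * α = (2 * Real.pi * n * α : ℝ) * Complex.I by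
    push_cast; ring, Complex.norm_exp_ofReal_mul_I]

theorem T_neg (y : ℕ) (α : ℝ) : T y (-α) = (starRingEnd ℂ) (T y α) := by
  simp only [T, map_sum, ← Complex.exp_conj]
  refine sum_congr rfl fun n _ => ?_
  congr 1
  simp [Complex.conj_ofNat]

theorem norm_T_le_div {u : ℝ} (hu : 0 < u) (hu' : u ≤ Real.pi) (y : ℕ) :
    ‖T y (u / (2 * Real.pi))‖ ≤ Real.pi / u := by
  set q : ℂ := Complex.exp (Complex.I * u) with hq
  have hπ := Real.pi_pos
  have hqn : ‖q‖ = 1 := by rw [hq, mul_comm, Complex.norm_exp_ofReal_mul_I]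
  have hT : T y (u / (2 * Real.pi) : ℝ) = q * ∑ n ∈ range y, q ^ n := by
    rw [T, mul_sum, ← Finset.Ico_add_one_right_eq_Icc, sum_Ico_eq_sum_range, add_tsub_cancel_right]
    refine sum_congr rfl fun n _ => ?_
    rw [← pow_succ', hq, ← Complex.exp_nat_mul]
    congr 1
    have : (Real.pi : ℂ) ≠ 0 := by exact_mod_cast hπ.ne'
    push_cast
    field_simp
    ring
  have hsin : 2 * u / Real.pi ≤ ‖q - 1‖ := by
    have := Real.mul_le_sin (x := u / 2) (by positivity) (by linarith)
    rw [hq, Complex.norm_exp_I_mul_ofReal_sub_one, Real.norm_eq_abs]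
    refine le_trans ?_ (le_abs_self _)
    calc _ = 2 * (2 / Real.pi * (u / 2)) := by ring
      _ ≤ _ := by gcongr
  have hgeom : ‖∑ n ∈ range y, q ^ n‖ * ‖q - 1‖ ≤ 2 := by
    rw [← norm_mul, geom_sum_mul]
    refine (norm_sub_le _ _).trans_eq ?_
    rw [norm_pow, hqn, one_pow, norm_one]
    norm_num
  rw [hT, norm_mul, hqn, one_mul, le_div_iff₀ hu]
  have h := (mul_le_mul_of_nonneg_left hsin (norm_nonneg (∑ n ∈ range y, q ^ n))).trans hgeom
  rw [mul_div_assoc', div_le_iff₀ hπ] at h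
  linarith

theorem vonMangoldtError_conj (z : ℂ) :
    vonMangoldtError ((starRingEnd ℂ) z) = (starRingEnd ℂ) (vonMangoldtError z) := by
  simp only [vonMangoldtError, map_sub, Complex.conj_tsum, map_mul, ← Complex.exp_conj, map_div₀,
    map_neg, map_one, Complex.conj_ofReal, map_natCast]

theorem Stilde_sub_eq (N : ℕ) (α : ℝ) : Stilde N α - 1 / zOf N α =
    vonMangoldtError ((1 / N : ℝ) - (2 * Real.pi * α : ℝ) * Complex.I) := by
  have hz : zOf N α = (1 / N : ℝ) - (2 * Real.pi * α : ℝ) * Complex.I := by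
    rw [zOf]
    push_cast
    ring
  rw [vonMangoldtError, ← hz, Stilde]
  congr 1
  refine tsum_congr fun n => ?_
  rw [vM, mul_assoc, Complex.ofReal_exp, ← Complex.exp_add, zOf]
  congr 2
  push_cast
  ring

theorem setLIntegral_Icc_neg_half_half_le {f : ℝ → ENNReal} (hf : ∀ α, f (-α) = f α) :
    ∫⁻ α in Set.Icc (-(1 / 2)) (1 / 2), f α ≤
      2 * ∫⁻ u in Set.Icc 0 Real.pi, f (u / (2 * Real.pi)) := by
  have hπ := Real.pi_pos
  have key : ∀ a : ℝ, a ≠ 0 → |a| ≤ 1 → ∫⁻ α in (fun u => a * u) '' Set.Icc 0 Real.pi, f α ≤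
      ∫⁻ u in Set.Icc 0 Real.pi, f (a * u) := by
    intro a ha ha1
    rw [MeasureTheory.lintegral_image_eq_lintegral_abs_deriv_mul measurableSet_Icc
      (f := fun u => a * u)
      (fun u _ => (hasDerivAt_const_mul a).hasDerivWithinAt)
      (mul_right_injective₀ ha).injOn]
    refine MeasureTheory.setLIntegral_mono' measurableSet_Icc fun u _ => ?_
    exact mul_le_of_le_one_left zero_le (ENNReal.ofReal_le_one.mpr ha1)
  have ha : |1 / (2 * Real.pi)| ≤ 1 := by
    rw [abs_of_pos (by positivity), div_le_one (by positivity)]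
    linarith [Real.pi_gt_three]
  have hsub : Set.Icc (-(1 / 2)) (1 / 2) ⊆
      ((fun u => 1 / (2 * Real.pi) * u) '' Set.Icc 0 Real.pi) ∪
        ((fun u => -(1 / (2 * Real.pi)) * u) '' Set.Icc 0 Real.pi) := by
    intro α hα
    rcases le_total 0 α with h | h
    · refine Or.inl ⟨2 * Real.pi * α, ⟨by positivity, ?_⟩, by field_simp⟩
      nlinarith [hα.2]
    · refine Or.inr ⟨2 * Real.pi * (-α), ⟨mul_nonneg (by positivity) (by linarith), ?_⟩,
        by field_simp⟩
      nlinarith [hα.1]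
  have h1 := key _ (by positivity) ha
  have h2 := key (-(1 / (2 * Real.pi))) (neg_ne_zero.mpr (by positivity)) (by rwa [abs_neg])
  simp only [neg_mul, hf, one_div_mul_eq_div] at h1 h2
  refine (MeasureTheory.lintegral_mono_set hsub).trans
    ((MeasureTheory.lintegral_union_le _ _ _).trans ?_)
  simp only [neg_mul, one_div_mul_eq_div]
  exact (add_le_add h1 h2).trans_eq (two_mul _).symm

theorem I3_estimate (hRH : RiemannHypothesis) :
    ∃ C : ℝ, 0 < C ∧ ∃ N₀ : ℕ, ∀ N : ℕ, N₀ ≤ N →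
      ∀ y : ℕ, Real.sqrt N ≤ y → y ≤ N →
        (∫ α in (-(1/2 : ℝ))..(1/2 : ℝ), ‖T y (-α)‖ * ‖Stilde N α - 1 / zOf N α‖ ^ 2)
          ≤ C * N * Real.log N ^ 2 * Real.log y := by
  obtain ⟨C, hC, N₀, h⟩ := exists_lintegral_weighted_sq_vonMangoldtError_le hRH
  refine ⟨4 * C, by positivity, max N₀ 1, fun N hN y hy hyN => ?_⟩
  have hN1 : 1 ≤ N := (le_max_right _ _).trans hN
  have hN0 : (0 : ℝ) < N := by exact_mod_cast hN1
  have hπ := Real.pi_pos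
  set F : ℝ → ℝ := fun α => ‖T y (-α)‖ * ‖Stilde N α - 1 / zOf N α‖ ^ 2 with hF
  have hF0 : ∀ α, 0 ≤ F α := fun α => by positivity
  have hFneg : ∀ α, F (-α) = F α := by
    intro α
    have h1 : Stilde N (-α) - 1 / zOf N (-α) =
        (starRingEnd ℂ) (Stilde N α - 1 / zOf N α) := by
      rw [Stilde_sub_eq, Stilde_sub_eq, ← vonMangoldtError_conj]
      congr 1
      simp [Complex.conj_ofNat]
    rw [hF]
    simp only
    rw [h1, RCLike.norm_conj, T_neg y α, T_neg y (-α), RCLike.norm_conj, T_neg y α,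
      RCLike.norm_conj]
  have hlog : Real.log N ≤ 2 * Real.log y := by
    have := Real.log_le_log (Real.sqrt_pos.mpr hN0) hy
    rw [Real.log_sqrt hN0.le] at this
    linarith
  set w : ℝ → ℝ := fun u => if u ≤ Real.pi then ‖T y (u / (2 * Real.pi))‖ else 0 with hw
  have hw0 : ∀ u, 0 ≤ w u := fun u => by
    simp only [hw]
    split_ifs <;> positivity
  have hwN : ∀ u, w u ≤ N := fun u => by
    simp only [hw]
    split_ifs
    · exact (norm_T_le_card y _).trans (by exact_mod_cast hyN)
    · exact hN0.le
  have hwπ : ∀ u, 0 < u → w u ≤ Real.pi / u := fun u hu => by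
    simp only [hw]
    split_ifs with hu'
    · exact norm_T_le_div hu hu' y
    · positivity
  have hmain : ∫⁻ u in Set.Icc 0 Real.pi, ENNReal.ofReal (F (u / (2 * Real.pi))) ≤
      ENNReal.ofReal (C * N * Real.log N ^ 3) := by
    refine le_of_eq_of_le (MeasureTheory.setLIntegral_congr_fun measurableSet_Icc fun u hu => ?_)
      (h N ((le_max_left _ _).trans hN) w hw0 hwN hwπ)
    simp only [hF, hw]
    rw [if_pos hu.2, Stilde_sub_eq, T_neg, RCLike.norm_conj,
      mul_div_cancel₀ u (by positivity : 2 * Real.pi ≠ 0)]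
  have hlogN := Real.log_nonneg (by exact_mod_cast hN1 : (1 : ℝ) ≤ N)
  calc ∫ α in (-(1 / 2 : ℝ))..(1 / 2 : ℝ), F α
      = ∫ α in Set.Ioc (-(1 / 2 : ℝ)) (1 / 2), F α :=
        intervalIntegral.integral_of_le (by norm_num)
    _ ≤ ENNReal.toReal (∫⁻ α in Set.Ioc (-(1 / 2 : ℝ)) (1 / 2), ENNReal.ofReal ‖F α‖) :=
        (Real.le_norm_self _).trans (MeasureTheory.norm_integral_le_lintegral_norm _)
    _ ≤ 2 * (C * N * Real.log N ^ 3) := by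
        refine ENNReal.toReal_le_of_le_ofReal (by positivity) ?_
        simp only [Real.norm_of_nonneg (hF0 _)]
        refine (MeasureTheory.lintegral_mono_set Set.Ioc_subset_Icc_self).trans ?_
        refine (setLIntegral_Icc_neg_half_half_le fun α => by rw [hFneg]).trans ?_
        rw [ENNReal.ofReal_mul (by norm_num), ENNReal.ofReal_ofNat]
        exact mul_le_mul_right hmain _
    _ = 2 * C * N * Real.log N ^ 2 * Real.log N := by ring
    _ ≤ 2 * C * N * Real.log N ^ 2 * (2 * Real.log y) := by gcongr
    _ = _ := by ring
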